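/- Every edge coloring of the complete graph on 17 vertices in three colors contains at least 5 monochromatic triangles. Precisely: for every symmetric function c : Fin 17 → Fin 17 → Fin 3, the number of 3-element subsets {x, y, z} of Fin 17 with c x y = c y z = c x z is at least 5. -/

import Mathlib

namespace K17

/-! ## A verified backtracking search on bit masks

Vertices are encoded by the marks of a Golomb ruler, so that the edge `{p, q}` is encoded by the
bit `p + q`. A state consists of the known edges `G0 G1 G2` in each colour, the edges `D0 D1 D2`
still allowed in each colour, and the set `U` of undecided edges. -/

noncomputable section

/-- The marks of the Golomb ruler. -/
def RL : List ℕ := [0, 1, 4, 11, 26, 32, 56, 68, 76, 115, 117, 134, 150, 163, 168, 177]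

/-- The bit mask of the ruler. -/
def SP : ℕ := 191947780467760936650333846651042330318810871257630739

/-- Lookup table from edge bits to the two marks. -/
def TBL : ℕ := 9534595306751142846833480545860854633221721337014592654049126485682286257562707369757751410688744138718585124625516476221988381407088744763537949052309425140177519007854373849167665807185396460083853612245404205909123304599384269630897842831157318589654990617632975726126694143738041551914282285672011312759936141878733737491075735859430763837491743072207953977468514746834987523119081010870674561622664211349327855971112281340047573284881931064240487537937805905250801671806034689222006729572318699651192350089787911022214085087416245210569612228954020178887267206778707751195812046752569758757410251610930504339542399754139386099371617546605602858421226891688677829410816668593076788462215111266663589641455657628887241683983711638608667159263794039927966206228742589369839159529291979704700682533377711154463559347366942647832797460926655318016849763124830142045604924052615619992292411336094279796552547027980260881520870089411619627680554410677894820835259756544807758439018981782895429147257221410679873745808462636696931996511537514076878719344832389671738736288130995124226706209000600978875078696765091050027611686406227547672431225133831749006177853222774842558701909900411492778379477972444933272471331908766186482234971828241350447031963612844719697791022453232622867597119357939186961565576847200360932825823322710409031633991968259664174910616934788716041993770296620215391921682486075671788202778800677192017013081141871083615006598770183609480361452622867971340148188023248556659692134133008233361710346172912876933480328271425693214953015196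87762446579082815954244777792030570733015107063105723572098042554547766221100708979361001153599917185480366489600

/-- A search procedure: `true` means that the state is refuted. -/
abbrev St := ℕ → ℕ → ℕ → ℕ → ℕ → ℕ → ℕ → Bool

/-- The two marks of an edge bit. -/
def look (b : ℕ) : ℕ := Nat.shiftRight TBL (Nat.shiftLeft (Nat.mod b 347) 4)
/-- The lowest bit. -/
def low (t : ℕ) : ℕ := Nat.xor t (Nat.land t (Nat.sub t 1))
/-- Edges closing a triangle with the new edge `b`, together with `b`. -/
def XX (G fx fy b : ℕ) : ℕ :=
  Nat.lor (Nat.lor (Nat.shiftLeft (Nat.land (Nat.shiftRight G fx) SP) fy)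
    (Nat.shiftLeft (Nat.land (Nat.shiftRight G fy) SP) fx)) b
/-- Difference of bit masks. -/
def nd (D X : ℕ) : ℕ := Nat.xor (Nat.lor D X) X

/-- Branching on the edge `b`. -/
def ch (K0 K1 K2 : St) (G0 G1 G2 D0 D1 D2 U fx fy b U' : ℕ) : Bool :=
  Bool.rec (motive := fun _ => Bool)
    (Bool.rec (motive := fun _ => Bool) false
      (Bool.rec (motive := fun _ => Bool) false
        (Bool.rec (motive := fun _ => Bool)
          (K2 G0 G1 (Nat.lor G2 b) (Nat.land D0 U') (Nat.land D1 U') (nd D2 (XX G2 fx fy b)) U')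
          true (Nat.beq (Nat.land D2 b) 0))
        (Bool.rec (motive := fun _ => Bool)
          (K1 G0 (Nat.lor G1 b) G2 (Nat.land D0 U') (nd D1 (XX G1 fx fy b)) (Nat.land D2 U') U')
          true (Nat.beq (Nat.land D1 b) 0)))
      (Bool.rec (motive := fun _ => Bool)
        (K0 (Nat.lor G0 b) G1 G2 (nd D0 (XX G0 fx fy b)) (Nat.land D1 U') (Nat.land D2 U') U')
        true (Nat.beq (Nat.land D0 b) 0)))
    false (Nat.beq (Nat.land U b) 0)
/-- Auxiliary step of `nod`. -/
def nod2 (K0 K1 K2 : St) (G0 G1 G2 D0 D1 D2 U fx fy b : ℕ) : Bool :=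
  ch K0 K1 K2 G0 G1 G2 D0 D1 D2 U fx fy b (Nat.xor U b)
/-- Auxiliary step of `nod`. -/
def nod1 (K0 K1 K2 : St) (G0 G1 G2 D0 D1 D2 U fx fy : ℕ) : Bool :=
  nod2 K0 K1 K2 G0 G1 G2 D0 D1 D2 U fx fy (Nat.shiftLeft 1 (Nat.add fx fy))
/-- Branching on the edge with table entry `v`. -/
def nod (K0 K1 K2 : St) (v G0 G1 G2 D0 D1 D2 U : ℕ) : Bool :=
  nod1 K0 K1 K2 G0 G1 G2 D0 D1 D2 U (Nat.land v 255) (Nat.land (Nat.shiftRight v 8) 255)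
/-- The default choice of a branching edge. -/
def pick (D0 D1 D2 U : ℕ) : ℕ :=
  Bool.rec (motive := fun _ => ℕ) (Nat.xor U (Nat.land (Nat.land D0 D1) D2)) U
    (Nat.beq (Nat.xor U (Nat.land (Nat.land D0 D1) D2)) 0)
/-- Either assign a forced edge, or go on with `K`. -/
def st3 (ih K : St) (G0 G1 G2 D0 D1 D2 U t : ℕ) : Bool :=
  Bool.rec (motive := fun _ => Bool) (nod ih ih ih (look (low t)) G0 G1 G2 D0 D1 D2 U)
    (K G0 G1 G2 D0 D1 D2 U) (Nat.beq t 0)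
/-- Close the state if some edge has no colour left. -/
def st2 (ih K : St) (G0 G1 G2 D0 D1 D2 U o : ℕ) : Bool :=
  Bool.rec (motive := fun _ => Bool) true
    (st3 ih K G0 G1 G2 D0 D1 D2 U (Nat.xor U (Nat.lor (Nat.land D0 D1) (Nat.land D2 o))))
    (Nat.beq (Nat.land (Nat.lor o D2) U) U)
/-- One step. -/
def stp (ih K : St) : St :=
  fun G0 G1 G2 D0 D1 D2 U => st2 ih K G0 G1 G2 D0 D1 D2 U (Nat.lor D0 D1)
/-- Branch on the default edge. -/
def brd (ih : St) : St :=
  fun G0 G1 G2 D0 D1 D2 U => nod ih ih ih (look (low (pick D0 D1 D2 U))) G0 G1 G2 D0 D1 D2 U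
/-- The default search. -/
def search (fuel : ℕ) : St :=
  Nat.rec (motive := fun _ => St) (fun _ _ _ _ _ _ _ => false) (fun _ ih => stp ih (brd ih)) fuel
/-- Unit propagation, followed by `K`. -/
def prp (K : St) (fuel : ℕ) : St :=
  Nat.rec (motive := fun _ => St) (fun _ _ _ _ _ _ _ => false) (fun _ ih => stp ih K) fuel

/-- Search trees: `n s t0 t1 t2` branches on the edge with bit index `s`. -/
inductive Tr : Type
  | l : Tr
  | n : ℕ → Tr → Tr → Tr → Tr

/-- Search guided by a tree. -/
def runT (t : Tr) : St :=
  Tr.rec (motive := fun _ => St) (search 200)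
    (fun s _ _ _ a b c => prp (nod a b c (look (Nat.shiftLeft 1 s))) 200) t

/-! ### Soundness -/

theorem sidon : ∀ a ∈ RL, ∀ b ∈ RL, ∀ c ∈ RL, ∀ d ∈ RL,
    a + b = c + d → (a = c ∧ b = d) ∨ (a = d ∧ b = c) := by decide +kernel

theorem SP_spec (s : ℕ) (h : SP.testBit s = true) : s ∈ RL := by
  by_cases hs : s < 200
  · have : ∀ s < 200, SP.testBit s = true → s ∈ RL := by decide +kernel
    exact this s hs h
  · have h2 : SP < 2 ^ s := lt_of_lt_of_le (by decide +kernel : SP < 2 ^ 200)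
      (Nat.pow_le_pow_right (by norm_num) (by omega))
    rw [Nat.testBit_lt_two_pow h2] at h
    exact absurd h (by simp)

theorem look_spec (b : ℕ) : Nat.land (look b) 255 ∈ RL ∧
    Nat.land (Nat.shiftRight (look b) 8) 255 ∈ RL := by
  have : ∀ r < 347, Nat.land (Nat.shiftRight TBL (Nat.shiftLeft r 4)) 255 ∈ RL ∧
    Nat.land (Nat.shiftRight (Nat.shiftRight TBL (Nat.shiftLeft r 4)) 8) 255 ∈ RL := by
    decide +kernel
  exact this (b % 347) (Nat.mod_lt _ (by norm_num))

/-- The hypotheses on the colouring `d` of pairs of marks: no monochromatic triangle with two edges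
in `E` and the third one in `W`. -/
def Hyp (d : ℕ → ℕ → ℕ) (E W : ℕ) : Prop :=
  (∀ p q, d p q = d q p) ∧ (∀ p q, d p q < 3) ∧
  (∀ s, E.testBit s = true → ∃ p ∈ RL, ∃ q ∈ RL, p ≠ q ∧ s = p + q) ∧
  (∀ s, E.testBit s = true → W.testBit s = true) ∧
  ∀ p ∈ RL, ∀ q ∈ RL, ∀ r ∈ RL, p ≠ q → p ≠ r → q ≠ r →
    E.testBit (p + q) = true → E.testBit (p + r) = true → W.testBit (q + r) = true →
    d p q = d p r → d p q = d q r → False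

/-- The invariant for one colour. -/
def InvC (d : ℕ → ℕ → ℕ) (W c G D U : ℕ) : Prop :=
  (∀ s, G.testBit s = true → W.testBit s = true) ∧
  ∀ p ∈ RL, ∀ q ∈ RL, p ≠ q → (G.testBit (p + q) = true → d p q = c) ∧
    (U.testBit (p + q) = true → d p q = c → D.testBit (p + q) = true)

/-- The invariant of a state. -/
def Inv (d : ℕ → ℕ → ℕ) (E W G0 G1 G2 D0 D1 D2 U : ℕ) : Prop :=
  (∀ s, U.testBit s = true → E.testBit s = true) ∧
  InvC d W 0 G0 D0 U ∧ InvC d W 1 G1 D1 U ∧ InvC d W 2 G2 D2 U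

/-- Soundness of a search procedure. -/
def Good (K : St) : Prop :=
  ∀ d E W, Hyp d E W → ∀ G0 G1 G2 D0 D1 D2 U, K G0 G1 G2 D0 D1 D2 U = true →
    ¬ Inv d E W G0 G1 G2 D0 D1 D2 U

theorem bit_b (s i : ℕ) : (Nat.shiftLeft 1 s).testBit i = true ↔ i = s := by
  change (1 <<< s).testBit i = true ↔ _
  rw [Nat.one_shiftLeft, Nat.testBit_two_pow]
  simp [eq_comm]

theorem xor_b {U s : ℕ} (hU : U.testBit s = true) (i : ℕ) :
    (Nat.xor U (Nat.shiftLeft 1 s)).testBit i = true ↔ U.testBit i = true ∧ i ≠ s := by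
  change (U ^^^ Nat.shiftLeft 1 s).testBit i = true ↔ _
  rw [Nat.testBit_xor]
  have := bit_b s i
  by_cases h : i = s
  · subst h
    rw [this.2 rfl, hU]; simp
  · have h' : (Nat.shiftLeft 1 s).testBit i = false := by
      rw [← Bool.not_eq_true, this]; exact h
    rw [h']; simp [h]

theorem land_b {U s : ℕ} (h : Nat.beq (Nat.land U (Nat.shiftLeft 1 s)) 0 = false) :
    U.testBit s = true := by
  by_contra hc
  have : Nat.land U (Nat.shiftLeft 1 s) = 0 := by
    apply Nat.eq_of_testBit_eq
    intro i
    change (U &&& Nat.shiftLeft 1 s).testBit i = _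
    rw [Nat.testBit_and, Nat.zero_testBit]
    by_cases hi : i = s
    · subst hi; simp [hc]
    · have h' : (Nat.shiftLeft 1 s).testBit i = false := by
        rw [← Bool.not_eq_true, bit_b]; exact hi
      rw [h', Bool.and_false]
  rw [this] at h
  exact absurd h (by decide)

theorem land_b' {D s : ℕ} (h : Nat.beq (Nat.land D (Nat.shiftLeft 1 s)) 0 = true) :
    D.testBit s = false := by
  have h0 : D &&& Nat.shiftLeft 1 s = 0 := Nat.eq_of_beq_eq_true h
  have := congrArg (fun z => z.testBit s) h0
  simp only [Nat.testBit_and, Nat.zero_testBit, (bit_b s s).2 rfl] at this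
  simpa using this

theorem nd_spec (D X i : ℕ) : (nd D X).testBit i = true ↔ D.testBit i = true ∧ X.testBit i = false := by
  change ((D ||| X) ^^^ X).testBit i = true ↔ _
  rw [Nat.testBit_xor, Nat.testBit_or]
  cases D.testBit i <;> cases X.testBit i <;> simp

theorem sh_spec {G x y i : ℕ}
    (h : (Nat.shiftLeft (Nat.land (Nat.shiftRight G x) SP) y).testBit i = true) :
    ∃ z ∈ RL, i = y + z ∧ G.testBit (x + z) = true := by
  change (((G >>> x) &&& SP) <<< y).testBit i = true at h
  rw [Nat.testBit_shiftLeft, Nat.testBit_and, Nat.testBit_shiftRight] at h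
  simp only [Bool.and_eq_true, decide_eq_true_eq, ge_iff_le] at h
  exact ⟨i - y, SP_spec _ h.2.2, by omega, h.2.1⟩

theorem XX_spec {G x y b i : ℕ} (h : (XX G x y b).testBit i = true) :
    (∃ z ∈ RL, i = y + z ∧ G.testBit (x + z) = true) ∨
    (∃ z ∈ RL, i = x + z ∧ G.testBit (y + z) = true) ∨ b.testBit i = true := by
  change ((_ ||| _) ||| b).testBit i = true at h
  rw [Nat.testBit_or, Nat.testBit_or, Bool.or_eq_true, Bool.or_eq_true] at h
  rcases h with (h | h) | h
  · exact Or.inl (sh_spec h)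
  · exact Or.inr (Or.inl (sh_spec h))
  · exact Or.inr (Or.inr h)

theorem invC_other {d : ℕ → ℕ → ℕ} {W c G D U U' : ℕ} (h : InvC d W c G D U)
    (hU : ∀ s, U'.testBit s = true → U.testBit s = true) : InvC d W c G (Nat.land D U') U' := by
  refine ⟨h.1, fun p hp q hq hpq => ⟨(h.2 p hp q hq hpq).1, fun h1 h2 => ?_⟩⟩
  change (D &&& U').testBit (p + q) = true
  rw [Nat.testBit_and, h1, (h.2 p hp q hq hpq).2 (hU _ h1) h2]
  rfl

theorem invC_same {d : ℕ → ℕ → ℕ} {E W c G D U x y : ℕ} (H : Hyp d E W)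
    (hUE : ∀ s, U.testBit s = true → E.testBit s = true)
    (h : InvC d W c G D U) (hx : x ∈ RL) (hy : y ∈ RL) (hxy : x ≠ y)
    (hb : U.testBit (x + y) = true) (hc : d x y = c) :
    InvC d W c (Nat.lor G (Nat.shiftLeft 1 (x + y)))
      (nd D (XX G x y (Nat.shiftLeft 1 (x + y)))) (Nat.xor U (Nat.shiftLeft 1 (x + y))) := by
  obtain ⟨hs, h3, hE, hEW, ht⟩ := H
  have aux : ∀ x ∈ RL, ∀ y ∈ RL, x ≠ y → U.testBit (x + y) = true → d x y = c →
      ∀ p ∈ RL, ∀ q ∈ RL, p ≠ q → U.testBit (p + q) = true → p + q ≠ x + y → d p q = c →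
      ∀ z ∈ RL, p + q = y + z → G.testBit (x + z) = true → False := by
    intro x hx y hy hxy hb hc p hp q hq hpq hU hne hdc z hz e hG
    have hyz : y ≠ z := by
      rcases sidon p hp q hq y hy z hz e with ⟨h1, h2⟩ | ⟨h1, h2⟩ <;> subst h1 <;> subst h2 <;>
        first | exact hpq | exact hpq.symm
    have hdyz : d y z = c := by
      rcases sidon p hp q hq y hy z hz e with ⟨h1, h2⟩ | ⟨h1, h2⟩
      · rw [← h1, ← h2]; exact hdc
      · rw [← h1, ← h2, hs]; exact hdc
    have hxz : x ≠ z := by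
      intro hh; apply hne; rw [e, hh, add_comm]
    have hd := (h.2 x hx z hz hxz).1 hG
    refine ht y hy x hx z hz hxy.symm hyz hxz ?_ ?_ (h.1 _ hG) ?_ ?_
    · rw [add_comm]; exact hUE _ hb
    · rw [← e]; exact hUE _ hU
    · rw [hs y x, hc, hdyz]
    · rw [hs y x, hc, hd]
  constructor
  · intro s h1
    change (G ||| _).testBit s = true at h1
    rw [Nat.testBit_or, Bool.or_eq_true, bit_b] at h1
    rcases h1 with h1 | h1
    · exact h.1 s h1
    · subst h1; exact hEW _ (hUE _ hb)
  · intro p hp q hq hpq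
    constructor
    · intro h1
      change (G ||| _).testBit _ = true at h1
      rw [Nat.testBit_or, Bool.or_eq_true, bit_b] at h1
      rcases h1 with h1 | h1
      · exact (h.2 p hp q hq hpq).1 h1
      · rcases sidon p hp q hq x hx y hy h1 with ⟨h1, h2⟩ | ⟨h1, h2⟩
        · rw [h1, h2]; exact hc
        · rw [h1, h2, hs]; exact hc
    · intro h1 h2
      rw [xor_b hb] at h1
      rw [nd_spec]
      refine ⟨(h.2 p hp q hq hpq).2 h1.1 h2, ?_⟩
      rw [← Bool.not_eq_true]
      intro hX
      rcases XX_spec hX with ⟨z, hz, e, hG⟩ | ⟨z, hz, e, hG⟩ | hX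
      · exact aux x hx y hy hxy hb hc p hp q hq hpq h1.1 h1.2 h2 z hz e hG
      · exact aux y hy x hx hxy.symm (by rw [add_comm]; exact hb) (by rw [hs]; exact hc)
          p hp q hq hpq h1.1 (by rw [add_comm y x]; exact h1.2) h2 z hz e hG
      · rw [bit_b] at hX; exact h1.2 hX

theorem brec_true {c a b : Bool} (h : (Bool.rec (motive := fun _ => Bool) a b c : Bool) = true) :
    (c = true ∧ b = true) ∨ (c = false ∧ a = true) := by
  cases c
  · exact Or.inr ⟨rfl, h⟩
  · exact Or.inl ⟨rfl, h⟩

theorem nod_good {K0 K1 K2 : St} (h0 : Good K0) (h1 : Good K1) (h2 : Good K2) (b : ℕ) :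
    Good (nod K0 K1 K2 (look b)) := by
  intro d E W H G0 G1 G2 D0 D1 D2 U hK hI
  obtain ⟨hx, hy⟩ := look_spec b
  unfold nod nod1 nod2 at hK
  generalize Nat.land (look b) 255 = x at hx hK
  generalize Nat.land (Nat.shiftRight (look b) 8) 255 = y at hy hK
  obtain ⟨hUE, i0, i1, i2⟩ := hI
  unfold ch at hK
  rcases brec_true hK with ⟨_, hK⟩ | ⟨hU, hK⟩
  · exact absurd hK (by simp)
  have hb : U.testBit (x + y) = true := land_b hU
  have hxy : x ≠ y := by
    obtain ⟨p, hp, q, hq, hpq, e⟩ := H.2.2.1 _ (hUE _ hb)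
    rintro rfl
    rcases sidon x hx x hx p hp q hq e with ⟨h1, h2⟩ | ⟨h1, h2⟩ <;> exact hpq (by rw [← h1, ← h2])
  have hU' : ∀ s, (Nat.xor U (Nat.shiftLeft 1 (x + y))).testBit s = true → U.testBit s = true :=
    fun s hs => ((xor_b hb s).1 hs).1
  rcases brec_true hK with ⟨k0, hK⟩ | ⟨_, hK⟩
  swap
  · exact absurd hK (by simp)
  rcases brec_true hK with ⟨k1, k2⟩ | ⟨_, hK⟩
  swap
  · exact absurd hK (by simp)
  have hc := H.2.1 x y
  have hcases : d x y = 0 ∨ d x y = 1 ∨ d x y = 2 := by omega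
  rcases hcases with hc | hc | hc
  · rcases brec_true k0 with ⟨hD, _⟩ | ⟨_, k⟩
    · have := (i0.2 x hx y hy hxy).2 hb hc
      have h9 : D0.testBit (x + y) = false := land_b' hD
      rw [h9] at this; exact absurd this (by simp)
    · exact h0 d E W H _ _ _ _ _ _ _ k ⟨fun s hs => hUE s (hU' s hs),
        invC_same H hUE i0 hx hy hxy hb hc, invC_other i1 hU', invC_other i2 hU'⟩
  · rcases brec_true k1 with ⟨hD, _⟩ | ⟨_, k⟩
    · have := (i1.2 x hx y hy hxy).2 hb hc
      have h9 : D1.testBit (x + y) = false := land_b' hD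
      rw [h9] at this; exact absurd this (by simp)
    · exact h1 d E W H _ _ _ _ _ _ _ k ⟨fun s hs => hUE s (hU' s hs),
        invC_other i0 hU', invC_same H hUE i1 hx hy hxy hb hc, invC_other i2 hU'⟩
  · rcases brec_true k2 with ⟨hD, _⟩ | ⟨_, k⟩
    · have := (i2.2 x hx y hy hxy).2 hb hc
      have h9 : D2.testBit (x + y) = false := land_b' hD
      rw [h9] at this; exact absurd this (by simp)
    · exact h2 d E W H _ _ _ _ _ _ _ k ⟨fun s hs => hUE s (hU' s hs),
        invC_other i0 hU', invC_other i1 hU', invC_same H hUE i2 hx hy hxy hb hc⟩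

theorem stp_good {ih K : St} (h0 : Good ih) (h1 : Good K) : Good (stp ih K) := by
  intro d E W H G0 G1 G2 D0 D1 D2 U hK hI
  unfold stp st2 at hK
  rcases brec_true hK with ⟨_, hK⟩ | ⟨hc, _⟩
  · unfold st3 at hK
    rcases brec_true hK with ⟨_, hK⟩ | ⟨_, hK⟩
    · exact h1 d E W H _ _ _ _ _ _ _ hK hI
    · exact nod_good h0 h0 h0 _ d E W H _ _ _ _ _ _ _ hK hI
  · have hne : (D0 ||| D1 ||| D2) &&& U ≠ U := Nat.ne_of_beq_eq_false hc
    apply hne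
    apply Nat.eq_of_testBit_eq
    intro s
    obtain ⟨hUE, i0, i1, i2⟩ := hI
    rw [Nat.testBit_and, Nat.testBit_or, Nat.testBit_or]
    cases hs : U.testBit s
    · simp
    · obtain ⟨p, hp, q, hq, hpq, e⟩ := H.2.2.1 _ (hUE _ hs)
      subst e
      have hc := H.2.1 p q
      have hcases : d p q = 0 ∨ d p q = 1 ∨ d p q = 2 := by omega
      rcases hcases with hc | hc | hc
      · simp [(i0.2 p hp q hq hpq).2 hs hc]
      · simp [(i1.2 p hp q hq hpq).2 hs hc]
      · simp [(i2.2 p hp q hq hpq).2 hs hc]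

theorem false_good : Good (fun _ _ _ _ _ _ _ => false) :=
  fun _ _ _ _ _ _ _ _ _ _ _ h => absurd h (by simp)

theorem search_good (fuel : ℕ) : Good (search fuel) := by
  induction fuel with
  | zero => exact false_good
  | succ k ih =>
    refine stp_good ih ?_
    intro d E W H G0 G1 G2 D0 D1 D2 U hK
    exact nod_good ih ih ih _ d E W H _ _ _ _ _ _ _ hK

theorem prp_good {K : St} (h : Good K) (fuel : ℕ) : Good (prp K fuel) := by
  induction fuel with
  | zero => exact false_good
  | succ k ih => exact stp_good ih h

theorem runT_good (t : Tr) : Good (runT t) := by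
  induction t with
  | l => exact search_good 200
  | n s a b c ha hb hc => exact prp_good (nod_good ha hb hc (Nat.shiftLeft 1 s)) 200

/-! ### Instances of the search -/

/-- The pairs `a < b < n`. -/
def prs (n : ℕ) : List (ℕ × ℕ) :=
  (List.range n).flatMap fun b => (List.range b).map fun a => (a, b)

/-- The bit mask of the selected pairs. -/
def msk (P : List (ℕ × ℕ)) (F : ℕ → ℕ) (q : ℕ → ℕ → Bool) : ℕ :=
  P.foldr (fun p acc => bif q p.1 p.2 then Nat.lor acc (Nat.shiftLeft 1 (F p.1 + F p.2)) else acc) 0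

theorem mem_prs {n a b : ℕ} : (a, b) ∈ prs n ↔ a < b ∧ b < n := by
  simp only [prs, List.mem_flatMap, List.mem_range, List.mem_map, Prod.mk.injEq]
  constructor
  · rintro ⟨b', hb, a', ha, rfl, rfl⟩; exact ⟨ha, hb⟩
  · rintro ⟨h1, h2⟩; exact ⟨b, h2, a, h1, rfl, rfl⟩

theorem msk_spec (P : List (ℕ × ℕ)) (F : ℕ → ℕ) (q : ℕ → ℕ → Bool) (s : ℕ) :
    (msk P F q).testBit s = true ↔ ∃ p ∈ P, q p.1 p.2 = true ∧ s = F p.1 + F p.2 := by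
  induction P with
  | nil => simp [msk]
  | cons p P ih =>
    have e : msk (p :: P) F q = bif q p.1 p.2 then
      Nat.lor (msk P F q) (Nat.shiftLeft 1 (F p.1 + F p.2)) else msk P F q := rfl
    rw [e]
    cases h : q p.1 p.2
    · rw [cond_false, ih]
      simp [h]
    · rw [cond_true]
      change (msk P F q ||| _).testBit s = true ↔ _
      rw [Nat.testBit_or, Bool.or_eq_true, bit_b, ih]
      simp only [List.mem_cons, exists_eq_or_imp, h, true_and]
      exact or_comm

/-- Run the search on an instance: `pt` gives the parts, `kc` the known colours inside parts,
`ok` the edges which are not omitted, `al` the allowed colours across parts. -/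
def chk (n : ℕ) (pt : ℕ → ℕ) (kc : ℕ → ℕ → ℕ) (ok : ℕ → ℕ → Bool) (al : ℕ → ℕ → ℕ → Bool)
    (FL : List ℕ) (t : Tr) : Bool :=
  let F := fun i => FL.getD i 0
  let g := fun c => msk (prs n) F fun a b => Nat.beq (pt a) (pt b) && (ok a b && Nat.beq (kc a b) c)
  let dd := fun c => msk (prs n) F fun a b => !Nat.beq (pt a) (pt b) && (ok a b && al a b c)
  runT t (g 0) (g 1) (g 2) (dd 0) (dd 1) (dd 2)
    (msk (prs n) F fun a b => !Nat.beq (pt a) (pt b) && ok a b)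

/-- Validity of the list of marks. -/
def okF (n : ℕ) (FL : List ℕ) : Bool :=
  decide (n ≤ FL.length) && (decide FL.Nodup && FL.all fun x => decide (x ∈ RL))

theorem chk_sound {V : Type*} (κ : V → V → ℕ) (hs : ∀ x y, κ x y = κ y x) (h3 : ∀ x y, κ x y < 3)
    (w : ℕ → V) (n : ℕ) (pt : ℕ → ℕ) (kc : ℕ → ℕ → ℕ) (ok : ℕ → ℕ → Bool)
    (al : ℕ → ℕ → ℕ → Bool) (FL : List ℕ) (t : Tr) (hF : okF n FL = true)
    (hoks : ∀ a b, ok a b = ok b a)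
    (hin : ∀ a b, a < b → b < n → pt a = pt b → ok a b = true → κ (w a) (w b) = kc a b)
    (hal : ∀ a b, a < b → b < n → pt a ≠ pt b → ok a b = true → al a b (κ (w a) (w b)) = true)
    (hno : ∀ i j k, i < n → j < n → k < n → i ≠ j → i ≠ k → j ≠ k → pt i ≠ pt j → pt i ≠ pt k →
      ok i j = true → ok i k = true → ok j k = true → κ (w i) (w j) = κ (w i) (w k) →
      κ (w i) (w j) = κ (w j) (w k) → False)
    (hc : chk n pt kc ok al FL t = true) : False := by
  unfold okF at hF
  simp only [Bool.and_eq_true, decide_eq_true_eq, List.all_eq_true] at hF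
  obtain ⟨hlen, hnd, hRL⟩ := hF
  unfold chk at hc
  set F := fun i => FL.getD i 0 with hFd
  have hFR : ∀ i < n, F i ∈ RL := by
    intro i hi
    apply hRL
    have : F i = FL[i]'(by omega) := by
      simp only [hFd]; rw [List.getD_eq_getElem]
    rw [this]; exact List.getElem_mem _
  have hidx : ∀ i < n, FL.idxOf (F i) = i := by
    intro i hi
    have : F i = FL[i]'(by omega) := by
      simp only [hFd]; rw [List.getD_eq_getElem]
    rw [this]; exact hnd.idxOf_getElem _ _
  have hFi : ∀ i < n, ∀ j < n, F i = F j → i = j := by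
    intro i hi j hj h
    rw [← hidx i hi, ← hidx j hj, h]
  set d : ℕ → ℕ → ℕ := fun p q => κ (w (FL.idxOf p)) (w (FL.idxOf q)) with hd
  have hdF : ∀ i < n, ∀ j < n, d (F i) (F j) = κ (w i) (w j) := by
    intro i hi j hj; simp only [hd, hidx i hi, hidx j hj]
  -- reading bits
  have key : ∀ (q : ℕ → ℕ → Bool) (p r : ℕ), p ∈ RL → r ∈ RL →
      (msk (prs n) F q).testBit (p + r) = true →
      ∃ a b, a < b ∧ b < n ∧ q a b = true ∧ ((p = F a ∧ r = F b) ∨ (p = F b ∧ r = F a)) := by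
    intro q p r hp hr h
    rw [msk_spec] at h
    obtain ⟨⟨a, b⟩, hab, h1, h2⟩ := h
    rw [mem_prs] at hab
    exact ⟨a, b, hab.1, hab.2, h1,
      sidon p hp r hr _ (hFR a (by omega)) _ (hFR b hab.2) h2⟩
  set qU : ℕ → ℕ → Bool := fun a b => !Nat.beq (pt a) (pt b) && ok a b with hqU
  set qG : ℕ → ℕ → ℕ → Bool := fun c a b => Nat.beq (pt a) (pt b) && (ok a b && Nat.beq (kc a b) c)
    with hqG
  set qD : ℕ → ℕ → ℕ → Bool := fun c a b => !Nat.beq (pt a) (pt b) && (ok a b && al a b c)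
    with hqD
  have hbeq : ∀ a b : ℕ, Nat.beq a b = true ↔ a = b := fun a b => Nat.beq_eq ▸ Iff.rfl
  have hbne : ∀ a b : ℕ, (!Nat.beq a b) = true ↔ a ≠ b := by
    intro a b
    rw [Bool.not_eq_true', ← Bool.not_eq_true, hbeq]
  have eU : ∀ a b, qU a b = true ↔ pt a ≠ pt b ∧ ok a b = true := by
    intro a b; simp only [hqU, Bool.and_eq_true, hbne]
  have eG : ∀ c a b, qG c a b = true ↔ pt a = pt b ∧ ok a b = true ∧ kc a b = c := by
    intro c a b; simp only [hqG, Bool.and_eq_true, hbeq]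
  have eD : ∀ c a b, qD c a b = true ↔ pt a ≠ pt b ∧ ok a b = true ∧ al a b c = true := by
    intro c a b; simp only [hqD, Bool.and_eq_true, hbne]
  set E := msk (prs n) F qU with hE
  set W := msk (prs n) F ok with hW
  have hyp : Hyp d E W := by
    refine ⟨fun p q => hs _ _, fun p q => h3 _ _, ?_, ?_, ?_⟩
    · intro s h
      rw [hE, msk_spec] at h
      obtain ⟨⟨a, b⟩, hab, h1, h2⟩ := h
      rw [mem_prs] at hab
      exact ⟨_, hFR a (by omega), _, hFR b hab.2, fun e => by
        have := hFi a (by omega) b hab.2 e; omega, h2⟩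
    · intro s h
      rw [hE, msk_spec] at h
      obtain ⟨p, hp, h1, h2⟩ := h
      rw [hW, msk_spec]
      exact ⟨p, hp, ((eU _ _).1 h1).2, h2⟩
    · intro p hp q hq r hr hpq hpr hqr h1 h2 h3' m1 m2
      have sy : ∀ p q : ℕ, p ∈ RL → q ∈ RL → E.testBit (p + q) = true → ∃ a b, a < n ∧ b < n ∧ p = F a ∧
          q = F b ∧ pt a ≠ pt b ∧ ok a b = true := by
        intro p q hp hq h
        obtain ⟨a, b, hab, hb, h1, ⟨rfl, rfl⟩ | ⟨rfl, rfl⟩⟩ := key _ p q hp hq h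
        · exact ⟨a, b, by omega, hb, rfl, rfl, (eU _ _).1 h1⟩
        · refine ⟨b, a, hb, by omega, rfl, rfl, Ne.symm ((eU _ _).1 h1).1, ?_⟩
          rw [hoks]; exact ((eU _ _).1 h1).2
      obtain ⟨i, j, hi, hj, rfl, rfl, a1, a2⟩ := sy p q hp hq h1
      obtain ⟨i', k, hi', hk, e, rfl, b1, b2⟩ := sy _ r hp hr h2
      have := hFi _ hi _ hi' e
      subst this
      have hjk : ok j k = true := by
        obtain ⟨a, b, hab, hb, h1, ⟨e1, e2⟩ | ⟨e1, e2⟩⟩ := key _ _ _ hq hr h3'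
        · rw [hFi _ hj _ (by omega) e1, hFi _ hk _ hb e2]; exact h1
        · rw [hFi _ hj _ hb e1, hFi _ hk _ (by omega) e2, hoks]; exact h1
      rw [hdF _ hi _ hj, hdF _ hi _ hk] at m1
      rw [hdF _ hi _ hj, hdF _ hj _ hk] at m2
      exact hno i j k hi hj hk (fun e => hpq (by rw [e])) (fun e => hpr (by rw [e]))
        (fun e => hqr (by rw [e])) a1 b1 a2 b2 hjk m1 m2
  have inv : ∀ c, InvC d W c (msk (prs n) F (qG c)) (msk (prs n) F (qD c)) E := by
    intro c
    constructor
    · intro s h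
      rw [msk_spec] at h
      obtain ⟨p, hp, h1, h2⟩ := h
      rw [hW, msk_spec]
      exact ⟨p, hp, ((eG _ _ _).1 h1).2.1, h2⟩
    · intro p hp q hq hpq
      constructor
      · intro h
        obtain ⟨a, b, hab, hb, h1, h2⟩ := key _ p q hp hq h
        rw [eG] at h1
        have h4 := hin a b hab hb h1.1 h1.2.1
        rcases h2 with ⟨rfl, rfl⟩ | ⟨rfl, rfl⟩
        · rw [hdF _ (by omega) _ hb, h4, h1.2.2]
        · rw [hdF _ hb _ (by omega), hs, h4, h1.2.2]
      · intro h hdc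
        obtain ⟨a, b, hab, hb, h1, h2⟩ := key _ p q hp hq h
        rw [eU] at h1
        have h4 := hal a b hab hb h1.1 h1.2
        rw [msk_spec]
        refine ⟨(a, b), mem_prs.2 ⟨hab, hb⟩, ?_, ?_⟩
        · rw [eD]
          refine ⟨h1.1, h1.2, ?_⟩
          rcases h2 with ⟨rfl, rfl⟩ | ⟨rfl, rfl⟩
          · rw [hdF _ (by omega) _ hb] at hdc
            rw [← hdc]; exact h4
          · rw [hdF _ hb _ (by omega), hs] at hdc
            rw [← hdc]; exact h4
        · rcases h2 with ⟨rfl, rfl⟩ | ⟨rfl, rfl⟩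
          · rfl
          · exact add_comm _ _
  exact runT_good t d E W hyp _ _ _ _ _ _ _ hc ⟨fun _ h => h, inv 0, inv 1, inv 2⟩

/-! ### Instances with three parts -/

/-- The bit of the pair `{a, b}` in the mask `m`. -/
def bt (m a b : ℕ) : Bool :=
  bif Nat.ble a b then Nat.testBit m (b * (b - 1) / 2 + a) else Nat.testBit m (a * (a - 1) / 2 + b)

theorem bt_comm (m a b : ℕ) : bt m a b = bt m b a := by
  unfold bt
  rcases lt_trichotomy a b with h | h | h
  · have h1 : Nat.ble a b = true := Nat.ble_eq_true_of_le h.le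
    have h2 : Nat.ble b a = false := by
      rw [← Bool.not_eq_true, Nat.ble_eq]; omega
    rw [h1, h2]; rfl
  · subst h; rfl
  · have h1 : Nat.ble b a = true := Nat.ble_eq_true_of_le h.le
    have h2 : Nat.ble a b = false := by
      rw [← Bool.not_eq_true, Nat.ble_eq]; omega
    rw [h1, h2]; rfl

/-- The part of an index. -/
def ptf (n1 n2 i : ℕ) : ℕ := bif Nat.blt i n1 then 0 else bif Nat.blt i (n1 + n2) then 1 else 2

/-- The known colours inside the parts. -/
def kcf (n1 n2 m0 m1 m2 a b : ℕ) : ℕ :=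
  bif Nat.blt a n1 then bif bt m0 a b then 2 else 1
  else bif Nat.blt a (n1 + n2) then bif bt m1 (a - n1) (b - n1) then 2 else 0
  else bif bt m2 (a - (n1 + n2)) (b - (n1 + n2)) then 1 else 0

/-- Edges which are not omitted. -/
def okf (om : List (ℕ × ℕ)) (a b : ℕ) : Bool :=
  om.all fun p => !((Nat.beq p.1 a && Nat.beq p.2 b) || (Nat.beq p.1 b && Nat.beq p.2 a))

/-- Allowed colours, for a list of prescribed colours. -/
def alf (fx : List (ℕ × ℕ × ℕ)) (a b c : ℕ) : Bool :=
  fx.all fun p => !(Nat.beq p.1 a && Nat.beq p.2.1 b) || Nat.beq p.2.2 c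

/-- The check of one instance. -/
def icheck (n1 n2 n3 m0 m1 m2 : ℕ) (om : List (ℕ × ℕ)) (fx : List (ℕ × ℕ × ℕ)) (FL : List ℕ)
    (t : Tr) : Bool :=
  okF (n1 + n2 + n3) FL &&
  chk (n1 + n2 + n3) (ptf n1 n2) (kcf n1 n2 m0 m1 m2) (okf om) (alf fx) FL t

/-- The concatenation of three parts. -/
def cat {V : Type} (n1 n2 : ℕ) (x y z : ℕ → V) (i : ℕ) : V :=
  bif Nat.blt i n1 then x i else bif Nat.blt i (n1 + n2) then y (i - n1) else z (i - (n1 + n2))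

/-- The vertex set. -/
abbrev V := Fin 17

/-- `x 0, …, x (k-1)` are distinct neighbours of `u` in colour `c`, and the colouring on them is
given by the mask `m` and the two colours `c0, c1`. -/
def Pt (col : V → V → ℕ) (u : V) (c c0 c1 k m : ℕ) (x : ℕ → V) : Prop :=
  ∀ a < k, col u (x a) = c ∧ ∀ b < k, a ≠ b → x a ≠ x b ∧
    col (x a) (x b) = bif bt m a b then c1 else c0

/-- No monochromatic triangles across the parts in `S`, up to omitted pairs. -/
def NoX (col : V → V → ℕ) (u : V) (S : V → Prop) (Om : V → V → Prop) : Prop :=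
  ∀ p q r, S p → S q → S r → col u p ≠ col u q → col u p ≠ col u r → q ≠ r →
    ¬ Om p q → ¬ Om p r → ¬ Om q r → col p q = col p r → col p q = col q r → False

/-- Membership in the three parts. -/
def In3 (n1 n2 n3 : ℕ) (x y z : ℕ → V) (p : V) : Prop :=
  (∃ a < n1, p = x a) ∨ (∃ a < n2, p = y a) ∨ ∃ a < n3, p = z a

/-- The roles of colours. -/
def rol (c0 c1 t : ℕ) : ℕ := if t = c0 then 0 else if t = c1 then 1 else 2

theorem beq_iff (a b : ℕ) : Nat.beq a b = true ↔ a = b := Nat.beq_eq ▸ Iff.rfl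
theorem blt_t {a b : ℕ} (h : a < b) : Nat.blt a b = true := Nat.ble_eq_true_of_le h
theorem blt_f {a b : ℕ} (h : b ≤ a) : Nat.blt a b = false := by
  rw [← Bool.not_eq_true, Nat.blt, Nat.ble_eq]; omega

theorem idx_cases (n1 n2 n3 i : ℕ) (h : i < n1 + n2 + n3) :
    i < n1 ∨ (∃ j < n2, i = n1 + j) ∨ ∃ j < n3, i = n1 + n2 + j := by
  by_cases h1 : i < n1
  · exact Or.inl h1
  by_cases h2 : i < n1 + n2
  · exact Or.inr (Or.inl ⟨i - n1, by omega, by omega⟩)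
  · exact Or.inr (Or.inr ⟨i - (n1 + n2), by omega, by omega⟩)

section
variable {W : Type} (n1 n2 : ℕ) (x y z : ℕ → W) (m0 m1 m2 : ℕ)
theorem cat0 {i : ℕ} (h : i < n1) : cat n1 n2 x y z i = x i := by simp [cat, blt_t h]
theorem cat1 {i : ℕ} (h : i < n2) : cat n1 n2 x y z (n1 + i) = y i := by
  simp [cat, blt_f (Nat.le_add_right n1 i), blt_t (show n1 + i < n1 + n2 by omega)]
theorem cat2 {i : ℕ} : cat n1 n2 x y z (n1 + n2 + i) = z i := by
  simp [cat, blt_f (show n1 ≤ n1 + n2 + i by omega), blt_f (show n1 + n2 ≤ n1 + n2 + i by omega)]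
theorem pt0 {i : ℕ} (h : i < n1) : ptf n1 n2 i = 0 := by simp [ptf, blt_t h]
theorem pt1 {i : ℕ} (h : i < n2) : ptf n1 n2 (n1 + i) = 1 := by
  simp [ptf, blt_f (Nat.le_add_right n1 i), blt_t (show n1 + i < n1 + n2 by omega)]
theorem pt2 {i : ℕ} : ptf n1 n2 (n1 + n2 + i) = 2 := by
  simp [ptf, blt_f (show n1 ≤ n1 + n2 + i by omega), blt_f (show n1 + n2 ≤ n1 + n2 + i by omega)]
theorem kc0 {i j : ℕ} (h : i < n1) : kcf n1 n2 m0 m1 m2 i j = bif bt m0 i j then 2 else 1 := by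
  simp [kcf, blt_t h]
theorem kc1 {i j : ℕ} (h : i < n2) :
    kcf n1 n2 m0 m1 m2 (n1 + i) (n1 + j) = bif bt m1 i j then 2 else 0 := by
  simp [kcf, blt_f (Nat.le_add_right n1 i), blt_t (show n1 + i < n1 + n2 by omega)]
theorem kc2 {i j : ℕ} :
    kcf n1 n2 m0 m1 m2 (n1 + n2 + i) (n1 + n2 + j) = bif bt m2 i j then 1 else 0 := by
  simp [kcf, blt_f (show n1 ≤ n1 + n2 + i by omega), blt_f (show n1 + n2 ≤ n1 + n2 + i by omega)]
end

/-- A symmetric colouring in three colours, and three distinct colours. -/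
structure Ctx (col : V → V → ℕ) (c0 c1 c2 : ℕ) : Prop where
  sym : ∀ a b, col a b = col b a
  lt : ∀ a b, col a b < 3
  h0 : c0 < 3
  h1 : c1 < 3
  h2 : c2 < 3
  h01 : c0 ≠ c1
  h02 : c0 ≠ c2
  h12 : c1 ≠ c2

theorem inst_sound {col : V → V → ℕ} {c0 c1 c2 : ℕ} (C : Ctx col c0 c1 c2) (u : V)
    {n1 n2 n3 m0 m1 m2 : ℕ} {om : List (ℕ × ℕ)} {fx : List (ℕ × ℕ × ℕ)} {FL : List ℕ} {t : Tr}
    {x y z : ℕ → V} (hx : Pt col u c0 c1 c2 n1 m0 x) (hy : Pt col u c1 c0 c2 n2 m1 y)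
    (hz : Pt col u c2 c0 c1 n3 m2 z)
    (hno : NoX col u (In3 n1 n2 n3 x y z) (fun p q => ∃ e ∈ om,
      (p = cat n1 n2 x y z e.1 ∧ q = cat n1 n2 x y z e.2) ∨
      (p = cat n1 n2 x y z e.2 ∧ q = cat n1 n2 x y z e.1)))
    (hfx : ∀ e ∈ fx, rol c0 c1 (col (cat n1 n2 x y z e.1) (cat n1 n2 x y z e.2.1)) = e.2.2)
    (hom : ∀ e ∈ om, e.1 < n1 + n2 + n3 ∧ e.2 < n1 + n2 + n3)
    (h : icheck n1 n2 n3 m0 m1 m2 om fx FL t = true) : False := by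
  unfold icheck at h
  rw [Bool.and_eq_true] at h
  obtain ⟨hF, h⟩ := h
  have r0 : rol c0 c1 c0 = 0 := by simp [rol]
  have r1 : rol c0 c1 c1 = 1 := by simp [rol, C.h01.symm]
  have r2 : rol c0 c1 c2 = 2 := by simp [rol, C.h02.symm, C.h12.symm]
  have hrol : ∀ a b, a < 3 → b < 3 → rol c0 c1 a = rol c0 c1 b → a = b := by
    obtain ⟨_, _, h0, h1, h2, h01, h02, h12⟩ := C
    intro a b ha hb
    have k : ∀ a < 3, a = c0 ∨ a = c1 ∨ a = c2 := by
      intro a ha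
      interval_cases c0 <;> interval_cases c1 <;> interval_cases c2 <;> omega
    rcases k a ha with h | h | h <;> rcases k b hb with h' | h' | h' <;> rw [h, h'] <;>
      simp only [r0, r1, r2] <;> simp
  set w := cat n1 n2 x y z with hw
  -- colour to `u` by part
  have hu : ∀ i < n1 + n2 + n3, rol c0 c1 (col u (w i)) = ptf n1 n2 i := by
    intro i hi
    rcases idx_cases n1 n2 n3 i hi with h | ⟨j, h, rfl⟩ | ⟨j, h, rfl⟩
    · rw [hw, cat0 _ _ _ _ _ h, (hx i h).1, pt0 _ _ h, r0]
    · rw [hw, cat1 _ _ _ _ _ h, (hy j h).1, pt1 _ _ h, r1]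
    · rw [hw, cat2, (hz j h).1, pt2, r2]
  have hin : ∀ i < n1 + n2 + n3, In3 n1 n2 n3 x y z (w i) := by
    intro i hi
    rcases idx_cases n1 n2 n3 i hi with h | ⟨j, h, rfl⟩ | ⟨j, h, rfl⟩
    · exact Or.inl ⟨i, h, by rw [hw, cat0 _ _ _ _ _ h]⟩
    · exact Or.inr (Or.inl ⟨j, h, by rw [hw, cat1 _ _ _ _ _ h]⟩)
    · exact Or.inr (Or.inr ⟨j, h, by rw [hw, cat2]⟩)
  have hsame : ∀ i < n1 + n2 + n3, ∀ j < n1 + n2 + n3, i ≠ j → ptf n1 n2 i = ptf n1 n2 j →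
      w i ≠ w j ∧ rol c0 c1 (col (w i) (w j)) = kcf n1 n2 m0 m1 m2 i j := by
    intro i hi j hj hij
    rcases idx_cases n1 n2 n3 i hi with h | ⟨i', h, rfl⟩ | ⟨i', h, rfl⟩ <;>
    rcases idx_cases n1 n2 n3 j hj with h' | ⟨j', h', rfl⟩ | ⟨j', h', rfl⟩
    · intro _
      rw [hw, cat0 _ _ _ _ _ h, cat0 _ _ _ _ _ h', kc0 _ _ _ _ _ h]
      refine ⟨((hx i h).2 j h' hij).1, ?_⟩
      rw [((hx i h).2 j h' hij).2]
      cases bt m0 i j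
      · exact r1
      · exact r2
    · rw [pt0 _ _ h, pt1 _ _ h']; intro h; omega
    · rw [pt0 _ _ h, pt2]; intro h; omega
    · rw [pt0 _ _ h', pt1 _ _ h]; intro h; omega
    · intro _
      have hij : i' ≠ j' := by omega
      rw [hw, cat1 _ _ _ _ _ h, cat1 _ _ _ _ _ h', kc1 _ _ _ _ _ h]
      refine ⟨((hy _ h).2 _ h' hij).1, ?_⟩
      rw [((hy _ h).2 _ h' hij).2]
      cases bt m1 i' j'
      · exact r0
      · exact r2
    · rw [pt1 _ _ h, pt2]; intro h; omega
    · rw [pt0 _ _ h', pt2]; intro h; omega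
    · rw [pt1 _ _ h', pt2]; intro h; omega
    · intro _
      have hij : i' ≠ j' := by omega
      rw [hw, cat2, cat2, kc2]
      refine ⟨((hz _ h).2 _ h' hij).1, ?_⟩
      rw [((hz _ h).2 _ h' hij).2]
      cases bt m2 i' j'
      · exact r0
      · exact r1
  have hne : ∀ i < n1 + n2 + n3, ∀ j < n1 + n2 + n3, i ≠ j → w i ≠ w j := by
    intro i hi j hj hij e
    refine (hsame i hi j hj hij ?_).1 e
    rw [← hu i hi, ← hu j hj, e]
  have hok : ∀ i j, okf om i j = true ↔ ∀ e ∈ om, ¬ ((e.1 = i ∧ e.2 = j) ∨ (e.1 = j ∧ e.2 = i)) := by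
    intro i j
    simp only [okf, List.all_eq_true, Bool.not_eq_true', ← Bool.not_eq_true, Bool.or_eq_true,
      Bool.and_eq_true, beq_iff]
  have hOm : ∀ i < n1 + n2 + n3, ∀ j < n1 + n2 + n3, okf om i j = true →
      ¬ ∃ e ∈ om, (w i = w e.1 ∧ w j = w e.2) ∨ (w i = w e.2 ∧ w j = w e.1) := by
    rintro i hi j hj h ⟨e, he, h'⟩
    have hinj : ∀ i < n1 + n2 + n3, ∀ j < n1 + n2 + n3, w i = w j → i = j := by
      intro i hi j hj e
      by_contra hc
      exact hne i hi j hj hc e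
    refine (hok i j).1 h e he ?_
    obtain ⟨b1, b2⟩ := hom e he
    rcases h' with ⟨e1, e2⟩ | ⟨e1, e2⟩
    · exact Or.inl ⟨(hinj _ hi _ b1 e1).symm, (hinj _ hj _ b2 e2).symm⟩
    · exact Or.inr ⟨(hinj _ hj _ b1 e2).symm, (hinj _ hi _ b2 e1).symm⟩
  have hcol : ∀ i < n1 + n2 + n3, ∀ j < n1 + n2 + n3, ptf n1 n2 i ≠ ptf n1 n2 j →
      col u (w i) ≠ col u (w j) := by
    intro i hi j hj h e
    apply h
    rw [← hu i hi, ← hu j hj, e]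
  refine chk_sound (fun a b => rol c0 c1 (col a b)) (fun a b => by simp only [C.sym a b])
    (fun a b => by simp only [rol]; split_ifs <;> omega) w _ _ _ _ _ FL t hF ?_ ?_ ?_ ?_ h
  · intro a b
    rw [Bool.eq_iff_iff, hok, hok]
    simp only [or_comm]
  · intro a b hab hb hp _
    exact (hsame a (by omega) b hb (by omega) hp).2
  · intro a b hab hb _ _
    simp only [alf, List.all_eq_true, Bool.or_eq_true, Bool.not_eq_true', ← Bool.not_eq_true,
      Bool.and_eq_true, beq_iff]
    intro e he
    by_cases h : e.1 = a ∧ e.2.1 = b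
    · right; rw [← hfx e he, h.1, h.2]
    · exact Or.inl h
  · intro i j k hi hj hk hij hik hjk p1 p2 o1 o2 o3 e1 e2
    exact hno (w i) (w j) (w k) (hin i hi) (hin j hj) (hin k hk) (hcol i hi j hj p1)
      (hcol i hi k hk p2) (hne j hj k hk hjk) (hOm i hi j hj o1) (hOm i hi k hk o2)
      (hOm j hj k hk o3) (hrol _ _ (C.lt _ _) (C.lt _ _) e1) (hrol _ _ (C.lt _ _) (C.lt _ _) e2)

/-! ### Symmetry breaking on a pentagon -/

/-- The automorphisms of the pentagon with mask `236`. -/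
def D5 : List (List ℕ) := [[0, 1, 2, 3, 4], [0, 2, 1, 4, 3], [1, 0, 3, 2, 4], [1, 3, 0, 4, 2],
  [2, 0, 4, 1, 3], [2, 4, 0, 3, 1], [3, 1, 4, 0, 2], [3, 4, 1, 2, 0], [4, 2, 3, 0, 1],
  [4, 3, 2, 1, 0]]

theorem D5_spec : ∀ s ∈ D5, ∀ a < 5, s.getD a 0 < 5 ∧ ∀ b < 5, a ≠ b → s.getD a 0 ≠ s.getD b 0 ∧
    bt 236 (s.getD a 0) (s.getD b 0) = bt 236 a b := by decide +kernel

theorem D5_surj : ∀ s ∈ D5, ∀ a < 5, ∃ b < 5, s.getD b 0 = a := by decide +kernel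

/-- Rows on the pentagon without monochromatic triangles. -/
def rval (r : List ℕ) : Bool :=
  (List.range 5).all fun b => (List.range b).all fun a =>
    !(Nat.beq (r.getD a 0) (r.getD b 0) && Nat.beq (r.getD a 0) (bif bt 236 a b then 2 else 0))

/-- `R` represents all valid rows up to symmetry. -/
def rowsOK (R : List (List ℕ)) : Prop :=
  ∀ a < 3, ∀ b < 3, ∀ c < 3, ∀ d < 3, ∀ e < 3, rval [a, b, c, d, e] = true →
    (D5.any fun s => decide (s.map (fun i => [a, b, c, d, e].getD i 0) ∈ R)) = true

/-- The prescribed colours for a row. -/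
def rfix (n1 v : ℕ) (r : List ℕ) : List (ℕ × ℕ × ℕ) :=
  (List.range 5).map fun b => (v, n1 + b, r.getD b 0)

/-- The check of an instance, for all rows. -/
def rcheck (n1 n3 m0 m2 v : ℕ) (R : List (List ℕ)) (FL : List ℕ) (ts : List Tr) : Bool :=
  Nat.beq R.length ts.length && (Nat.blt v n1 &&
    (R.zip ts).all fun p => icheck n1 5 n3 m0 236 m2 [] (rfix n1 v p.1) FL p.2)

theorem rows_sound {col : V → V → ℕ} {c0 c1 c2 : ℕ} (C : Ctx col c0 c1 c2) (u : V)
    {n1 n3 m0 m2 v : ℕ} {R : List (List ℕ)} {FL : List ℕ} {ts : List Tr}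
    {x y z : ℕ → V} (hx : Pt col u c0 c1 c2 n1 m0 x) (hy : Pt col u c1 c0 c2 5 236 y)
    (hz : Pt col u c2 c0 c1 n3 m2 z)
    (hno : NoX col u (In3 n1 5 n3 x y z) (fun _ _ => False))
    (hR : rowsOK R) (h : rcheck n1 n3 m0 m2 v R FL ts = true) : False := by
  unfold rcheck at h
  rw [Bool.and_eq_true, Bool.and_eq_true, beq_iff, List.all_eq_true] at h
  obtain ⟨hl, hv, h⟩ := h
  have hv : v < n1 := Nat.le_of_ble_eq_true hv
  have r0 : rol c0 c1 c0 = 0 := by simp [rol]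
  have r2 : rol c0 c1 c2 = 2 := by simp [rol, C.h02.symm, C.h12.symm]
  have h3 : ∀ t, rol c0 c1 t < 3 := by intro t; simp only [rol]; split_ifs <;> omega
  set ρ : ℕ → ℕ := fun b => rol c0 c1 (col (x v) (y b)) with hρ
  have hget : ∀ b < 5, [ρ 0, ρ 1, ρ 2, ρ 3, ρ 4].getD b 0 = ρ b := by
    intro b hb; interval_cases b <;> rfl
  have hinj : ∀ a b, a < 3 → b < 3 → rol c0 c1 a = rol c0 c1 b → a = b := by
    obtain ⟨_, _, h0, h1, h2, h01, h02, h12⟩ := C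
    intro a b ha hb
    have k : ∀ a < 3, a = c0 ∨ a = c1 ∨ a = c2 := by
      intro a ha
      interval_cases c0 <;> interval_cases c1 <;> interval_cases c2 <;> omega
    have r1 : rol c0 c1 c1 = 1 := by simp [rol, h01.symm]
    rcases k a ha with h | h | h <;> rcases k b hb with h' | h' | h' <;> rw [h, h'] <;>
      simp only [r0, r1, r2] <;> simp
  have hval : rval [ρ 0, ρ 1, ρ 2, ρ 3, ρ 4] = true := by
    unfold rval
    simp only [List.all_eq_true, List.mem_range, Bool.not_eq_true', ← Bool.not_eq_true,
      Bool.and_eq_true, beq_iff]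
    intro b hb a ha ⟨e1, e2⟩
    rw [hget a (by omega)] at e1 e2
    rw [hget b hb] at e1
    have hab := (hy a (by omega)).2 b hb (by omega)
    have e3 : ρ a = rol c0 c1 (col (y a) (y b)) := by
      rw [hab.2, e2]; cases bt 236 a b
      · exact r0.symm
      · exact r2.symm
    refine hno (x v) (y a) (y b) (Or.inl ⟨v, hv, rfl⟩) (Or.inr (Or.inl ⟨a, by omega, rfl⟩))
      (Or.inr (Or.inl ⟨b, hb, rfl⟩)) ?_ ?_ hab.1 id id id ?_ ?_
    · rw [(hx v hv).1, (hy a (by omega)).1]; exact C.h01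
    · rw [(hx v hv).1, (hy b hb).1]; exact C.h01
    · exact hinj _ _ (C.lt _ _) (C.lt _ _) e1
    · exact hinj _ _ (C.lt _ _) (C.lt _ _) e3
  have hR' := hR _ (h3 _) _ (h3 _) _ (h3 _) _ (h3 _) _ (h3 _) hval
  obtain ⟨s, hs, hsR⟩ := List.any_eq_true.1 hR'
  rw [decide_eq_true_eq] at hsR
  obtain ⟨i, hi, hiR⟩ := List.getElem_of_mem hsR
  have hz' := h (R[i], ts[i]'(by omega)) (by
    have : (R.zip ts)[i]'(by simp; omega) = (R[i], ts[i]'(by omega)) := by simp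
    rw [← this]; exact List.getElem_mem _)
  have hsp := D5_spec s hs
  refine inst_sound C u (y := fun b => y (s.getD b 0)) hx ?_ hz ?_ ?_ ?_ hz'
  · intro a ha
    refine ⟨(hy _ (hsp a ha).1).1, fun b hb hab => ?_⟩
    have h4 := (hsp a ha).2 b hb hab
    have h5 := (hy _ (hsp a ha).1).2 _ (hsp b hb).1 h4.1
    exact ⟨h5.1, by rw [h5.2, h4.2]⟩
  · have hIn : ∀ p, In3 n1 5 n3 x (fun b => y (s.getD b 0)) z p → In3 n1 5 n3 x y z p := by
      rintro p (h | ⟨a, ha, rfl⟩ | h)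
      · exact Or.inl h
      · exact Or.inr (Or.inl ⟨_, (hsp a ha).1, rfl⟩)
      · exact Or.inr (Or.inr h)
    intro p q r hp hq hr a1 a2 a3 _ _ _ a4 a5
    exact hno p q r (hIn p hp) (hIn q hq) (hIn r hr) a1 a2 a3 id id id a4 a5
  · intro e he
    simp only [rfix, List.mem_map, List.mem_range] at he
    obtain ⟨b, hb, rfl⟩ := he
    simp only [cat0 _ _ _ _ _ hv, cat1 _ _ _ _ _ hb]
    rw [hiR]
    have hlen : s.length = 5 := (by decide : ∀ s ∈ D5, s.length = 5) s hs
    have : (s.map fun i => [ρ 0, ρ 1, ρ 2, ρ 3, ρ 4].getD i 0).getD b 0 = ρ (s.getD b 0) := by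
      rw [List.getD_eq_getElem _ _ (by simpa [hlen] using hb), List.getElem_map,
        List.getD_eq_getElem s 0 (by omega), hget]
      have := (hsp b hb).1
      rwa [List.getD_eq_getElem s 0 (by omega)] at this
    rw [this]
  · simp

/-- Representatives of the valid rows. -/
def R1 : List (List ℕ) := [[0, 1, 1, 0, 1], [0, 1, 1, 0, 2], [0, 1, 1, 1, 1], [0, 1, 1, 1, 2],
  [0, 1, 1, 2, 2], [0, 1, 2, 0, 2], [0, 1, 2, 1, 0], [0, 1, 2, 1, 1], [0, 1, 2, 1, 2],
  [1, 1, 1, 1, 1], [1, 1, 1, 1, 2], [1, 1, 1, 2, 2]]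

/-- Another list of representatives. -/
def R2 : List (List ℕ) := [[0, 2, 1, 0, 1], [0, 2, 1, 2, 0], [0, 2, 1, 2, 1], [0, 2, 1, 1, 0],
  [0, 2, 1, 1, 1], [0, 1, 1, 0, 1], [0, 1, 1, 2, 2], [0, 1, 1, 2, 1], [0, 1, 1, 1, 1],
  [2, 2, 1, 1, 1], [2, 1, 1, 1, 1], [1, 1, 1, 1, 1]]

set_option synthInstance.maxSize 2000 in
set_option synthInstance.maxHeartbeats 400000 in
theorem R1_ok : rowsOK R1 := by unfold rowsOK; decide +kernel
set_option synthInstance.maxSize 2000 in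
set_option synthInstance.maxHeartbeats 400000 in
theorem R2_ok : rowsOK R2 := by unfold rowsOK; decide +kernel

/-! ### The instances -/

section
open Tr

theorem iL2_1880_1 : rcheck 6 3 3440 1 2 R1
    [163, 117, 134, 150, 56, 11, 168, 1, 26, 177, 76, 0, 4, 68]
    [l, n 179 l (n 12 (n 239 (n 143 (n 193 l (n 327 (n 76 l l l) l l) l) l l) (n 189 (n 118 (n 294
      l (n 233 (n 176 l (n 143 l l (n 76 l l l)) l) l l) l) l l) l l) l) l l) l, l, l, n 12 (n 179
      l (n 37 (n 188 l l (n 87 l l (n 164 (n 202 l l l) l (n 202 l l l)))) l l) l) l l, n 12 (n 132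
      (n 340 l (n 239 (n 285 l (n 143 (n 224 (n 327 (n 202 (n 134 l l l) l (n 218 l l l)) l l) l l)
      l l) l) l l) l) (n 331 l (n 189 (n 294 l (n 193 (n 233 (n 318 (n 202 (n 138 l l l) l (n 218 l
      l l)) l l) l l) l l) l) l l) l) l) l l, l, l, l, l, l, l] = true := by decide +kernel

theorem iL2_1880_3 : rcheck 6 3 3440 3 2 R1
    [117, 177, 56, 150, 115, 11, 68, 1, 26, 168, 76, 0, 4, 134]
    [l, n 79 l (n 12 (n 193 (n 203 (n 253 l (n 318 (n 76 l l l) l l) l) l l) (n 143 (n 178 (n 345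
      l (n 283 (n 176 l (n 203 l l (n 76 l l l)) l) l l) l) l l) l l) l) l l) l, l, l, n 12 (n 79 l
      (n 37 (n 179 l l (n 87 l l (n 118 (n 76 l l l) l (n 76 l l l)))) l l) l) l l, n 12 (n 176 (n
      285 l (n 193 (n 245 l (n 203 (n 183 (n 318 (n 60 (n 210 (n 251 l l l) (n 160 l l l) l) l l) l
      l) l l) l l) l) l l) l) (n 185 l (n 143 (n 345 l (n 253 (n 283 (n 218 (n 60 (n 210 (n 311 l l
      l) (n 160 l l l) l) l l) l l) l l) l l) l) l l) l) l) l l, l, l, l, l, l, l] = true := by decide +kernel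

theorem iL2_1884_1 : rcheck 6 3 3448 1 2 R1
    [163, 134, 56, 150, 76, 11, 168, 1, 26, 115, 68, 0, 4, 117]
    [l, l, l, l, l, l, l, l, l, l, l, l] = true := by decide +kernel

theorem iL2_1884_3 : rcheck 6 3 3448 3 1 R1
    [56, 177, 68, 117, 76, 168, 32, 1, 163, 26, 134, 0, 4, 11]
    [l, l, l, l, l, l, l, l, l, l, l, l] = true := by decide +kernel

theorem iL2_2012_1 : rcheck 6 3 3576 1 0 R1
    [177, 168, 150, 76, 163, 68, 26, 1, 115, 0, 56, 4, 32, 117]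
    [n 169 l l l, l, l, l, l, l, l, l, l, l, l, l] = true := by decide +kernel

theorem iL2_2012_3 : rcheck 6 3 3576 3 1 R1
    [76, 177, 117, 134, 168, 26, 68, 1, 115, 163, 4, 0, 11, 150]
    [l, l, l, l, l, l, l, l, l, l, l, l] = true := by decide +kernel

theorem iL2_4060_1 : rcheck 6 3 7672 1 2 R1
    [32, 117, 0, 68, 1, 4, 168, 26, 115, 11, 177, 150, 76, 134]
    [l, l, l, l, l, n 183 l l l, l, l, l, l, l, l] = true := by decide +kernel

theorem iL2_4060_3 : rcheck 6 3 7672 3 2 R1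
    [1, 56, 11, 150, 117, 32, 134, 163, 68, 4, 177, 0, 26, 76]
    [l, l, l, l, l, l, l, l, l, l, l, l] = true := by decide +kernel

theorem iL2_5905_1 : rcheck 6 3 3873 1 2 R1
    [26, 117, 32, 11, 150, 4, 1, 163, 177, 76, 115, 56, 168, 0]
    [l, l, l, l, l, l, l, l, l, l, l, l] = true := by decide +kernel

theorem iL2_5905_3 : rcheck 6 3 3873 3 2 R1
    [26, 117, 32, 11, 150, 4, 1, 163, 177, 76, 115, 56, 168, 0]
    [l, l, l, l, l, l, l, l, l, l, l, l] = true := by decide +kernel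

theorem iL2_5907_1 : rcheck 6 3 3875 1 4 R1
    [115, 163, 177, 76, 1, 26, 68, 134, 117, 168, 56, 0, 32, 4]
    [l, n 82 (n 171 l (n 149 l l l) l) (n 280 (n 345 l (n 249 (n 283 l (n 144 (n 143 (n 160 (n 200
      l l l) l (n 200 l (n 168 l l l) l)) l l) l l) l) l l) l) l l) (n 244 l l (n 132 (n 143 (n 233
      (n 200 l (n 56 l l l) l) (n 149 l l l) l) l l) l l)), l, l, l, n 283 (n 345 (n 144 (n 244 l l
      (n 5 l l l)) l l) l l) (n 144 (n 345 (n 232 (n 171 l (n 297 (n 160 (n 143 (n 200 l (n 56 l l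
      l) l) l (n 200 l l (n 108 l l l))) l l) l l) l) l l) (n 249 (n 280 (n 294 l (n 233 (n 244 l l
      (n 132 (n 143 (n 33 (n 181 (n 209 l l (n 119 l l l)) l l) (n 166 l l l) (n 209 l l l)) l l) l
      l)) l l) l) l l) l l) l) l (n 294 (n 183 l (n 249 (n 219 (n 193 (n 82 (n 33 l (n 166 l l l)
      (n 209 (n 108 l l l) l l)) l l) l l) l l) l l) l) (n 232 l (n 171 (n 297 (n 245 (n 160 (n 82
      (n 149 l (n 56 l l l) l) l (n 149 l l l)) l l) l l) l l) l l) l) l)) (n 331 l (n 194 l (n 144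
      (n 171 l (n 297 (n 160 (n 1 l l l) l l) l l) l) l (n 193 (n 82 (n 294 (n 183 l (n 249 (n 219
      (n 33 l (n 166 l l l) l) l l) l l) l) (n 149 l (n 1 l l l) l) l) l (n 149 l l l)) l l)) l)
      l), l, l, l, l, l, l] = true := by decide +kernel

theorem iL2_5907_3 : rcheck 6 3 3875 3 1 R1
    [76, 4, 117, 168, 68, 1, 56, 134, 163, 32, 0, 26, 115, 11]
    [l, n 168 (n 108 (n 189 l l l) l l) (n 108 l (n 251 (n 149 l (n 331 (n 231 (n 57 (n 27 (n 11 l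
      (n 30 (n 200 l l l) l l) (n 15 (n 191 l (n 119 l (n 232 l l l) l) l) l l)) (n 160 l l l) l) l
      l) l l) l l) l) l l) l) (n 331 (n 33 l l (n 1 (n 68 (n 189 l l l) (n 58 l l l) l) l l)) l l),
      l, l, l, n 173 (n 132 (n 57 l l (n 33 (n 119 l (n 232 l l l) (n 191 l l l)) l l)) l l) (n 33
      (n 132 (n 280 l (n 117 (n 302 (n 202 (n 30 l (n 160 l l l) l) l l) l l) l l) l) (n 251 (n 168
      (n 239 (n 68 (n 57 l l (n 164 (n 15 (n 115 (n 191 (n 87 l l (n 119 l l l)) l l) (n 278 l l l)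
      l) (n 145 l l l) l) l l)) l l) l l) l l) l l) l) l (n 76 (n 251 (n 149 l (n 331 (n 231 (n 1
      (n 119 l (n 249 l l (n 278 l l l)) l) l l) l l) l l) l) l l) (n 280 (n 117 l (n 302 (n 108 (n
      202 (n 30 l l l) l l) l l) l l) l) l l) l)) (n 132 (n 224 l (n 124 l (n 33 (n 280 l (n 302 (n
      202 (n 82 l l l) l l) l l) l) l (n 1 (n 331 (n 76 (n 251 (n 231 (n 119 l (n 249 l l (n 278 l
      l l)) l) l l) l l) (n 189 l l l) l) l (n 189 l l l)) l l)) l) l) l l), l, l, l, l, l, l] = true := by decide +kernel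

theorem iL2_5941_1 : rcheck 6 3 3885 1 4 R1
    [115, 1, 26, 117, 68, 11, 177, 163, 150, 168, 76, 0, 4, 56]
    [l, n 174 (n 285 (n 265 (n 191 l (n 164 (n 169 l (n 176 l (n 161 (n 154 l l l) l (n 203 (n 26
      l l l) l l)) l) l) l l) l) l l) (n 189 l (n 168 l (n 163 l (n 167 l l l) l) l) l) (n 294 (n
      278 (n 151 (n 77 l (n 121 (n 124 l l (n 219 l (n 30 l l (n 171 l l l)) l)) (n 167 l (n 117 (n
      154 l l l) l l) l) l) l) l l) l (n 173 (n 121 l l l) l l)) l l)) l l, l, l, n 174 (n 188 l (n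
      161 (n 179 l l (n 87 l l (n 278 (n 115 l l l) l (n 115 (n 68 l l l) l l)))) l l) l) l l, n
      174 (n 283 (n 169 l (n 280 l (n 124 l l l) l) l) (n 203 (n 278 (n 77 (n 193 l (n 285 (n 151 l
      (n 292 l (n 72 (n 171 (n 119 l l l) l l) l (n 30 (n 121 (n 171 l l l) l l) l l)) l) (n 26 l l
      l)) l (n 292 l (n 265 (n 15 l l l) l l) l)) l) (n 151 (n 72 (n 124 l l (n 82 (n 173 l l l) l
      l)) l (n 30 (n 121 (n 171 l l l) l l) l l)) l l) (n 265 (n 80 l l l) l l)) l (n 26 (n 124 l l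
      l) (n 163 l l l) l)) (n 280 l (n 72 l l l) l) (n 178 (n 72 l l l) (n 191 (n 124 l l l) l (n
      80 l l l)) l)) (n 169 l (n 292 (n 178 l (n 72 (n 171 l l l) l l) l) (n 203 (n 172 l (n 168 l
      l (n 115 (n 82 l l l) l l)) l) l (n 164 (n 265 l (n 191 (n 171 (n 115 l l (n 1 (n 173 l l l)
      l l)) l l) l l) l) l (n 72 l l l))) l) l)) l l, l, l, l, l, l, l] = true := by decide +kernel

theorem iL2_5941_3 : rcheck 6 3 3885 3 5 R1
    [115, 177, 163, 134, 68, 26, 117, 11, 76, 1, 0, 56, 32, 4]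
    [l, n 79 (n 116 (n 174 (n 164 l (n 210 (n 253 l (n 177 (n 134 l (n 163 (n 132 l l l) l (n 294
      (n 57 l l l) l l)) l) l l) l) l l) l) l l) (n 188 l (n 57 l l (n 124 (n 177 l l l) l l)) l)
      (n 232 (n 145 (n 239 (n 115 (n 163 l (n 147 l l l) l) l l) l l) l (n 57 l l (n 171 l l l))) l
      l)) l l, l, l, n 79 (n 185 l (n 144 (n 69 l l (n 68 l l (n 134 (n 56 l l l) (n 56 l l l) l)))
      l l) l) l l, n 79 (n 135 (n 164 l (n 126 l (n 185 l (n 82 l (n 190 (n 67 l l l) l l) l) (n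
      173 l l l)) l) l) (n 294 (n 145 (n 163 (n 115 l (n 116 (n 239 l (n 251 l (n 82 l (n 67 l l l)
      l) l) (n 57 l l l)) l (n 232 l (n 56 l l l) l)) l) (n 239 (n 116 l (n 30 l l l) (n 232 (n 82
      l (n 67 l l l) l) l l)) l l) (n 116 (n 56 l l l) l l)) l (n 58 l l l)) (n 126 l (n 58 l l l)
      l) (n 280 (n 67 l l l) (n 134 (n 82 l (n 67 l l l) l) l (n 56 l l l)) l)) (n 164 l (n 251 (n
      280 l (n 82 l l l) l) (n 294 (n 30 l l l) l (n 174 (n 253 (n 210 l (n 134 (n 82 l l l) l l)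
      l) l l) l (n 173 l l l))) l) l)) l (n 232 l l l), l, l, l, l, l, l] = true := by decide +kernel

theorem iL2_7100_1 : rcheck 6 3 7916 1 3 R1
    [117, 56, 134, 11, 32, 163, 115, 177, 26, 168, 150, 0, 1, 4]
    [n 233 (n 340 (n 160 (n 224 l (n 232 (n 143 l (n 284 l (n 147 (n 58 l (n 331 l (n 285 (n 27 l
      l l) l (n 27 l l l)) l) l) l l) l) l) l l) l) (n 285 (n 267 l (n 171 l (n 284 (n 200 (n 182 l
      (n 278 l (n 147 (n 151 l l l) l (n 151 l l l)) l) l) l l) l l) l) l) l l) l) l l) l l, n 82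
      (n 189 (n 182 (n 224 (n 285 l (n 284 l (n 302 (n 232 (n 171 l (n 15 l l (n 121 l l l)) l) l
      l) l (n 15 l l l)) l) l) (n 233 (n 313 l (n 302 l (n 151 l l l) (n 294 l (n 249 l (n 311 (n
      200 l (n 143 l (n 15 l l (n 121 (n 117 l l l) l l)) l) l) l l) l) l)) l) l l) (n 15 l l l))
      (n 200 (n 331 l (n 150 l (n 12 l l l) l) l) l l) l) l (n 147 (n 209 l (n 160 (n 15 l l l) (n
      285 (n 15 l l l) l l) l) l) l l)) l (n 232 (n 294 l (n 285 (n 200 (n 15 l l l) l l) l (n 15 l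
      l l)) l) l l), l, n 171 l (n 82 (n 285 l (n 267 (n 311 l (n 302 (n 200 l (n 278 l (n 189 (n
      294 (n 169 l l l) l (n 168 l l l)) l l) l) l) l l) l) l l) l) l l) l, n 284 (n 171 l (n 233
      (n 160 l (n 278 l (n 340 (n 11 l l l) l l) l) l) l l) l) (n 171 l (n 82 (n 311 l (n 278 l (n
      189 (n 11 l l l) l l) l) l) l l) l) l, n 58 (n 233 (n 147 l (n 278 (n 285 (n 12 l l l) l (n
      121 l l l)) l l) l) l (n 232 l (n 171 (n 200 (n 11 l l l) l (n 36 l l l)) l l) l)) (n 340 (n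
      285 l (n 233 l l (n 224 (n 147 (n 12 l l l) l (n 36 l l l)) l l)) l) l (n 200 l (n 331 (n 232
      (n 12 l l l) l (n 121 l l l)) l l) l)) l, n 331 (n 294 (n 200 l (n 189 (n 169 l l l) (n 15 l
      l l) l) l) (n 143 (n 15 l l l) (n 178 l (n 150 l l l) l) l) l) l (n 285 (n 209 l (n 313 (n 15
      l l l) (n 178 l l l) l) l) (n 294 (n 15 l l l) l (n 169 l (n 115 l l l) l)) l), l, n 171 l (n
      143 l (n 285 l (n 82 (n 311 l (n 302 (n 200 l (n 278 l (n 189 (n 15 l (n 30 l (n 172 l l l)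
      l) l) l l) l) l) l l) l) l l) l) l) l, l, l, l] = true := by decide +kernel

theorem iL2_7100_3 : rcheck 6 3 7916 3 0 R1
    [163, 117, 26, 150, 177, 11, 168, 1, 56, 68, 76, 0, 4, 134]
    [n 118 (n 27 (n 87 (n 285 l (n 194 l (n 218 (n 226 l (n 245 (n 253 l (n 67 l (n 318 (n 76 l (n
      168 l (n 172 l l l) l) l) l (n 76 l (n 168 l (n 172 l l l) l) l)) l) l) l l) l) l l) l) l) (n
      185 l (n 94 l (n 318 (n 206 l (n 345 (n 233 l (n 67 (n 102 (n 56 l l l) l (n 56 l l l)) l l)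
      l) l l) l) l l) l) l) l) l l) l l, n 173 (n 82 (n 253 (n 185 (n 218 l (n 87 l (n 79 (n 285 l
      (n 318 (n 167 l l (n 154 (n 251 l l l) l l)) l l) l) l (n 76 l l l)) l) l) (n 118 (n 102 l (n
      79 l (n 76 l (n 210 l l (n 167 l l l)) l) (n 27 l l (n 94 (n 151 l (n 245 l (n 87 l (n 76 l l
      l) l) l) l) l l))) l) l l) (n 68 l (n 168 l (n 172 l l l) l) l)) (n 94 l (n 245 (n 210 (n 297
      l l l) l (n 297 l l l)) l l) l) l) l (n 345 (n 178 l (n 245 (n 218 (n 56 (n 117 l l (n 167 l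
      l l)) l l) l l) l (n 190 l l l)) l) l l)) l (n 318 (n 151 l (n 233 (n 245 (n 56 (n 117 (n 26
      l l (n 167 l l l)) l l) l l) l l) (n 60 l l l) l) l) l l), l, n 285 l (n 173 (n 194 l (n 82
      (n 218 l (n 226 (n 245 l (n 253 (n 12 l (n 79 (n 178 (n 68 l (n 168 l (n 172 l l l) l) l) l
      (n 68 l (n 168 l (n 172 l l l) l) l)) l l) l) l l) l) l l) l) l l) l) l l) l, n 87 (n 285 l
      (n 118 (n 194 l (n 27 (n 67 l (n 167 (n 297 l (n 135 l l (n 163 (n 173 l l l) l l)) (n 284 l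
      l l)) (n 5 l l (n 163 l l l)) l) l) l l) l) l l) l) (n 285 l (n 173 (n 194 l (n 82 (n 12 l (n
      167 (n 297 l (n 135 l l l) (n 284 l l l)) l l) l) l l) l) l l) l) l, n 87 (n 118 (n 194 (n
      345 l (n 218 (n 56 l l l) l (n 1 l l l)) l) l l) l (n 285 (n 318 l (n 245 (n 56 l l l) l (n 1
      l l l)) l) l l)) (n 118 (n 82 (n 94 (n 245 l (n 318 (n 76 l l l) l (n 1 l l l)) l) l l) l l)
      l (n 185 (n 218 l (n 345 (n 76 l l l) l (n 1 l l l)) l) l l)) l, n 118 (n 245 (n 151 l (n 173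
      (n 1 l l l) l l) l) (n 194 l (n 68 l l l) l) l) l (n 178 (n 218 l (n 226 (n 68 l l l) l l) l)
      (n 82 (n 1 l l l) l l) l), l, n 285 l (n 173 (n 194 l (n 82 (n 206 l (n 218 l (n 245 l (n 12
      l (n 79 (n 297 (n 167 l l l) l l) l l) l) l) l) l) l l) l) l l) l, l, l, l] = true := by decide +kernel

theorem iL2_956_1 : rcheck 6 3 3308 1 1 R1
    [115, 0, 163, 177, 168, 26, 117, 134, 4, 1, 76, 56, 32, 68]
    [l, n 102 (n 119 (n 181 (n 116 l (n 232 l (n 249 (n 191 l l (n 164 (n 132 l l l) l l)) l l) l)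
      l) l l) l l) l l, l, l, l, l, l, l, l, l, l, l] = true := by decide +kernel

theorem iL2_956_3 : rcheck 6 3 3308 3 1 R1
    [115, 76, 68, 177, 168, 26, 117, 134, 163, 1, 0, 56, 32, 4]
    [l, n 26 (n 278 (n 340 (n 116 l (n 232 l (n 249 (n 115 l l (n 69 (n 56 l l l) l l)) l l) l) l)
      l l) l l) l l, l, l, l, l, l, l, l, l, l, l] = true := by decide +kernel

theorem iL2_1881_1 : rcheck 6 3 3441 1 4 R1
    [177, 117, 26, 163, 32, 76, 168, 11, 150, 134, 56, 0, 1, 4]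
    [l, n 285 l (n 297 (n 37 l (n 87 (n 160 (n 327 l (n 226 (n 167 l l l) l (n 57 (n 178 l l l) l
      l)) l) l (n 167 l l l)) l l) l) (n 233 l (n 267 (n 174 (n 226 (n 331 l (n 311 (n 80 l l (n
      181 (n 177 l l l) l l)) l l) (n 36 l l l)) l l) l l) l l) l) (n 345 (n 327 l (n 233 (n 128 (n
      267 (n 135 l (n 57 l (n 150 l l l) l) (n 164 l l l)) l l) l l) l l) l) l l)) l, l, l, n 160
      (n 327 l (n 285 l (n 128 (n 313 (n 219 l (n 87 (n 36 l l l) l l) l) l l) l l) l) l) (n 188 l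
      (n 285 l (n 267 (n 174 (n 297 l (n 226 (n 36 l l l) l l) l) l l) l l) l) l) l, n 327 (n 297 l
      (n 219 (n 226 (n 194 (n 128 (n 32 l l l) l (n 12 l l l)) l (n 188 l (n 311 (n 285 l (n 128 (n
      37 (n 331 (n 36 l l l) l l) l l) l l) l) l l) l)) l l) l l) l) (n 331 l (n 313 (n 132 (n 160
      (n 128 (n 32 l l l) l (n 12 l l l)) l (n 345 (n 188 l (n 285 l l (n 37 (n 174 l l (n 297 (n
      36 l l l) l l)) l l)) l) l l)) l l) l l) l) l, l, l, l, l, l, l] = true := by decide +kernel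

theorem iL2_1881_3 : rcheck 6 3 3441 3 2 R1
    [117, 163, 134, 150, 177, 11, 168, 115, 56, 68, 76, 0, 4, 26]
    [l, n 126 (n 245 (n 173 (n 193 l (n 278 (n 231 l (n 206 l (n 87 (n 318 (n 56 l l l) l l) l (n
      76 l l l)) l) l) l l) l) l l) (n 265 l (n 218 (n 76 l l l) l (n 226 (n 68 l l l) l l)) l) (n
      345 (n 219 (n 253 (n 218 (n 232 (n 239 l (n 181 l l l) l) l l) (n 68 l l l) l) l l) l l) l
      l)) l l, l, l, n 126 (n 179 l (n 67 (n 79 l l (n 87 l l (n 232 (n 56 l l l) l (n 56 l l l))))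
      l l) l) l l, n 126 (n 206 (n 185 l (n 331 l (n 245 l (n 76 l l l) (n 318 l (n 56 l l l) (n
      193 (n 138 (n 82 (n 189 l l l) (n 102 l l l) l) l l) l (n 76 l l l)))) l) l) (n 285 l (n 231
      l (n 345 l (n 56 l l l) (n 218 l (n 76 l l l) (n 173 (n 138 (n 102 (n 189 l l l) (n 82 l l l)
      l) l l) l (n 56 l l l)))) l) l) l) l l, l, l, l, l, l, l] = true := by decide +kernel

theorem iL2_1916_1 : rcheck 6 3 3452 1 0 R1
    [1, 115, 168, 32, 163, 76, 26, 177, 117, 4, 68, 0, 11, 56]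
    [l, n 285 (n 232 (n 80 (n 172 l (n 68 l (n 12 (n 179 (n 57 l l l) l l) (n 126 l l l) l) l) l)
      (n 141 l (n 292 (n 119 l (n 345 l l (n 172 (n 58 l (n 209 (n 340 l (n 102 l l (n 253 (n 193 l
      l (n 57 l l l)) l l)) l) l l) l) l l)) l) l l) l) (n 102 (n 144 (n 167 (n 79 l l l) (n 57 (n
      88 l l l) l l) l) l l) l l)) l l) l l, l, l, l, l, l, l, l, l, l, l] = true := by decide +kernel

theorem iL2_1916_3 : rcheck 6 3 3452 3 0 R1
    [11, 68, 177, 76, 168, 32, 117, 115, 163, 1, 0, 56, 26, 4]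
    [l, n 231 (n 340 (n 33 (n 178 l (n 169 l (n 56 l l l) (n 285 (n 56 l l l) l l)) l) (n 185 l (n
      183 (n 69 l (n 292 l l (n 178 (n 193 l (n 191 (n 283 l (n 149 l l (n 147 (n 195 l l (n 37 l
      (n 94 l l l) l)) l l)) l) l l) l) l l)) l) l l) l) (n 149 (n 32 (n 169 (n 56 l l l) (n 57 l l
      l) l) l l) l l)) l l) l l, l, l, l, l, l, l, l, l, l, l] = true := by decide +kernel

theorem iL2_5948_1 : rcheck 6 3 3948 1 1 R1
    [117, 1, 134, 150, 68, 11, 168, 177, 26, 115, 163, 0, 4, 56]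
    [l, n 245 (n 126 (n 143 (n 280 l (n 160 l (n 327 (n 313 (n 167 l (n 1 l l l) l) l (n 167 l (n
      1 l l l) l)) l l) l) l) l l) (n 57 l l l) (n 179 (n 174 (n 294 (n 297 l (n 176 (n 94 (n 15 l
      l l) l (n 190 l l l)) l (n 26 l l l)) l) l (n 318 l (n 236 l (n 67 l l l) l) l)) l l) l l)) l
      (n 232 l (n 297 l (n 249 (n 179 (n 181 l l l) l (n 154 (n 57 l l l) l (n 121 (n 119 l l l) l
      l))) l (n 115 l (n 15 l l l) l)) l) l), l, l, n 174 (n 294 (n 232 l (n 311 l (n 176 (n 94 (n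
      57 l l l) l l) l l) l) l) l l) (n 143 (n 280 l (n 160 l (n 327 (n 245 (n 57 l l l) l l) l l)
      l) l) l l) l, n 174 (n 232 l (n 294 (n 318 l (n 236 l (n 179 (n 5 (n 173 (n 121 l l l) (n 285
      l l l) l) l l) l (n 311 l (n 176 (n 94 (n 1 l l l) l l) l l) l)) l) l) l (n 179 (n 126 l l (n
      1 (n 117 l l l) l l)) l l)) l) (n 285 l (n 294 (n 265 l (n 183 l (n 126 (n 5 (n 173 l (n 143
      l l l) l) l l) l (n 311 l (n 313 (n 231 (n 5 l l l) l l) l l) l)) l) l) l (n 179 l l (n 188 l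
      (n 126 (n 1 l l l) l l) l))) l) l, l, l, l, l, l, l] = true := by decide +kernel

theorem iL2_5948_3 : rcheck 6 3 3948 3 1 R1
    [115, 0, 163, 177, 76, 26, 117, 134, 68, 1, 168, 56, 32, 4]
    [l, n 210 (n 27 (n 183 (n 283 l (n 231 l (n 311 (n 345 (n 224 l (n 172 l l l) l) l (n 224 l (n
      172 l l l) l)) l l) l) l) l l) (n 57 l l l) (n 143 (n 194 (n 249 (n 331 l (n 245 (n 144 (n 58
      l l l) l (n 124 l l l)) l (n 124 l l l)) l) l (n 294 l (n 193 l (n 166 l l (n 100 l l l)) l)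
      l)) l l) l l)) l (n 116 l (n 331 l (n 164 (n 143 (n 138 l (n 57 l l (n 82 l l l)) l) l (n 181
      (n 32 l l l) l l)) l (n 33 l l l)) l) l), l, l, n 27 (n 183 (n 283 l (n 231 l (n 311 (n 210
      (n 32 l l l) l l) l l) l) l) l l) (n 249 (n 116 l (n 297 l (n 245 (n 144 (n 32 l l l) l l) l
      l) l) l) l l) l, n 194 (n 116 l (n 249 (n 294 l (n 193 l (n 143 (n 32 (n 172 l (n 72 l (n 57
      l (n 164 l l l) l) l) l) (n 166 l l (n 100 l (n 56 (n 119 l l l) l l) l)) l) l (n 297 l (n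
      245 (n 144 (n 32 l (n 166 l l l) (n 195 (n 119 (n 30 l l (n 173 l l l)) l l) l l)) l l) l l)
      l)) l) l) l (n 143 (n 27 l l (n 4 l (n 119 (n 138 l l (n 56 (n 173 l (n 166 l l l) l) l l)) l
      l) l)) l l)) l) (n 232 l (n 249 (n 178 l (n 77 l (n 27 (n 4 (n 100 l (n 200 l (n 57 l (n 219
      l l l) l) l) l) l (n 167 (n 57 l (n 173 l l l) l) l l)) l (n 297 l (n 345 (n 244 (n 4 l l l)
      l l) l l) l)) l) l) l (n 143 l l (n 160 l (n 27 (n 4 l l l) l l) l))) l) l, l, l, l, l, l, l] = true := by decide +kernel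

theorem iK1_58 : rcheck 5 4 86 13 0 R1
    [150, 117, 115, 177, 168, 26, 163, 11, 4, 56, 0, 1, 76, 68]
    [n 280 (n 340 (n 128 (n 171 (n 172 (n 12 l l l) l l) (n 194 (n 57 l l l) l l) l) l (n 126 (n
      194 (n 56 l l l) l l) (n 172 (n 11 l l l) l l) l)) l l) l l, n 340 (n 172 (n 280 (n 121 l (n
      126 l (n 128 (n 57 l l l) l (n 57 l l l)) l) l) l l) (n 278 l (n 226 l l l) l) (n 194 (n 224
      (n 128 (n 171 (n 4 l l l) (n 143 l (n 233 (n 56 l l l) l (n 57 l l l)) (n 57 l l l)) l) l (n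
      11 l l l)) l l) l l)) l (n 128 (n 126 l l (n 194 (n 226 l l l) l l)) l l), l, n 128 (n 188 (n
      224 (n 181 (n 56 l l l) l (n 278 (n 5 l l l) (n 226 (n 56 l l l) l l) l)) l l) l l) l l, n
      340 (n 203 l (n 188 (n 181 l l (n 233 l l (n 173 (n 226 (n 150 l l l) l l) (n 226 (n 150 l l
      l) l l) l))) l l) l) l l, n 340 (n 179 (n 121 l (n 194 l (n 226 (n 150 l l l) l l) (n 188 (n
      57 l l l) l (n 11 l l l))) l) (n 143 l (n 172 l (n 226 l (n 193 l l l) l) (n 233 (n 11 l l l)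
      l (n 56 l l l))) l) l) l l, n 143 l (n 173 l (n 128 (n 126 (n 188 (n 179 l (n 280 (n 226 (n
      11 l l l) l l) l (n 226 (n 11 l l l) l l)) l) l l) l l) l l) l) l, l, n 143 l (n 280 l l (n
      218 (n 151 l l l) l l)) l, l, l, l] = true := by decide +kernel

theorem iK1_62 : rcheck 5 4 94 13 1 R1
    [115, 163, 168, 177, 68, 26, 117, 11, 134, 56, 0, 1, 32, 76]
    [n 141 l (n 232 (n 249 l (n 185 (n 171 (n 179 (n 188 l (n 11 l l l) l) (n 11 l l l) l) l (n
      233 (n 224 l (n 57 l l l) l) (n 57 l l l) l)) l l) l) l l) l, n 141 l (n 185 (n 126 (n 94 l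
      (n 311 (n 302 l (n 239 (n 164 l l l) l l) (n 232 (n 195 (n 163 l l l) l l) l l)) (n 302 (n
      239 (n 164 l l l) l l) l (n 135 l l l)) (n 302 (n 232 (n 195 (n 163 l l l) l l) l l) (n 135 l
      l l) l)) (n 79 l l (n 124 (n 224 (n 233 l (n 57 l l l) l) (n 56 l l l) l) l l))) l (n 94 l (n
      124 l l (n 188 (n 56 l l l) (n 56 l l l) l)) l)) l (n 126 (n 249 l (n 195 (n 163 l l l) l (n
      88 l (n 118 (n 116 l l (n 171 l (n 27 l (n 57 l l (n 239 l l (n 168 l l l))) l) l)) (n 164 (n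
      68 l l l) l l) (n 116 (n 164 (n 169 l l l) l l) l l)) l)) l) l l)) (n 232 (n 126 (n 194 (n
      203 (n 94 l (n 116 (n 102 (n 191 l l l) l l) l l) l) l l) l l) l l) l l), l, n 141 l (n 232 l
      l (n 294 (n 285 l (n 118 l (n 147 l l l) l) l) (n 117 l l (n 11 l (n 135 l l l) l)) l)) l, n
      185 (n 94 l (n 79 (n 202 l l (n 124 l l (n 141 l (n 233 (n 164 (n 132 l l l) l l) (n 163 (n
      166 l (n 164 (n 88 l (n 69 (n 26 l l (n 144 l l l)) l l) l) l l) l) l l) l) l))) l l) l) l l,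
      n 185 (n 233 (n 124 (n 56 l l l) l (n 202 l (n 141 l (n 232 (n 27 l l (n 135 l (n 56 l l l)
      l)) l l) l) (n 11 l l l))) (n 124 (n 56 l l l) l (n 202 l (n 141 l (n 232 (n 27 l l (n 135 l
      (n 56 l l l) l)) l l) l) (n 11 l l l))) l) l l, n 79 (n 232 (n 188 (n 179 l (n 195 (n 163 l l
      l) l l) l) (n 195 (n 163 l l l) l l) l) l (n 188 (n 179 l (n 195 (n 163 l l l) l l) l) (n 195
      (n 163 l l l) l l) l)) l l, l, n 232 l l (n 79 (n 124 l l (n 188 (n 195 (n 163 l l l) l l) (n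
      195 (n 163 l l l) l l) l)) l l), l, l, l] = true := by decide +kernel

theorem iK1_126 : rcheck 5 4 222 13 1 R1
    [117, 163, 134, 150, 68, 11, 168, 1, 26, 177, 4, 0, 76, 32]
    [n 285 (n 143 l (n 128 l (n 239 (n 154 (n 167 l l (n 193 (n 166 (n 195 l l (n 163 (n 117 (n 11
      l (n 311 (n 135 l l l) (n 151 l l l) l) (n 135 (n 145 l l l) (n 327 l (n 118 l l l) l) l)) l
      l) l l)) (n 182 (n 100 l l l) l l) l) l l)) (n 138 (n 193 (n 150 l l l) l l) l l) l) (n 193 l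
      l (n 244 (n 294 (n 145 l l (n 135 l l l)) l (n 160 l l (n 135 l (n 311 l l l) l))) l l)) (n
      195 (n 149 (n 150 (n 163 l l (n 134 (n 68 (n 30 (n 167 l l (n 138 l l l)) (n 100 l l (n 26 l
      l (n 176 (n 118 l l (n 294 l l l)) (n 118 l l (n 294 l l l)) l))) (n 15 (n 135 (n 117 l (n
      138 l l l) l) l l) (n 166 l l (n 11 l l (n 135 l (n 327 l l l) l))) l)) l l) l l)) l l) l (n
      138 l l (n 121 (n 167 (n 134 l l l) l l) l l))) (n 149 l l (n 138 l l (n 121 (n 134 l l l) l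
      l))) l)) l) l) l l, n 118 (n 327 (n 94 (n 151 l (n 181 l (n 195 l l l) l) (n 181 l (n 195 l l
      l) l)) (n 311 l (n 177 l (n 239 (n 167 l l l) l l) (n 11 l (n 30 (n 167 l l l) l l) l)) l) (n
      151 l (n 239 (n 167 l l l) l (n 144 l l l)) (n 311 (n 30 (n 167 l l l) l l) (n 177 l (n 239
      (n 167 l l l) l l) (n 11 l (n 30 (n 167 l l l) l l) l)) l))) (n 160 l (n 181 l (n 195 (n 163
      l l l) l l) (n 15 l (n 26 (n 163 l l l) (n 30 l l (n 177 l (n 239 l l l) l)) l) l)) (n 181 l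
      (n 195 (n 163 l l l) l l) l)) l) l l, l, l, l, l, n 285 (n 245 (n 327 l (n 239 (n 167 l l l)
      l l) (n 239 (n 167 l l l) l l)) (n 69 (n 94 (n 176 (n 160 l (n 79 l l (n 239 l l l)) l) (n 79
      l l (n 239 l l l)) l) l l) l l) (n 311 (n 239 l l l) (n 145 l l (n 302 l l (n 135 (n 160 (n
      239 (n 167 l l l) l l) l l) l l))) (n 161 l l (n 318 l l (n 151 (n 176 (n 239 (n 167 l l l) l
      l) l l) l l))))) l (n 318 (n 143 (n 151 (n 79 (n 161 l (n 195 (n 163 l l l) l l) (n 195 (n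
      163 l l l) l l)) (n 145 (n 195 (n 163 l l l) l l) l l) (n 161 l (n 176 l l (n 327 l l (n 239
      (n 167 l l l) (n 193 (n 182 l l l) l l) l))) l)) (n 161 l l (n 327 (n 79 l (n 239 l l l) (n
      239 l l l)) l l)) l) l l) (n 143 (n 79 l (n 69 (n 245 l l (n 239 (n 167 l l l) l l)) l l) (n
      135 (n 311 l l (n 195 (n 163 l l l) l l)) l l)) l l) l), n 143 l l (n 285 (n 69 (n 118 l (n
      294 (n 195 (n 163 l l (n 1 l (n 239 l l l) l)) l (n 33 l (n 167 (n 226 l (n 193 (n 163 (n 239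
      l l l) l l) l l) l) l l) l)) l l) l) l l) l l), l, l, l, l] = true := by decide +kernel

theorem iK1_184 : rcheck 5 4 116 13 0 R1
    [115, 76, 68, 117, 168, 26, 32, 1, 4, 11, 0, 56, 134, 163]
    [l, n 69 (n 179 (n 194 (n 108 (n 169 l (n 172 l l (n 168 l l (n 4 l (n 331 l l l) l))) l) l (n
      169 l (n 172 l l (n 168 l l l)) l)) l l) l l) l (n 194 (n 169 l (n 172 l l (n 179 (n 224 (n
      278 l (n 239 l l l) (n 231 (n 200 l l (n 195 l (n 164 l l (n 168 (n 249 l l l) l l)) l)) l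
      l)) l l) l l)) l) l l), l, l, l, n 108 (n 172 (n 194 l l (n 128 (n 169 (n 171 (n 26 l (n 224
      (n 278 l (n 160 l (n 102 l (n 202 l (n 132 l l l) l) l) l) l) l l) (n 168 (n 249 l (n 160 l l
      l) l) l l)) (n 88 l l l) l) l l) l (n 169 (n 171 l (n 88 l l l) l) l l))) l (n 194 (n 118 (n
      179 (n 171 l (n 88 l l l) l) l l) l (n 179 (n 171 l (n 88 l l l) l) l l)) l l)) l (n 179 (n
      194 (n 172 l l (n 171 l (n 132 (n 88 l l l) l l) l)) l l) (n 194 l l (n 172 (n 171 l (n 132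
      (n 88 l l l) l l) l) l l)) l), l, l, l, l, l, l] = true := by decide +kernel

theorem iK1_185 : rcheck 5 4 117 13 0 R1
    [163, 76, 68, 134, 168, 26, 117, 11, 32, 56, 0, 1, 4, 115]
    [n 185 (n 251 (n 190 (n 200 (n 224 l (n 57 l l l) (n 57 l l l)) l (n 11 l (n 249 l l l) l)) l
      (n 200 (n 224 l (n 57 l l l) (n 57 l l l)) l (n 11 l (n 183 l l l) l))) l l) l l, n 224 (n
      200 l (n 193 l (n 108 (n 79 (n 145 (n 166 (n 167 (n 56 l l l) l l) l (n 167 (n 56 l l l) l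
      l)) l l) l l) l l) l) (n 145 (n 194 (n 79 (n 167 l (n 121 (n 15 l l (n 72 l l l)) l l) (n 168
      (n 15 l l (n 285 l l (n 27 l (n 232 l (n 164 l l l) l) l))) l (n 32 l (n 283 l l l) l))) l (n
      11 l l l)) l l) l (n 194 (n 11 l l l) l l))) (n 87 l (n 185 (n 251 (n 200 (n 190 (n 57 l l l)
      l (n 57 l l l)) l l) l l) l l) l) l, l, n 79 (n 145 (n 224 (n 166 (n 200 l (n 32 l l l) (n 33
      l l l)) l (n 200 l (n 32 l l l) (n 33 l l l))) l l) l l) l l, n 108 (n 193 l (n 79 (n 145 (n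
      164 (n 278 l (n 232 (n 126 l l (n 163 (n 167 l l (n 80 l l l)) l l)) l l) (n 191 l l l)) l l)
      l l) l l) l) (n 87 l (n 185 (n 251 (n 164 (n 278 l (n 232 l l l) (n 191 (n 56 l l (n 163 (n
      167 l (n 77 l l (n 80 l (n 94 l (n 79 l l l) l) l)) l) l l)) l l)) (n 118 l l l) l) l l) l l)
      l) l, n 224 (n 194 (n 251 (n 200 l (n 33 l l l) (n 167 (n 163 l l l) (n 278 l l (n 191 l l
      l)) l)) l (n 167 (n 163 l l l) (n 138 (n 278 l l (n 191 l l l)) l l) l)) l (n 193 l (n 108 (n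
      79 (n 145 (n 166 (n 167 l l l) l (n 167 l l l)) l l) l l) l l) l)) (n 200 (n 251 (n 194 l (n
      27 l l l) (n 167 (n 163 l l l) (n 278 l l (n 191 l l l)) l)) l (n 167 (n 163 l l l) (n 138 (n
      278 l l (n 191 l l l)) l l) (n 80 (n 168 l l l) l l))) l (n 102 (n 193 l (n 124 (n 190 (n 94
      (n 167 l l l) l (n 167 l l l)) l l) l l) l) l l)) l, n 179 l (n 79 (n 145 (n 100 (n 12 l l l)
      l (n 12 l l l)) l l) l l) l, l, n 179 l (n 79 (n 145 (n 164 (n 126 (n 278 l l l) (n 11 (n 163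
      (n 76 l l l) l l) l (n 163 (n 278 l (n 166 l l l) l) l l)) l) l l) l l) l l) l, l, l, l] = true := by decide +kernel

theorem iK1_29 : rcheck 5 4 77 13 4 R1
    [150, 117, 168, 134, 76, 26, 56, 11, 4, 115, 0, 1, 163, 68]
    [l, n 160 l l (n 145 (n 173 (n 224 (n 190 l l (n 138 (n 283 (n 116 l l l) l (n 12 l l l)) l
      l)) l l) l l) l (n 128 (n 179 (n 161 l (n 249 (n 173 (n 5 l l l) l (n 57 l l l)) l l) l) l l)
      l l)), l, l, n 160 l l (n 145 (n 173 (n 224 (n 206 l (n 190 l l (n 138 (n 128 (n 116 l l l) l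
      (n 12 l l l)) l l)) l) l l) l l) l (n 128 (n 179 (n 161 l (n 249 (n 173 (n 5 l l l) l (n 57 l
      l l)) l l) l) l l) l l)), n 283 (n 224 (n 172 l (n 190 (n 26 l l l) l (n 249 (n 160 (n 12 l l
      l) l l) (n 145 (n 160 l (n 56 l l l) (n 121 l (n 176 (n 11 l l (n 168 (n 5 l l (n 134 (n 297
      l l l) l l)) l l)) (n 26 l l (n 168 (n 5 l l (n 76 (n 297 l l l) l l)) l l)) l) (n 5 l l l)))
      (n 12 l l l) l) l)) l) l (n 176 l (n 145 (n 138 (n 11 l l l) l (n 11 l l l)) l l) l)) (n 179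
      (n 249 (n 173 (n 154 l (n 160 (n 115 l (n 144 (n 77 l l l) (n 185 l l (n 218 l l l)) l) l) l
      (n 116 l l l)) l) l (n 232 l (n 194 l (n 172 l l (n 160 (n 144 l l l) l (n 331 (n 4 l l l) (n
      313 l l l) (n 167 l l l)))) l) l)) l l) l l) (n 190 (n 236 l l l) l (n 145 (n 138 (n 27 l (n
      297 l l l) l) l l) (n 128 (n 172 l (n 116 l l l) (n 115 l l l)) l (n 11 l l l)) l)), n 179 (n
      160 (n 128 (n 138 l l (n 249 (n 172 (n 56 l l l) l (n 5 l l l)) l l)) l l) l l) l l, l, n 179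
      (n 160 (n 128 (n 138 l l (n 249 (n 172 (n 5 l l l) l (n 4 l l l)) l l)) l l) l l) l l, l, l,
      l] = true := by decide +kernel

theorem iK1_59 : rcheck 5 4 87 13 4 R1
    [134, 168, 76, 177, 163, 26, 4, 115, 56, 11, 0, 1, 32, 68]
    [l, n 194 l (n 188 (n 191 (n 132 (n 195 (n 11 l l l) l (n 79 l l (n 231 (n 4 l l l) l l))) l
      (n 115 l (n 245 l (n 202 l l l) l) l)) l l) (n 80 (n 292 (n 233 (n 191 (n 209 (n 177 l l l) l
      l) l (n 4 l l l)) l (n 115 l l l)) l l) l l) (n 160 (n 102 l l (n 80 (n 195 l l l) l (n 27 l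
      l l))) l l)) l, l, l, n 194 l (n 188 (n 191 (n 231 (n 164 l l l) l l) l l) (n 80 (n 292 (n
      203 l (n 116 l l l) (n 231 (n 164 l l l) l l)) l l) l l) (n 160 (n 102 l l (n 233 l (n 4 l l
      l) (n 231 (n 12 l l l) l l))) l l)) l, n 172 (n 188 (n 145 (n 12 l l l) (n 224 l (n 233 l (n
      80 (n 56 l l l) l (n 292 l (n 115 (n 134 l l l) (n 231 (n 164 l l l) l l) l) (n 194 l (n 5 l
      l l) (n 5 l l l)))) (n 203 (n 245 (n 178 l l l) (n 231 (n 183 (n 169 l l l) l l) l l) l) l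
      l)) (n 56 l l l)) l) (n 292 (n 194 l (n 87 (n 43 (n 195 l l l) (n 164 (n 79 (n 202 l l l) l
      l) l l) (n 58 l (n 163 l l l) l)) l (n 181 l l (n 233 (n 209 (n 177 l l l) l l) l l))) (n 26
      l l l)) l l) (n 80 (n 124 l l l) l (n 224 l (n 160 (n 135 l l (n 236 l l l)) l (n 26 l l l))
      (n 5 l l l)))) l (n 233 l (n 4 l l l) (n 5 l l l)), l, l, l, l, l, l] = true := by decide +kernel

theorem iK4_58_58 : rcheck 5 5 937 86 0 R2
    [11, 76, 163, 168, 115, 150, 68, 56, 177, 134, 4, 32, 117, 26, 1]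
    [n 171 (n 210 (n 226 (n 37 l l l) (n 189 (n 167 l l l) l l) l) (n 253 (n 37 l l l) l (n 144 (n
      37 l l l) l l)) l) l (n 132 (n 253 (n 37 l l l) (n 189 (n 167 l l l) l l) l) (n 226 (n 37 l l
      l) l (n 144 (n 37 l l l) l l)) l), n 345 (n 340 (n 12 l (n 181 l (n 173 l (n 128 (n 164 l l
      l) l l) l) (n 178 l (n 108 l l l) l)) l) l (n 210 (n 43 l l l) l l)) (n 231 (n 37 l l l) l (n
      226 (n 43 l l l) l l)) l, n 171 (n 37 l l l) l (n 236 (n 37 l l l) (n 37 l l l) l), n 219 (n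
      249 l (n 226 (n 292 (n 340 (n 37 l l l) l (n 37 l l l)) l (n 294 (n 193 l l l) l (n 232 l l
      l))) (n 37 l l l) (n 253 (n 37 l l l) (n 210 (n 144 (n 37 l (n 189 l l l) l) (n 72 l l l) l)
      (n 138 l l (n 167 (n 181 l (n 267 l l l) l) l l)) l) l)) (n 292 (n 166 l (n 141 (n 119 l l l)
      (n 185 l l l) l) l) l (n 37 l l l))) l (n 37 l l (n 169 l l l)), l, n 231 (n 183 (n 297 (n
      210 (n 226 (n 141 (n 119 l l l) l l) l l) (n 166 l (n 232 (n 141 l l l) (n 128 l l (n 267 (n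
      141 l l l) l l)) l) l) l) l (n 132 (n 253 (n 141 (n 119 l l l) l l) l l) (n 88 (n 43 (n 15 l
      l (n 12 l l (n 108 l l (n 226 (n 195 l l l) l l)))) l l) (n 232 l l l) l) l)) l l) l l, n 302
      (n 231 (n 43 l (n 100 l l l) l) l l) (n 219 (n 43 l l l) l l) l, n 231 (n 183 (n 302 (n 210 l
      (n 224 l (n 265 l (n 171 (n 37 l l l) l (n 141 (n 119 l l l) l l)) l) l) l) (n 132 l (n 313 l
      (n 219 (n 60 (n 15 (n 43 l l (n 37 l l (n 80 l l (n 226 (n 167 l (n 280 l l l) l) l l)))) l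
      l) (n 232 l (n 185 l (n 166 l (n 138 l l l) l) l) l) l) l l) l) l) l) l l) l l, l, l, l, l] = true := by decide +kernel

theorem iK4_126_126 : rcheck 5 5 801 222 0 R2
    [26, 150, 68, 115, 177, 117, 56, 32, 168, 134, 11, 0, 4, 1, 76]
    [l, n 100 (n 284 (n 267 l l (n 345 (n 206 (n 30 l l l) l l) l (n 206 (n 30 l l l) l l))) l (n
      267 (n 233 (n 318 (n 30 l l (n 154 (n 26 l l l) l l)) l l) l (n 318 (n 30 l l l) l l)) l l))
      l (n 124 (n 267 (n 284 l l (n 30 l l l)) l l) (n 267 l l (n 284 (n 30 l l l) l l)) l), l, n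
      236 (n 206 (n 284 (n 209 (n 267 l l (n 154 l l l)) l (n 267 l l (n 151 (n 30 l l (n 36 l l
      l)) l l))) l l) l l) l (n 267 l l (n 206 (n 284 (n 226 l (n 144 (n 182 l l (n 108 l l l)) l
      l) (n 193 l (n 150 l l l) l)) l l) l l)), l, l, l, l, l, l, l, l] = true := by decide +kernel

theorem iK4_184_126 : rcheck 5 5 907 222 4 R2
    [163, 117, 168, 134, 26, 177, 0, 68, 11, 4, 32, 56, 76, 115, 1]
    [n 167 (n 345 (n 294 l (n 27 l l l) (n 27 l l l)) (n 168 (n 236 (n 134 (n 117 l (n 172 l l (n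
      141 l (n 278 l l l) l)) l) (n 172 l l (n 27 (n 283 l l l) l l)) l) l l) l l) (n 134 (n 138 (n
      102 l l l) l (n 202 (n 145 l l (n 102 l (n 239 l l l) l)) l l)) (n 185 (n 121 l l (n 102 l (n
      239 l l l) l)) l l) l)) l (n 172 (n 340 l (n 231 (n 168 (n 128 (n 145 l (n 27 l l l) (n 27 l
      l l)) (n 294 l l (n 117 (n 185 l l (n 121 (n 134 l (n 145 (n 27 l l l) l l) l) l l)) l l)) (n
      345 l l (n 236 l l (n 102 l (n 239 l l l) l)))) (n 345 (n 236 l (n 179 l l (n 138 (n 102 l l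
      l) (n 102 l l l) l)) l) l l) l) l l) l) (n 340 l (n 231 (n 128 l (n 294 l l (n 117 (n 102 l
      (n 239 l l l) l) l l)) (n 311 l l (n 134 (n 102 l (n 239 l l l) l) l l))) l l) l) l), l, l, n
      174 (n 117 (n 345 (n 311 l (n 32 l l l) (n 56 (n 173 l l l) l l)) (n 168 (n 134 l (n 56 (n
      173 l l l) l l) l) l l) (n 128 l (n 102 l (n 239 l l (n 340 l (n 231 (n 244 l l l) l l) l))
      l) (n 134 (n 141 l l l) (n 56 (n 173 l l l) l l) l))) (n 145 l (n 56 (n 224 l l l) l l) (n 32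
      l l l)) l) l l, l, n 163 (n 340 l (n 174 l (n 27 (n 210 (n 232 (n 164 (n 193 l (n 278 l l l)
      l) l l) l l) (n 193 (n 278 l l l) l l) l) (n 164 l l (n 1 (n 5 (n 118 l l l) l (n 118 l l l))
      l l)) (n 141 (n 193 (n 239 l l l) (n 239 l l l) l) (n 278 l l (n 232 l l l)) l)) l) l) l l,
      l, n 163 (n 167 (n 236 (n 340 l (n 179 (n 239 (n 27 (n 278 l l (n 102 l l (n 193 l l l))) l
      l) l (n 144 l l l)) l l) l) (n 340 l (n 311 l (n 117 l l (n 128 (n 239 (n 232 l l l) l l) l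
      l)) (n 134 l l (n 145 (n 239 l l l) l l))) l) l) l l) l l, l, l, l, l] = true := by decide +kernel

theorem iK4_184_184 : rcheck 5 5 907 116 0 R2
    [1, 134, 68, 150, 115, 168, 56, 177, 26, 76, 11, 0, 32, 163, 117]
    [n 292 (n 176 (n 302 l (n 12 l l l) (n 118 l (n 232 l l l) (n 267 (n 173 l l l) l l))) (n 206
      (n 226 (n 124 (n 190 l (n 327 l l (n 12 l l l)) l) (n 327 l l (n 12 l l l)) l) l l) l l) (n
      144 (n 236 (n 12 l l (n 79 (n 161 (n 313 l l l) l l) l l)) l (n 124 (n 245 l l (n 12 l l l))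
      l l)) (n 302 l l (n 190 (n 12 l l (n 79 (n 67 l (n 294 (n 118 l l l) l l) l) l l)) l l)) l))
      l (n 327 (n 141 l (n 191 (n 206 (n 302 (n 318 l (n 12 l l l) (n 118 l (n 232 l l l) (n 251 (n
      173 l l l) l l))) (n 190 (n 311 (n 236 (n 118 l (n 232 l l l) (n 185 (n 173 l l l) l l)) l l)
      l l) l l) (n 318 l (n 176 l l (n 226 l l (n 12 l l l))) l)) (n 318 l l (n 176 (n 144 (n 12 l
      l l) l (n 12 l l (n 145 (n 134 l l l) l l))) l l)) l) l l) l) (n 141 l (n 191 (n 144 l (n 190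
      (n 160 l l (n 12 l (n 126 (n 67 l (n 1 l l l) l) l l) l)) l l) (n 124 (n 94 l l (n 12 l l l))
      l l)) l l) l) l), l, l, n 141 (n 206 (n 236 (n 176 l (n 56 l l (n 76 l (n 88 l (n 331 l l l)
      l) l)) (n 56 l l (n 76 l (n 88 l (n 331 l l l) l) l))) (n 190 l (n 219 (n 164 (n 231 l l l) l
      l) l (n 239 l (n 88 l l l) l)) l) (n 176 l (n 12 l l l) (n 190 (n 12 l l l) (n 219 (n 164 (n
      231 l l l) l l) l (n 239 l (n 88 l l l) l)) l))) (n 94 l (n 56 l l (n 76 l (n 219 l l l) l))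
      (n 56 l (n 200 l (n 331 l l l) l) (n 76 l (n 88 l (n 331 l l l) l) l))) l) l l, n 191 l l (n
      292 (n 226 (n 171 l (n 141 (n 206 (n 118 l (n 267 l (n 251 (n 210 l (n 311 l l l) l) l l) l)
      (n 173 l l l)) l l) l l) l) (n 171 l (n 141 (n 245 l (n 302 l l (n 190 (n 232 l l l) l l)) (n
      236 l l (n 124 (n 232 l l l) l l))) l l) l) l) l l), n 171 (n 141 l (n 283 l (n 118 (n 100 (n
      33 l (n 147 l l (n 245 l (n 311 (n 134 (n 166 l (n 210 l (n 124 l l l) l) l) l l) l l) l)) (n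
      232 (n 12 (n 126 (n 294 (n 1 l l (n 164 l l (n 115 l l l))) (n 188 (n 1 l l (n 164 l l (n 115
      l l l))) l l) l) l l) l l) l l)) (n 166 (n 68 (n 231 (n 182 (n 232 (n 191 (n 1 l l (n 33 l l
      (n 164 l l (n 209 l l l)))) l (n 1 l l (n 33 l l (n 164 l l (n 108 l l l))))) l l) l l) l l)
      l l) l l) l) (n 232 l l (n 173 (n 193 l l l) l l)) (n 182 l (n 251 (n 33 (n 100 l l (n 150 l
      l (n 1 (n 313 l l (n 164 l l l)) l l))) l l) (n 1 (n 33 (n 164 l l l) l l) l l) l) (n 33 (n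
      147 (n 231 l (n 297 l l (n 164 l l l)) (n 164 (n 278 (n 26 (n 1 l l (n 145 l l l)) l l) l l)
      l l)) l l) l l))) l) l) l l, l, n 171 (n 191 (n 327 (n 283 l (n 176 (n 232 (n 115 l l (n 177
      l l l)) l (n 294 l (n 188 l l l) l)) l l) l) (n 283 l (n 236 l (n 190 l l (n 160 (n 232 (n
      115 l l l) l l) l l)) (n 124 l l (n 94 (n 232 l l l) l l))) l) l) l l) l l, l, l, l, l] = true := by decide +kernel

theorem iL4 : rcheck 6 4 3958 13 5 R1
    [163, 177, 117, 150, 26, 11, 168, 1, 134, 68, 76, 0, 4, 56, 32]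
    [l, n 285 l (n 251 (n 151 (n 27 (n 253 (n 218 l (n 239 l (n 160 (n 231 (n 67 l l (n 219 (n 149
      (n 43 l l l) l l) l l)) l (n 43 l l l)) l (n 118 (n 68 l l (n 177 l l l)) l l)) l) l) (n 94 l
      (n 284 (n 245 (n 43 l l (n 209 (n 173 (n 67 l l l) l l) l l)) l (n 67 l l l)) l (n 118 (n 68
      l l l) l l)) l) l) l (n 231 (n 67 l l l) l (n 297 (n 43 l l (n 195 (n 108 l l l) l l)) (n 318
      l (n 134 l l l) (n 233 l l l)) l))) l (n 245 (n 67 l l l) l (n 311 (n 43 l l l) (n 194 l (n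
      138 l l l) (n 219 l l l)) l))) l (n 318 l (n 194 l (n 297 (n 231 (n 138 l (n 190 l l (n 117 l
      (n 163 l l l) l)) l) l l) (n 245 (n 138 l l l) l l) l) l) l)) (n 331 (n 345 (n 118 (n 251 (n
      318 l (n 194 l (n 173 (n 117 l (n 163 l l l) (n 150 (n 219 l l l) l l)) l (n 206 l l l)) l)
      l) l l) l l) l l) l l), l, l, n 231 (n 151 (n 160 (n 251 (n 118 (n 194 l (n 43 l l l) (n 43 l
      l l)) l (n 233 l l l)) l (n 219 (n 67 l l l) l l)) l l) l l) (n 284 (n 27 (n 251 (n 118 (n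
      318 l (n 67 l l (n 219 l l l)) (n 67 l l (n 219 l l l))) l (n 195 l l l)) l (n 233 (n 67 l l
      l) l l)) l l) l l) l, n 297 (n 194 l (n 218 l (n 27 (n 94 l (n 118 (n 43 (n 15 l (n 219 l l
      l) l) (n 33 l l (n 134 l l l)) l) l (n 43 l l l)) (n 43 l l l)) l (n 285 l (n 43 l l l) l))
      (n 219 l l l)) (n 43 l l l)) (n 94 l (n 318 l (n 27 (n 194 l (n 118 (n 43 (n 15 l (n 219 l l
      l) l) (n 33 l l (n 76 l l (n 1 l (n 5 l l (n 181 l l l)) l))) l) l (n 43 l l (n 195 l l l)))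
      (n 43 l l l)) l (n 185 l (n 67 l l l) l)) (n 219 l l l)) (n 209 (n 181 l l l) l l)) l, l, l,
      l, l, l, l] = true := by decide +kernel

theorem iK7 : rcheck 3 5 0 236 2 R1
    [115, 76, 134, 163, 1, 26, 117, 11, 32, 168, 0, 56, 68]
    [l, n 116 (n 102 (n 232 l (n 193 (n 117 l l l) l (n 185 (n 79 l (n 285 l l (n 244 l l l)) l)
      (n 285 l l (n 194 l (n 26 (n 115 l l l) l l) l)) l)) (n 79 l (n 179 l l (n 283 l l l)) l)) l
      (n 185 l (n 285 l l (n 194 l (n 144 l l l) l)) (n 94 l l l))) l (n 77 (n 87 (n 79 (n 94 l (n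
      179 l l l) l) (n 179 l l l) l) l (n 79 l l l)) l l), l, l, n 116 (n 102 (n 232 l (n 193 (n
      149 l (n 185 l l l) l) l (n 185 (n 173 l l (n 132 l l l)) (n 285 l l (n 244 l l l)) (n 144 l
      l l))) (n 79 l (n 179 l l l) l)) l (n 185 l (n 285 l l (n 283 l l l)) (n 183 l l l))) l (n 77
      (n 87 (n 79 l l l) l (n 79 l l l)) l l), n 79 (n 67 l l (n 219 l (n 11 l (n 43 l (n 194 l (n
      166 l l (n 163 l l (n 33 l l (n 285 l l (n 87 (n 141 l l l) (n 202 (n 278 l l l) (n 278 l l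
      l) l) (n 278 l l l)))))) (n 134 l l (n 1 l l (n 94 l (n 195 l l (n 285 l (n 302 (n 171 l l l)
      (n 283 l l l) l) l)) l)))) l) l) l)) l l, n 116 (n 77 l l (n 239 (n 231 l (n 331 (n 244 l l
      l) l l) l) l (n 231 l (n 331 l l (n 285 l (n 179 l l l) l)) l))) l (n 193 (n 57 l l l) l (n
      126 (n 185 (n 173 l l (n 171 l l l)) (n 149 (n 283 l l l) l l) (n 183 l l l)) (n 87 (n 79 (n
      144 l l l) l l) l (n 79 l l l)) l)), l, n 116 (n 77 l l (n 239 (n 166 (n 194 (n 302 l l l) l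
      l) l l) l (n 231 l (n 331 l l (n 285 l (n 43 l l l) l)) l))) l (n 193 (n 57 l l l) l (n 126
      (n 185 l (n 285 l l (n 283 l l l)) (n 183 l l l)) (n 87 (n 79 l l l) l (n 79 l l l)) l)), l,
      l, l] = true := by decide +kernel

theorem iK6 : rcheck 4 5 12 236 0 R1
    [11, 115, 68, 163, 168, 150, 26, 177, 32, 1, 56, 0, 4, 117]
    [n 265 (n 218 (n 100 (n 149 l (n 33 (n 206 l l l) l (n 151 l (n 116 l l l) l)) l) l (n 149 (n
      143 l (n 116 l l l) l) (n 88 l l (n 206 l l l)) l)) l l) l l, n 218 (n 340 (n 265 (n 100 (n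
      149 l l l) l (n 149 l l l)) l l) (n 178 l (n 185 l (n 128 l l l) l) l) (n 331 (n 141 (n 195
      (n 67 l (n 82 l l l) (n 149 l l l)) (n 149 l l l) l) l (n 67 l (n 171 l l l) l)) l l)) l (n
      340 l (n 178 l (n 232 (n 15 l l l) (n 128 l l l) l) l) (n 331 (n 67 l (n 171 l l l) (n 149 l
      l l)) l l)), l, n 141 (n 94 (n 195 (n 245 (n 178 l (n 119 (n 30 l (n 177 l (n 124 l l l) l)
      l) l l) l) l (n 178 l l l)) l l) l l) l l, n 195 (n 141 (n 94 (n 245 (n 178 l (n 294 l l l)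
      l) l (n 178 l (n 294 l l l) l)) l l) l l) (n 265 (n 218 (n 340 (n 100 (n 149 l l l) l (n 149
      l l l)) l l) l l) l l) l, n 265 (n 340 (n 100 (n 189 (n 331 l (n 285 l (n 116 l l l) (n 232 l
      l l)) (n 67 l l l)) (n 149 l l l) l) l (n 149 l l l)) (n 177 l (n 119 l l l) l) (n 331 (n 94
      (n 195 (n 67 l l l) (n 149 l l l) l) l (n 27 l l l)) (n 285 l (n 116 l l l) (n 149 l l l))
      l)) l (n 189 (n 331 l (n 285 l (n 124 l l l) (n 149 l l l)) (n 340 (n 67 l l l) l l)) (n 340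
      l (n 177 l (n 72 l l l) l) (n 331 (n 67 l l l) l l)) l), n 94 (n 141 (n 245 (n 189 l (n 67 l
      (n 171 l l l) l) l) l (n 189 l (n 67 l (n 171 l l l) l) l)) l l) l l, l, n 141 (n 94 (n 189 l
      (n 195 (n 265 (n 67 l l l) l (n 67 l l l)) l l) l) l l) l l, l, l, l] = true := by decide +kernel

theorem iR3_956_4_0 : icheck 6 5 5 3308 236 236 [(4, 6), (0, 11)]
    []
    [0, 1, 4, 11, 26, 32, 56, 68, 76, 115, 117, 177, 150, 163, 168, 134]
    (n 135 (n 169 l (n 138 (n 178 (n 154 (n 161 l (n 150 l l (n 168 (n 116 l l (n 119 l l l)) l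
      l)) (n 168 l l (n 69 (n 283 l l l) l l))) l l) l l) (n 168 l l (n 134 (n 178 (n 181 l l (n
      154 (n 161 l l (n 160 l l (n 166 l l (n 251 l l (n 202 l l l))))) l l)) l l) l l)) (n 179 (n
      168 l l (n 160 l l (n 166 l l (n 189 (n 178 (n 69 (n 283 l l l) l (n 231 l (n 150 l l l) l))
      l l) (n 150 (n 178 (n 118 l l (n 143 l l l)) l l) l l) l)))) l (n 150 l (n 181 l l (n 174 l l
      (n 145 (n 176 (n 182 (n 121 l l (n 118 l l l)) l l) l l) l l))) (n 167 (n 178 (n 209 l (n 87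
      l l l) (n 203 l (n 128 (n 87 l (n 77 (n 143 l l l) l l) l) l (n 267 l l l)) (n 118 (n 283 l l
      l) l (n 280 l (n 161 l l l) l)))) l l) (n 134 l (n 178 (n 69 l l l) l l) l) l)))) (n 138 (n
      151 (n 181 (n 176 l (n 168 l l (n 285 l l (n 236 l l l))) (n 168 l l (n 188 l (n 150 (n 163
      (n 182 l l (n 236 l (n 245 l l (n 280 l (n 118 l l l) l)) (n 285 l l l))) l l) l l) (n 121 l
      (n 117 (n 285 l l (n 236 l l l)) l l) (n 118 (n 267 l (n 77 l l l) l) l l))))) l l) l l) (n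
      134 (n 160 l l (n 166 l l (n 164 l (n 151 (n 181 (n 188 l l (n 251 l l (n 202 l l l))) l l) l
      l) (n 172 (n 188 (n 150 (n 121 l (n 143 l l l) (n 118 l l l)) l l) (n 163 l l (n 168 l (n 178
      (n 195 (n 189 (n 128 l l (n 117 l l l)) (n 128 l l (n 117 l l l)) l) (n 128 l l (n 117 l l
      l)) l) l l) l)) (n 231 l l (n 121 (n 80 l l l) l l))) (n 161 l (n 119 l l l) (n 236 l l (n
      121 (n 80 l l l) l l))) l)))) l l) (n 194 (n 151 (n 174 (n 172 (n 150 (n 166 (n 251 l l (n 68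
      l l l)) l (n 128 (n 87 l (n 102 (n 108 (n 118 (n 117 l (n 163 l l l) l) (n 117 (n 251 l l l)
      l l) l) l l) l l) (n 141 l l l)) (n 143 (n 149 l l l) l l) (n 202 (n 69 l l l) (n 88 (n 267 l
      l l) l l) (n 94 (n 294 (n 87 l l l) l l) l l)))) (n 166 l l (n 68 (n 116 l l l) l (n 218 l l
      l))) (n 283 l (n 149 l l (n 100 l (n 79 (n 116 l l l) l l) l)) (n 253 (n 88 l l l) l l))) (n
      168 l l (n 285 l l (n 72 l l l))) l) (n 178 l (n 172 (n 154 l (n 69 l (n 126 l (n 116 l l l)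
      l) l) (n 69 l l l)) (n 168 l l (n 285 l l (n 236 l l l))) l) l) (n 150 (n 172 (n 163 (n 134 l
      (n 176 l (n 188 l (n 143 l l l) (n 267 l l (n 231 l l (n 226 l l (n 218 l (n 141 l l (n 115 l
      l l)) l))))) (n 117 (n 249 l l l) (n 121 (n 76 (n 251 l l (n 56 l l (n 68 l l (n 115 l l
      l)))) l l) l l) l)) (n 285 l l (n 236 (n 68 l l l) l l))) (n 178 l (n 200 (n 176 l (n 236 l l
      (n 280 l l l)) (n 182 l (n 244 l l (n 231 l l l)) (n 239 l l (n 231 l l l)))) (n 121 l l l)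
      l) l) l) (n 80 (n 285 (n 117 (n 121 l l l) l l) l l) l (n 77 l l l)) l) (n 147 l l (n 116 l l
      l)) (n 134 l (n 265 l l l) l))) (n 150 (n 172 (n 195 (n 69 (n 115 (n 265 l l l) l (n 76 l (n
      56 (n 77 (n 57 l (n 117 l l (n 134 (n 116 l l l) l l)) l) l l) l l) l)) (n 115 l (n 116 (n
      267 l l l) l l) l) l) (n 203 l (n 141 l l l) (n 174 (n 149 (n 147 l l (n 115 l l l)) (n 280 l
      l (n 231 l l l)) (n 117 l l l)) l (n 280 l (n 285 l l (n 267 l l l)) (n 100 l l l)))) l) (n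
      188 (n 121 (n 244 l l l) (n 117 (n 118 l l l) l l) (n 267 l l l)) l l) l) l (n 218 l l (n 267
      l (n 77 l l l) l))) l) (n 179 (n 189 (n 126 l l l) l (n 244 l l l)) l (n 189 (n 182 l (n 236
      l (n 231 l l (n 244 l l (n 141 l l (n 134 l (n 115 l l l) l)))) (n 294 (n 102 (n 143 l l (n
      253 l l (n 117 (n 116 l l l) l l))) l l) l (n 102 l l (n 141 l l l)))) (n 168 l (n 174 (n 128
      l l (n 117 (n 294 (n 231 l (n 236 l l (n 76 l l l)) l) l l) l l)) (n 150 (n 280 (n 121 l l l)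
      l (n 236 l l (n 79 l l l))) (n 163 l l (n 134 (n 231 l l l) l l)) l) (n 150 (n 134 l (n 117 l
      l l) l) l l)) l)) l (n 151 (n 150 (n 77 (n 117 (n 219 l l l) l l) l l) (n 206 (n 57 l l (n
      116 l l l)) l (n 265 l l l)) (n 283 l l l)) l l))) l))) (n 151 (n 167 (n 172 (n 179 l (n 150
      (n 163 l (n 134 (n 164 (n 69 (n 115 l l l) (n 202 l l (n 77 l l (n 76 l l l))) l) l l) l l)
      l) l l) (n 163 (n 176 l (n 265 l l l) (n 169 l (n 164 (n 69 l l l) l l) (n 200 (n 141 l l l)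
      (n 147 l l l) l))) l l)) l l) (n 163 (n 154 l l (n 172 (n 179 l l (n 189 l l (n 195 l l (n
      121 (n 119 l l l) l (n 251 l l l))))) l l)) l l) (n 145 (n 134 l l (n 189 l l (n 195 l l (n
      154 l (n 150 (n 203 (n 209 (n 280 l l l) l l) l l) l l) (n 168 (n 203 (n 150 l (n 239 l l (n
      278 l (n 265 l l l) l)) (n 116 l l l)) (n 126 l l (n 115 l l l)) l) (n 138 l l (n 203 (n 209
      (n 79 l l l) l l) l l)) l))))) l (n 168 l (n 188 l l (n 174 (n 194 (n 200 (n 119 l l (n 116 l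
      l l)) l l) l l) l l)) (n 181 (n 176 l (n 128 (n 87 l (n 77 (n 143 l l l) l l) l) l (n 285 l l
      l)) (n 182 l (n 128 l l (n 285 l l l)) (n 118 (n 249 l l l) (n 128 (n 116 l l l) l l) (n 294
      l (n 179 l l l) l)))) (n 150 (n 163 l (n 69 l l l) l) l l) l)))) l (n 172 (n 178 (n 167 (n
      174 l (n 163 l l (n 168 l (n 134 (n 169 (n 116 l l (n 119 l l l)) l l) l l) l)) (n 134 l l (n
      169 (n 69 (n 249 l l l) l l) (n 69 l l l) l))) l l) l l) (n 168 (n 178 (n 181 l l (n 167 (n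
      174 l l (n 194 l l (n 200 l l (n 72 (n 283 l l l) l (n 202 l l l))))) l l)) l l) l l) (n 145
      (n 134 l l (n 194 l l (n 200 l l (n 176 (n 178 (n 116 (n 251 l l l) l (n 265 l (n 163 (n 164
      l l l) l l) l)) l l) (n 163 (n 178 (n 77 l l l) l l) l l) l)))) l (n 163 l (n 181 l l (n 161
      l l (n 179 (n 189 (n 195 (n 119 l l (n 116 l l l)) l l) l l) l l))) (n 154 (n 178 (n 203 l (n
      128 (n 87 l (n 77 (n 143 l l l) l l) l) l (n 280 l l l)) (n 209 l (n 128 l l (n 280 l l l))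
      (n 118 (n 249 l l l) (n 128 (n 116 l l l) l l) (n 267 l (n 174 l l l) l)))) l l) (n 168 l (n
      178 (n 69 l l l) l l) l) l))))) (n 172 (n 164 (n 181 (n 161 (n 195 l (n 134 l l (n 251 l l (n
      202 l l l))) (n 134 l l (n 169 (n 188 l (n 150 (n 189 l l (n 251 l l l)) l l) (n 121 (n 119 l
      (n 115 (n 249 l l (n 72 l l l)) l l) l) (n 117 (n 251 l l (n 202 l l l)) l l) (n 118 (n 280 l
      l l) l l))) (n 118 (n 116 l l l) (n 128 l l l) (n 121 l l l)) l))) (n 163 (n 168 (n 178 l l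
      (n 150 l (n 169 l (n 116 l l l) l) l)) l l) l l) l) l l) l l) (n 168 (n 194 (n 280 l l l) l
      (n 200 (n 239 l l l) l (n 167 (n 151 l l (n 169 (n 163 (n 251 (n 280 l l (n 174 l l l)) l (n
      72 (n 60 l l (n 115 l l l)) l (n 245 l l l))) (n 178 l (n 164 (n 218 l l (n 267 l l l)) l l)
      l) l) l l)) l (n 161 (n 181 (n 150 l (n 283 l l l) (n 164 (n 188 l l (n 166 (n 176 (n 178 l
      (n 119 l l (n 265 l l l)) (n 119 l l l)) (n 121 l l (n 118 l l l)) l) (n 147 (n 100 l (n 79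
      (n 119 l l l) l l) l) l (n 115 l l l)) l)) (n 121 l l (n 118 l l l)) l)) l (n 128 l l (n 117
      l l l))) (n 151 l l (n 169 (n 265 l l l) l l)) (n 178 l (n 163 (n 121 l (n 143 l l l) (n 118
      l l l)) l l) l))))) l l) (n 166 (n 169 (n 164 (n 161 (n 138 (n 163 (n 194 (n 236 l l (n 76 l
      l l)) l (n 128 (n 87 l (n 102 (n 108 (n 118 (n 117 l (n 150 l l l) l) (n 117 (n 285 l l l) l
      l) l) l l) l l) (n 141 l l l)) (n 143 (n 149 l l l) l l) (n 236 (n 69 l l l) (n 88 (n 280 l l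
      l) l l) (n 94 (n 294 (n 87 l l l) l l) l l)))) (n 194 l l (n 68 (n 116 l l l) l (n 218 l l
      l))) (n 202 l (n 141 l (n 126 l l l) (n 94 (n 168 l l l) l l)) (n 294 (n 102 (n 143 l l (n
      176 (n 117 (n 218 l l l) l l) l l)) l l) l (n 102 l l l)))) (n 134 l l (n 251 l l (n 72 l l
      l))) l) (n 178 l (n 138 (n 167 l (n 69 l l l) (n 69 l l l)) (n 134 l l (n 251 l l (n 202 l l
      l))) l) l) (n 163 (n 138 (n 150 (n 168 l (n 195 l (n 188 l (n 100 l l l) (n 147 l (n 119 (n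
      278 l l l) l l) (n 115 l l l))) (n 117 (n 283 l l l) (n 121 (n 115 (n 285 l l l) l l) l l)
      l)) (n 251 l l l)) (n 178 l (n 160 (n 195 l (n 251 l (n 128 (n 267 l l (n 231 l l l)) l l) (n
      206 l l l)) (n 189 l (n 251 l l (n 218 l l l)) (n 69 l l l))) (n 72 l l l) l) l) l) (n 80 (n
      251 (n 117 (n 121 l l l) l l) l l) l (n 77 l l l)) l) (n 100 (n 283 l l l) l l) (n 168 l (n
      231 l l l) l))) (n 163 (n 138 (n 176 (n 69 (n 219 l l (n 115 l l (n 56 (n 57 l (n 77 (n 117 l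
      l (n 168 (n 116 l l l) l l)) l l) l) l l))) (n 115 l (n 116 (n 280 l l l) l l) l) l) (n 209 l
      (n 147 l l (n 115 l l l)) (n 161 (n 267 l l l) l (n 267 l (n 251 l l (n 280 l l l)) (n 231 l
      l l)))) l) (n 188 (n 121 l (n 117 (n 118 l l l) l l) (n 280 l l l)) l l) l) l (n 280 l l (n
      231 l l l))) l) (n 178 l l (n 164 (n 138 (n 203 (n 209 (n 150 (n 285 l l (n 236 l l l)) (n
      163 (n 168 (n 151 (n 69 (n 115 l l l) (n 236 l l (n 77 l l (n 76 l l l))) l) l l) l l) l l)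
      l) l l) l l) l l) l l)) l) (n 169 (n 145 (n 182 (n 202 l (n 218 l l (n 280 (n 239 l l l) l (n
      251 l l l))) (n 149 (n 108 l l l) l (n 253 l l (n 117 l l l)))) l (n 251 l (n 147 l (n 149 l
      l l) (n 116 l l l)) l)) l (n 182 (n 189 l (n 251 l (n 267 l l (n 190 l l (n 147 l l (n 168 l
      l l)))) (n 100 l l (n 245 l l l))) (n 134 l (n 161 (n 126 l l l) (n 163 (n 226 (n 80 l l l) l
      (n 249 (n 119 l l l) l (n 79 l l l))) (n 150 l l (n 168 (n 218 l l l) l l)) l) (n 163 (n 168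
      l (n 115 l l l) l) l l)) l)) l (n 164 (n 163 (n 118 l l (n 149 (n 178 l (n 251 l l l) l) l
      l)) (n 100 (n 249 l l l) l l) (n 210 l l (n 147 (n 72 l l l) l (n 115 l l l)))) l l))) (n 150
      (n 244 l l (n 236 l l l)) l l) l) l))) = true := by decide +kernel

theorem iR3_956_4_5 : icheck 6 5 5 3308 236 236 [(4, 6), (5, 11)]
    []
    [68, 150, 11, 56, 177, 134, 115, 76, 26, 163, 168, 117, 1, 0, 32, 4]
    (n 219 (n 224 l (n 313 (n 231 l (n 265 (n 94 (n 183 l (n 236 l l (n 176 l (n 87 l (n 174 (n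
      172 l (n 169 (n 185 l l l) l (n 69 l l l)) l) l l) l) l)) l) l l) l l) l) (n 236 (n 176 l l
      (n 318 (n 203 (n 87 (n 183 (n 144 l (n 126 l (n 174 l l (n 132 l l (n 82 (n 160 l (n 100 l l
      l) l) l l))) l) l) l l) l l) l l) l l)) (n 318 (n 144 (n 94 (n 126 (n 253 l l l) l l) l l) (n
      87 (n 249 (n 82 (n 126 l (n 231 (n 160 l (n 345 (n 27 l l l) l (n 210 l (n 203 (n 88 l (n 209
      l l l) (n 100 (n 60 (n 138 (n 56 l l l) l l) l l) l l)) l (n 69 l l l)) (n 166 (n 77 l l l)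
      (n 108 l (n 134 (n 43 (n 72 l l l) l l) l l) l) l))) (n 76 l l l)) l (n 174 l l (n 132 l l (n
      69 l l l)))) (n 80 l (n 57 l (n 267 l l l) l) l)) l (n 231 (n 253 (n 80 l (n 77 l l l) l) l
      l) l l)) (n 231 (n 37 l (n 203 (n 160 (n 172 l l l) l l) l l) l) l l) (n 37 (n 203 (n 160 l
      (n 15 (n 43 l l (n 182 l l l)) (n 138 l l l) l) l) l l) l l)) l (n 253 (n 231 (n 249 l (n 210
      (n 77 (n 69 l l l) (n 15 l l l) (n 169 l (n 115 l (n 116 l l (n 76 l l l)) l) l)) l l) l) l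
      l) l l)) (n 231 (n 94 (n 126 (n 249 l (n 37 l (n 203 (n 100 (n 69 l l (n 57 (n 77 l l l) l
      l)) l l) l (n 27 (n 69 l l l) (n 167 l l l) l)) (n 69 l l l)) (n 80 (n 72 (n 68 l l l) l l)
      (n 77 (n 185 l l l) l l) l)) l (n 37 l (n 138 (n 134 l l (n 68 l l l)) l l) l)) (n 100 (n 166
      l l l) l (n 88 (n 135 l l l) l l)) l) l l)) l l) (n 144 l (n 231 (n 37 (n 183 (n 94 l (n 265
      l (n 226 (n 176 (n 172 l (n 169 (n 185 l l l) l (n 69 l l l)) l) l l) l l) l) l) l l) l l) l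
      l) l)) (n 176 l (n 318 (n 174 (n 253 l l l) l l) l l) l)) (n 313 (n 231 l (n 171 (n 176 (n
      179 (n 249 l (n 30 l l l) l) (n 87 (n 94 l (n 167 l l l) l) (n 94 l (n 249 l (n 174 (n 57 l
      (n 151 l l l) l) l l) (n 77 (n 69 l l l) l l)) (n 169 l l l)) l) l) l l) (n 203 (n 345 l l (n
      182 (n 151 l l l) l (n 108 l (n 150 l l l) l))) l l) l) l) (n 236 (n 226 (n 179 l (n 171 (n
      253 l l l) l l) l) l l) (n 37 l (n 249 l (n 94 (n 226 (n 126 (n 60 (n 200 l l l) l (n 72 (n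
      169 l l (n 57 l l l)) l l)) l (n 203 (n 318 (n 160 (n 100 (n 60 l l l) l l) l l) l l) l l)) l
      (n 231 (n 151 (n 182 l l l) l l) l l)) l (n 226 (n 176 l l (n 318 (n 27 (n 69 l l l) l l) l
      l)) l l)) (n 231 (n 318 (n 253 (n 203 (n 265 (n 144 l l (n 195 l (n 11 l l l) l)) (n 172 l l
      l) l) l l) l l) l l) l l)) (n 144 l (n 231 (n 226 (n 203 (n 265 l l (n 151 l l l)) l l) l l)
      l l) l)) l) l)) (n 318 (n 132 (n 265 (n 144 (n 226 l (n 179 (n 236 l (n 164 (n 69 (n 185 l l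
      l) l l) (n 163 l l l) l) l) l l) l) l l) l l) l l) (n 236 (n 231 l (n 313 (n 203 (n 144 (n
      132 (n 171 l (n 249 (n 37 (n 160 l (n 179 l (n 226 l (n 154 (n 68 l l l) l l) (n 72 l l l))
      (n 30 l l l)) (n 116 l (n 119 l l (n 72 l l l)) l)) l (n 167 l l l)) l (n 94 l l (n 226 l (n
      126 (n 37 l (n 72 l l l) l) l l) l))) (n 82 l (n 160 (n 56 l l l) l l) l)) (n 176 (n 87 l (n
      82 l (n 80 l l (n 30 l (n 164 (n 151 l l l) (n 77 l (n 150 l l l) l) l) l)) (n 69 (n 88 l l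
      l) l l)) l) l l) (n 87 (n 26 l l (n 163 l (n 77 l l l) l)) (n 160 (n 249 l (n 126 (n 60 l l
      l) l (n 88 l l l)) (n 94 l l (n 126 (n 27 (n 69 l l l) (n 30 (n 68 l l l) l (n 68 l l l)) l)
      l l))) l l) l)) (n 253 (n 210 l (n 37 (n 176 (n 249 (n 94 l (n 80 l (n 151 (n 267 l l l) (n
      69 l l (n 267 l l l)) l) l) (n 60 l l l)) l (n 154 l l l)) (n 249 (n 88 l l l) l l) l) (n 72
      (n 68 l l (n 138 l l (n 154 l l l))) l (n 30 l (n 167 l l l) l)) l) l) l l) (n 253 (n 210 (n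
      176 (n 87 l (n 174 (n 126 (n 82 l (n 15 l l l) l) l (n 76 (n 68 l l l) l l)) l l) l) l l) (n
      37 (n 249 (n 100 l l (n 166 (n 108 l l l) l l)) l (n 69 l l l)) l l) l) l l)) (n 94 l (n 37
      (n 210 (n 151 l l l) (n 126 l (n 132 (n 297 (n 340 l l (n 249 (n 58 l (n 76 l (n 134 (n 164 l
      l l) l l) l) (n 195 l (n 108 l l l) l)) l (n 253 (n 195 l l l) l l))) l l) l l) l) l) l l) l)
      (n 144 (n 183 l l (n 265 l l (n 226 l (n 126 l (n 37 (n 171 l (n 132 (n 119 l (n 164 (n 185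
      (n 69 l l l) l l) (n 30 l l l) l) l) l l) l) l l) l) l))) l l)) l l) (n 87 (n 183 (n 144 l (n
      265 l (n 226 (n 224 (n 164 (n 69 (n 185 l l l) l l) (n 163 l l l) l) l l) l l) l) l) l l) l
      l)) l (n 313 (n 340 l l (n 37 (n 183 (n 94 l (n 126 l (n 179 l l (n 132 (n 82 l l (n 253 (n
      210 l (n 108 l l l) l) l l)) l l)) l) l) l l) l l)) l l)) (n 226 l (n 313 (n 179 (n 340 l l
      (n 144 l l (n 231 (n 37 l l (n 82 (n 94 (n 265 (n 87 (n 171 l (n 224 l l (n 253 (n 210 l (n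
      60 l l l) l) l l)) l) l l) l l) l l) l l)) l l))) l l) l l) l)) (n 82 (n 176 (n 226 l (n 87 l
      (n 253 (n 80 l l l) l l) (n 126 l (n 37 (n 56 l (n 150 l l l) l) l l) l)) l) (n 236 (n 144 (n
      203 (n 179 l (n 160 l (n 226 l (n 132 (n 87 l (n 313 (n 302 (n 72 l l l) l l) l l) (n 30 l (n
      143 l l l) l)) l l) (n 151 l l l)) l) l) l l) l l) (n 231 (n 174 (n 72 (n 68 l l (n 56 (n 138
      l l l) l l)) l (n 60 (n 80 l l l) l l)) (n 210 l (n 318 (n 313 l (n 340 (n 60 (n 88 l l (n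
      100 l l l)) (n 154 l l l) l) l (n 249 (n 87 (n 160 l (n 182 (n 167 (n 138 (n 150 (n 56 l l l)
      l l) l l) l l) l l) (n 138 (n 134 l l l) l l)) l (n 27 l l l)) l (n 253 (n 88 l l l) l l)))
      l) l (n 87 (n 37 l l (n 224 l l (n 77 l l l))) l l)) (n 126 l (n 87 (n 182 (n 116 l (n 151 l
      l (n 138 l l l)) l) l l) l l) l)) l) l l) (n 183 l (n 94 (n 265 (n 144 (n 226 l (n 313 (n 172
      l (n 167 l (n 143 l (n 151 l l l) l) l) l) l l) l) l l) l l) l l) l)) (n 203 (n 345 l l (n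
      160 (n 100 (n 69 l l l) l l) (n 179 l (n 154 (n 150 l l l) l (n 138 (n 30 l (n 43 l l (n 151
      l l l)) l) l l)) (n 87 (n 249 (n 172 l (n 169 l l l) l) l l) (n 154 (n 58 l l l) l l) l)) l))
      l l)) (n 318 (n 236 l (n 171 (n 226 (n 174 (n 249 l (n 30 l l l) l) (n 37 (n 144 l (n 172 l l
      l) l) (n 249 l (n 179 (n 144 l (n 26 (n 68 l l l) (n 151 l l l) l) (n 72 l l l)) l (n 163 l l
      l)) (n 30 (n 72 l l l) (n 27 (n 185 l l l) l l) l)) l) l) l l) (n 253 (n 340 l l (n 182 (n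
      151 l l (n 166 l l l)) l (n 58 l (n 150 l l l) l))) l l) l) l) (n 231 l (n 87 l (n 236 (n 253
      (n 313 (n 210 (n 171 (n 176 (n 249 l (n 160 (n 167 l (n 27 l (n 173 l l l) l) l) l (n 195 l
      (n 280 l l (n 173 l l l)) l)) (n 195 l (n 280 l l (n 173 l l l)) l)) l (n 60 l l l)) (n 172 l
      (n 169 l l l) (n 15 (n 60 l l l) l l)) l) l (n 126 (n 15 (n 200 l l l) l l) l l)) l (n 163 l
      (n 195 l l l) l)) l (n 126 (n 249 l (n 210 (n 169 l (n 15 l l l) l) l l) l) l l)) l (n 265 l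
      l (n 176 (n 179 l l (n 171 (n 249 l (n 302 (n 203 (n 172 l (n 169 l l l) l) l l) (n 160 (n
      164 l (n 56 l l l) l) l l) l) l) l l)) l l))) (n 94 l (n 236 (n 176 (n 253 (n 265 l l (n 15 l
      l l)) l l) l l) l l) l)) l) l) l)) = true := by decide +kernel

theorem iR3_1881_5_0 : icheck 6 5 5 3441 236 236 [(5, 6), (0, 11)]
    []
    [150, 177, 11, 56, 117, 134, 115, 76, 26, 168, 163, 68, 1, 0, 32, 4]
    (n 280 (n 285 l (n 253 (n 226 (n 203 (n 340 l (n 126 (n 37 l (n 179 l l (n 174 (n 132 l (n 200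
      l (n 236 l l l) l) l) l l)) l) l l) l) l l) l l) (n 219 (n 179 l (n 171 (n 174 (n 160 (n 60
      (n 168 l (n 209 l l l) l) l l) l (n 265 l (n 57 l l l) l)) l (n 200 l (n 56 l l l) l)) l l)
      l) (n 313 (n 345 (n 176 l (n 340 l (n 87 (n 126 l (n 318 l (n 167 l l l) (n 82 (n 172 l l l)
      l l)) (n 15 l l l)) l l) (n 292 (n 126 l (n 167 l (n 164 l l (n 245 l l l)) l) (n 15 l l l))
      l l)) (n 179 l l (n 265 (n 182 (n 151 l l l) l l) (n 15 l l l) l))) l (n 80 l l l)) l (n 82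
      (n 30 l l l) l l)) (n 340 l (n 345 (n 160 (n 82 (n 143 l (n 179 l (n 226 l (n 169 (n 178 l l
      (n 265 l l l)) (n 56 (n 124 l l l) l l) l) (n 58 l l l)) (n 265 l l (n 11 l l l))) l) (n 171
      (n 121 l l (n 15 (n 60 l l l) l l)) l l) (n 265 l (n 193 (n 88 l l (n 209 (n 178 l l (n 181 l
      l (n 124 l l l))) l l)) l (n 80 l l l)) l)) l (n 203 (n 87 (n 82 (n 143 l (n 265 (n 26 l l l)
      l (n 80 l l l)) l) l l) l l) l l)) l (n 80 l l l)) l)) (n 345 (n 226 (n 318 l (n 210 (n 126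
      (n 203 (n 160 (n 37 l (n 132 (n 200 l l (n 88 l l l)) (n 219 (n 265 l (n 200 l l l) l) (n 134
      (n 181 (n 76 l l l) (n 154 l l l) (n 151 l l l)) (n 135 (n 182 l l l) l (n 151 l l l)) (n 150
      l l l)) (n 169 l (n 172 l l l) l)) l) (n 292 l (n 12 l l l) l)) l l) l l) (n 219 (n 200 l (n
      168 l l l) l) (n 224 (n 209 (n 178 l l l) l (n 88 l l l)) l (n 172 l l l)) l) l) l l) l) (n
      179 l (n 82 (n 174 (n 203 (n 143 l (n 209 (n 80 l (n 154 (n 181 l l (n 178 l l l)) l l) l) (n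
      195 l l (n 108 l (n 245 l l l) l)) (n 182 (n 57 l l (n 12 (n 108 l (n 245 l l l) l) l l)) l
      l)) (n 149 (n 182 (n 151 l l l) l l) l l)) l l) l (n 265 (n 176 l (n 313 (n 195 l (n 200 l (n
      76 l l l) l) l) l (n 167 l l l)) l) l l)) (n 172 l (n 169 (n 151 l l l) l l) l) l) l) l) l
      l)) (n 340 (n 313 (n 210 (n 297 l l (n 232 (n 253 (n 181 (n 209 l l l) l l) l l) (n 178 l l
      l) l)) l l) l l) (n 179 (n 210 (n 219 (n 168 (n 150 l l (n 245 l l l)) l (n 117 (n 172 l l l)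
      l l)) (n 318 l (n 203 (n 126 (n 232 (n 12 (n 195 l l l) l (n 57 (n 118 (n 182 (n 15 l l l) l
      l) l l) l l)) (n 265 l (n 226 (n 15 l l (n 60 (n 117 l l l) l l)) l l) l) l) (n 181 (n 177 l
      l (n 56 (n 15 (n 182 l l l) l l) l l)) l (n 60 (n 119 l (n 182 l l (n 178 l l l)) l) l l)) l)
      l (n 232 (n 167 l (n 164 l l l) l) l l)) l) l) l l) (n 132 (n 232 (n 226 l (n 174 (n 203 (n
      171 l (n 149 (n 172 l (n 151 l l l) l) (n 58 l l (n 200 l (n 185 l l l) l)) l) (n 82 l l (n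
      219 (n 160 (n 60 l l l) l l) l l))) l (n 171 l (n 219 l l (n 181 (n 177 l l l) l (n 154 (n 30
      l (n 117 l l l) l) l l))) l)) l (n 265 (n 292 l l (n 203 (n 82 l l (n 219 (n 57 (n 43 l l l)
      (n 151 l l l) l) l l)) l l)) l l)) l) l l) (n 292 l l (n 174 (n 178 l l l) l (n 149 l l l)))
      l) l) (n 292 l (n 203 (n 219 (n 37 l (n 132 (n 297 l (n 174 (n 226 l (n 121 (n 200 l l l) l
      (n 154 l l l)) l) l (n 200 l l l)) l) l l) l) (n 253 (n 210 (n 87 l (n 82 (n 121 l l l) l (n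
      58 l l l)) (n 15 l l l)) l l) l l) l) l l) l))) (n 203 (n 176 (n 126 (n 253 (n 345 l (n 87 l
      (n 179 (n 82 l (n 285 (n 167 l (n 164 l l l) l) l l) l) l l) l) l) l l) l l) l l) (n 179 (n
      340 (n 210 (n 345 l (n 132 (n 193 (n 265 (n 226 l (n 172 l l l) l) l l) (n 285 (n 265 (n 171
      l (n 174 l (n 37 (n 224 l (n 77 l l l) (n 82 (n 167 l (n 57 (n 124 l l l) (n 151 l l l) l) l)
      (n 154 (n 121 (n 150 l l l) l l) l l) l)) l (n 224 l l (n 58 l l l))) (n 11 l l l)) (n 226 l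
      (n 60 l l l) l)) l (n 318 l (n 176 (n 43 l (n 182 l l l) l) (n 58 l l l) l) l)) l (n 88 l l
      l)) l) (n 143 (n 171 (n 232 l (n 318 (n 176 (n 80 l l l) (n 172 l l l) l) (n 174 l (n 226 (n
      149 l l (n 154 l (n 119 l l l) (n 181 l l l))) l (n 169 l (n 121 l l l) l)) (n 57 l l l)) (n
      172 l (n 116 l l l) l)) (n 121 (n 149 l l l) l l)) l l) l l) (n 265 l (n 171 (n 143 (n 224 l
      (n 15 l l l) (n 88 l l l)) l (n 27 l l l)) l l) l)) (n 318 l (n 143 (n 171 (n 232 l (n 172 l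
      (n 178 (n 245 l l l) l l) l) (n 121 l l l)) l l) l l) l)) (n 265 (n 318 (n 292 (n 345 l (n
      169 l l l) l) l l) l l) l l) (n 37 (n 174 l (n 171 (n 224 (n 232 l (n 143 (n 60 l l l) l l)
      l) l l) (n 253 (n 345 l (n 132 (n 193 l (n 285 (n 265 (n 77 l l l) l (n 27 l l l)) l l) l) l
      l) l) l l) (n 88 l l l)) l) l l)) l (n 176 (n 58 l l l) l l)) (n 318 (n 313 l (n 87 (n 292 (n
      224 l (n 143 (n 297 (n 167 l l l) l (n 219 (n 200 (n 182 l l l) (n 177 (n 115 l (n 236 l l l)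
      l) l l) l) l (n 167 l (n 164 l l l) l))) l l) l) l l) l l) l) l l) (n 285 (n 340 (n 226 (n
      167 l (n 57 l l l) l) (n 224 l (n 318 (n 313 l (n 15 (n 43 l l (n 88 l l l)) (n 12 (n 124 l l
      l) l l) l) (n 132 (n 169 l (n 172 l l l) l) l l)) l (n 132 (n 108 l l l) l l)) l) (n 318 (n
      182 (n 209 (n 151 l l l) l l) l l) l l)) l (n 58 l l l)) l l)) (n 345 l (n 340 (n 176 (n 313
      l (n 160 (n 126 (n 253 (n 210 (n 87 l (n 82 l (n 285 (n 224 (n 265 l (n 167 l l l) l) (n 134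
      (n 245 l l (n 150 l (n 265 l l l) l)) (n 135 (n 182 l l l) l (n 151 (n 182 l l l) l l)) (n
      150 l l l)) (n 167 l (n 231 l l l) l)) l (n 167 l (n 231 l l l) l)) l) (n 292 l (n 12 l l l)
      l)) l l) l l) (n 87 (n 224 (n 167 l (n 164 l l l) l) (n 219 (n 209 (n 178 l l l) l (n 88 (n
      58 l (n 154 l l (n 151 l l (n 182 (n 245 l l l) l l))) l) l l)) l (n 167 l l l)) l) l l) l) l
      l) l) (n 174 l (n 285 (n 132 (n 179 (n 253 (n 193 l (n 181 (n 58 l l l) l (n 154 (n 56 l l (n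
      11 (n 30 l (n 245 l l l) l) l l)) l l)) (n 149 (n 182 (n 151 l l l) l l) l (n 182 l l l))) l
      l) l (n 265 (n 226 l (n 313 (n 172 l l l) l (n 200 l l l)) l) l l)) (n 167 l (n 164 l l (n 57
      (n 245 l (n 209 l l l) l) l l)) (n 60 (n 88 l l (n 43 (n 181 l l l) l l)) l l)) l) l (n 253
      (n 210 (n 167 l (n 135 (n 124 l l l) (n 124 l (n 57 (n 182 l l l) l l) l) l) l) l l) l l)) l)
      l) l l) l)) (n 193 (n 179 (n 318 l (n 132 l (n 203 l (n 143 (n 224 (n 340 (n 285 l l (n 121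
      (n 117 l l l) (n 118 l l l) (n 154 (n 77 l l l) l l))) l (n 167 l (n 164 (n 151 l l l) l (n
      178 l l l)) l)) l (n 163 l (n 118 (n 185 l l (n 149 l l l)) l l) l)) l (n 292 (n 253 l (n 345
      (n 224 (n 167 l (n 164 l l (n 245 l (n 178 l l l) l)) l) l l) l l) l) l l)) (n 57 l (n 151 l
      l l) l)) (n 209 (n 178 l l (n 151 (n 88 l l l) l l)) l (n 182 (n 57 l l l) l l))) l) (n 174
      (n 253 l (n 313 (n 167 l l l) (n 82 l (n 345 (n 176 (n 171 (n 160 (n 318 (n 132 l (n 169 l l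
      (n 119 l (n 151 (n 245 l l l) l l) (n 172 l (n 30 l l (n 121 (n 144 l l l) l l)) l))) (n 57 l
      l l)) l (n 200 (n 182 (n 151 l l l) l l) l (n 182 (n 88 l l (n 178 l l l)) l l))) l (n 57 l l
      l)) l (n 149 (n 121 l l l) (n 88 l l l) l)) l (n 87 (n 219 (n 182 (n 151 l l l) l (n 209 (n
      58 l (n 121 l l l) l) l l)) l l) l l)) l (n 224 l (n 219 (n 121 l l l) l l) l)) (n 265 l (n
      176 (n 160 (n 209 (n 178 l l l) l l) l l) l l) l)) l) (n 226 l (n 149 l l l) l)) l l) (n 37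
      (n 318 l (n 292 (n 253 l (n 219 l (n 345 (n 169 l (n 172 l l l) l) l (n 172 l l l)) l) l) l
      l) l) (n 345 (n 340 l (n 171 (n 160 (n 132 l (n 265 l (n 15 l l l) (n 30 (n 121 l l l) l l))
      (n 167 l l l)) l l) l l) l) l l) l)) (n 345 (n 318 (n 160 (n 302 l l (n 232 (n 203 (n 209 (n
      181 l l (n 154 (n 88 l l l) l l)) (n 149 (n 171 l (n 167 l l l) l) l l) l) l l) (n 178 l l l)
      l)) l l) l l) (n 174 (n 160 (n 224 (n 167 l (n 164 l l l) l) (n 313 l (n 253 (n 126 (n 232 (n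
      12 (n 200 l l l) (n 77 l l l) (n 57 (n 118 l l l) l l)) (n 265 l (n 176 (n 15 l l l) l l) l)
      l) (n 178 (n 209 l l (n 88 (n 183 (n 115 l l (n 177 l l l)) l l) l l)) l (n 57 (n 116 l (n
      182 l l l) l) l l)) l) l (n 232 (n 172 l l l) l l)) l) l) l l) (n 82 (n 232 (n 176 l (n 179
      (n 253 (n 171 l (n 149 (n 167 l (n 151 l l l) l) (n 108 l l l) (n 43 (n 163 (n 150 l l l) l
      (n 118 (n 117 l l l) l l)) l l)) (n 132 l l (n 224 (n 210 (n 60 l l l) l l) l l))) l (n 171 l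
      (n 224 l l (n 181 (n 209 l l l) l l)) l)) l (n 265 (n 292 l l (n 253 (n 132 l l (n 224 (n 167
      l (n 118 l l l) l) l l)) l l)) l l)) l) l l) (n 292 l l (n 179 (n 164 l (n 80 (n 154 l l l)
      (n 117 l l l) l) l) l (n 149 l l l))) l) l) (n 292 l (n 253 (n 224 (n 87 l (n 82 (n 302 l (n
      179 (n 176 l (n 143 l (n 27 l l l) (n 121 l l l)) l) l (n 167 l l l)) l) l l) l) (n 203 (n
      160 (n 132 (n 76 l (n 135 (n 202 l l (n 166 l l l)) l l) l) l (n 108 l l l)) l l) l l) l) l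
      l) l)) l)) = true := by decide +kernel

theorem iZ_956_0_0 : icheck 6 5 5 3308 236 236 [(6, 7), (11, 12)]
    [(4, 6, 0), (4, 7, 0), (4, 11, 0), (4, 12, 0)]
    [117, 1, 76, 115, 32, 134, 150, 177, 56, 4, 26, 168, 163, 11, 0, 68]
    (n 88 l (n 102 l (n 121 l (n 5 (n 173 l l l) l l) l) l) (n 32 l (n 124 (n 26 l l (n 115 l l
      l)) (n 56 (n 171 l l l) l (n 102 l (n 121 l l l) l)) l) (n 67 (n 12 (n 1 (n 345 l (n 280 l l
      l) l) l l) l (n 169 (n 253 l l l) l l)) (n 124 l l l) (n 37 l l (n 80 l l l))))) = true := by decide +kernel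

theorem iZ_956_0_1 : icheck 6 5 5 3308 236 236 [(6, 7), (11, 14)]
    [(4, 6, 0), (4, 7, 0), (4, 11, 1), (4, 14, 1)]
    [56, 168, 134, 117, 76, 163, 115, 150, 0, 26, 68, 1, 11, 32, 4, 177]
    (n 76 l (n 117 (n 202 l (n 163 l l l) l) l l) (n 160 l l l)) = true := by decide +kernel

theorem iZ_956_2_0 : icheck 6 5 5 3308 236 236 [(6, 9), (11, 12)]
    [(4, 6, 2), (4, 9, 2), (4, 11, 0), (4, 12, 0)]
    [1, 4, 76, 134, 26, 68, 150, 115, 11, 168, 32, 163, 117, 56, 0, 177]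
    (n 82 l (n 1 (n 181 (n 154 (n 172 l l l) l l) (n 37 (n 166 (n 172 l l l) l l) (n 145 (n 154 (n
      87 l l l) l l) l l) l) l) (n 151 (n 169 l l l) l l) l) (n 57 (n 206 l (n 224 l l l) l) (n 151
      (n 169 l l l) l l) l)) = true := by decide +kernel

theorem iZ_956_2_1 : icheck 6 5 5 3308 236 236 [(6, 9), (11, 14)]
    [(4, 6, 2), (4, 9, 2), (4, 11, 1), (4, 14, 1)]
    [76, 150, 11, 56, 115, 117, 1, 177, 4, 163, 168, 134, 26, 68, 32, 0]
    (n 283 (n 154 l (n 151 (n 80 l l l) l l) l) (n 318 (n 244 l (n 218 (n 183 l l l) (n 144 l l (n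
      76 l l l)) (n 150 (n 179 l l l) l l)) l) (n 313 (n 244 (n 121 (n 60 l (n 183 (n 76 (n 149 l l
      l) l l) l (n 144 l l l)) l) l l) l l) l l) l) l) = true := by decide +kernel

theorem iZ_1881_0_0 : icheck 6 5 5 3441 236 236 [(6, 7), (11, 12)]
    [(5, 6, 0), (5, 7, 0), (5, 11, 0), (5, 12, 0)]
    [115, 76, 68, 168, 177, 134, 150, 117, 56, 1, 11, 26, 163, 4, 0, 32]
    (n 135 l (n 79 l (n 233 (n 87 (n 179 (n 37 l (n 56 l l l) l) (n 169 (n 224 (n 80 (n 154 l l l)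
      (n 239 l l l) l) l (n 76 l l l)) l l) (n 224 (n 138 l l (n 147 l (n 174 l l (n 68 l l l)) l))
      (n 69 (n 37 l (n 168 l l l) l) l l) (n 134 l l (n 11 l l (n 174 l (n 172 l l l) l))))) l (n
      226 (n 179 l l l) l l)) l (n 124 (n 224 (n 171 l (n 285 (n 77 l (n 1 l l l) l) l (n 174 l (n
      181 (n 147 l l l) l l) (n 134 l l (n 60 l l l)))) l) l l) l l)) (n 185 l (n 69 (n 179 (n 77 l
      (n 188 l (n 56 (n 115 l l l) l l) l) l) (n 116 l (n 56 (n 76 l l l) l l) l) l) l l) l)) (n 79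
      l (n 116 (n 124 (n 285 (n 188 l (n 5 l l l) l) l l) l l) (n 77 (n 124 (n 179 l (n 294 (n 1 l
      l l) l l) l) l l) (n 318 (n 132 l (n 233 (n 1 l l l) l l) l) (n 178 (n 327 (n 171 l (n 224 (n
      5 l l l) l l) l) l (n 87 (n 179 l l (n 134 l l l)) l l)) l l) (n 126 (n 226 (n 188 l l (n 138
      l l l)) l l) l l)) l) l) (n 218 l (n 124 (n 179 (n 132 l (n 188 l (n 1 l l l) l) l) (n 171 l
      (n 1 l l l) l) l) l l) l))) = true := by decide +kernel

theorem iZ_1881_0_1 : icheck 6 5 5 3441 236 236 [(6, 7), (11, 14)]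
    [(5, 6, 0), (5, 7, 0), (5, 11, 1), (5, 14, 1)]
    [134, 115, 1, 177, 26, 168, 117, 150, 32, 11, 68, 163, 4, 76, 56, 0]
    (n 179 l l l) = true := by decide +kernel

theorem iZ_1881_2_0 : icheck 6 5 5 3441 236 236 [(6, 9), (11, 12)]
    [(5, 6, 2), (5, 9, 2), (5, 11, 0), (5, 12, 0)]
    [11, 1, 56, 134, 163, 68, 150, 115, 76, 177, 32, 168, 117, 4, 0, 26]
    (n 72 l (n 100 (n 132 (n 181 l l l) l (n 43 l l l)) (n 88 (n 144 (n 154 (n 119 l (n 232 l l l)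
      l) l l) l l) l (n 87 l l l)) l) (n 144 (n 88 (n 188 (n 177 l l (n 32 l l (n 318 l l (n 154 l
      l l)))) (n 161 l l l) l) l (n 87 l l l)) (n 132 (n 100 (n 161 (n 150 l l (n 76 l l (n 345 l l
      (n 181 l l l)))) l l) l l) l (n 43 l l l)) l)) = true := by decide +kernel

theorem iZ_1881_2_1 : icheck 6 5 5 3441 236 236 [(6, 9), (11, 14)]
    [(5, 6, 2), (5, 9, 2), (5, 11, 1), (5, 14, 1)]
    [134, 177, 1, 117, 32, 163, 168, 150, 68, 11, 56, 115, 4, 26, 76, 0]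
    (n 231 l (n 69 (n 219 (n 144 l l (n 183 l l (n 302 (n 345 (n 150 l (n 284 l l l) (n 185 (n 88
      l l l) l l)) l l) l l))) l l) l (n 190 l l l)) l) = true := by decide +kernel

end

/-! ## Monochromatic triangles and clean vertices -/

/-- The standing hypotheses: `M` is the set of monochromatic triangles of `col`, and it has at most
four elements. -/
structure Hy (col : V → V → ℕ) (M : Finset (Finset V)) : Prop where
  sym : ∀ a b, col a b = col b a
  lt : ∀ a b, col a b < 3
  mem : ∀ T, T ∈ M ↔ T.card = 3 ∧ ∃ k, ∀ x ∈ T, ∀ y ∈ T, x ≠ y → col x y = k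
  card : M.card ≤ 4

/-- The neighbours of `u` in colour `c`. -/
def N (col : V → V → ℕ) (u : V) (c : ℕ) : Finset V := Finset.univ.filter fun v => v ≠ u ∧ col u v = c

theorem mem_N {col : V → V → ℕ} {u v : V} {c : ℕ} : v ∈ N col u c ↔ v ≠ u ∧ col u v = c := by
  simp [N]

/-- Vertices in no monochromatic triangle. -/
def Cl (M : Finset (Finset V)) (u : V) : Prop := ∀ T ∈ M, u ∉ T

/-- The number of monochromatic triangles inside `S`. -/
def tt (M : Finset (Finset V)) (S : Finset V) : ℕ := (M.filter (· ⊆ S)).card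

theorem mem3 {col : V → V → ℕ} {M : Finset (Finset V)} (H : Hy col M) {p q r : V} (hpq : p ≠ q)
    (hpr : p ≠ r) (hqr : q ≠ r) (h1 : col p q = col p r) (h2 : col p q = col q r) :
    ({p, q, r} : Finset V) ∈ M := by
  rw [H.mem]
  refine ⟨Finset.card_eq_three.2 ⟨p, q, r, hpq, hpr, hqr, rfl⟩, col p q, ?_⟩
  intro x hx y hy hxy
  simp only [Finset.mem_insert, Finset.mem_singleton] at hx hy
  have := H.sym
  rcases hx with rfl | rfl | rfl <;> rcases hy with rfl | rfl | rfl <;> grind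

theorem cl_col {col : V → V → ℕ} {M : Finset (Finset V)} (H : Hy col M) {u p q : V} {c : ℕ}
    (hu : Cl M u) (hp : p ∈ N col u c) (hq : q ∈ N col u c) (hpq : p ≠ q) : col p q ≠ c := by
  intro h
  rw [mem_N] at hp hq
  exact hu _ (mem3 H hp.1.symm hq.1.symm hpq (by rw [hp.2, hq.2]) (by rw [hp.2, h])) (by simp)

/-- A labelling of the set `S`. -/
def Lab (col : V → V → ℕ) (u : V) (c c0 c1 : ℕ) (S : Finset V) (k m : ℕ) (x : ℕ → V) : Prop :=
  Pt col u c c0 c1 k m x ∧ (∀ a < k, x a ∈ S) ∧ ∀ p ∈ S, ∃ a < k, p = x a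

theorem bits_exist (g : ℕ → Bool) (n : ℕ) : ∃ m < 2 ^ n, ∀ i < n, m.testBit i = g i := by
  refine ⟨Nat.ofBits (fun i : Fin n => g i), Nat.ofBits_lt_two_pow _, fun i hi => ?_⟩
  rw [Nat.testBit_ofBits_lt _ _ hi]

set_option synthInstance.maxSize 2000 in
set_option synthInstance.maxHeartbeats 400000 in
theorem idx_inj : ∀ b < 6, ∀ a < b, ∀ b' < 6, ∀ a' < b', b * (b - 1) / 2 + a = b' * (b' - 1) / 2 + a' →
    a = a' ∧ b = b' := by decide +kernel

theorem idx_lt : ∀ k < 7, ∀ b < k, ∀ a < b, b * (b - 1) / 2 + a < k * (k - 1) / 2 := by decide +kernel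

theorem bt_lt {m a b : ℕ} (h : a < b) : bt m a b = m.testBit (b * (b - 1) / 2 + a) := by
  simp [bt, Nat.ble_eq_true_of_le h.le]

/-- Labelling with a prescribed enumeration. -/
theorem pt_of {col : V → V → ℕ} (hs : ∀ a b, col a b = col b a) {u : V} {c c0 c1 k : ℕ}
    (hk : k < 7) {x : ℕ → V} (hu : ∀ a < k, col u (x a) = c)
    (hi : ∀ a < k, ∀ b < k, a ≠ b → x a ≠ x b)
    (hc : ∀ a < k, ∀ b < k, a ≠ b → col (x a) (x b) = c0 ∨ col (x a) (x b) = c1) :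
    ∃ m < 2 ^ (k * (k - 1) / 2), Pt col u c c0 c1 k m x := by
  obtain ⟨g, hg⟩ : ∃ g : ℕ → Bool, ∀ i, g i = true ↔ ∃ b < 6, ∃ a < b,
      b * (b - 1) / 2 + a = i ∧ col (x a) (x b) = c1 := by
    classical
    exact ⟨fun i => decide _, fun i => decide_eq_true_iff⟩
  obtain ⟨m, hm, hb⟩ := bits_exist g (k * (k - 1) / 2)
  refine ⟨m, hm, fun a ha => ⟨hu a ha, fun b hbk hab => ⟨hi a ha b hbk hab, ?_⟩⟩⟩
  have key : ∀ a b, a < b → b < k → col (x a) (x b) = bif bt m a b then c1 else c0 := by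
    intro a b hab hbk
    rw [bt_lt hab, hb _ (idx_lt k hk b hbk a hab)]
    by_cases h : col (x a) (x b) = c1
    · rw [(hg _).2 ⟨b, by omega, a, hab, rfl, h⟩, h]; rfl
    · have h0 : g (b * (b - 1) / 2 + a) = false := by
        rw [← Bool.not_eq_true, hg]
        rintro ⟨b', hb', a', hab', e, h'⟩
        obtain ⟨rfl, rfl⟩ := idx_inj b' hb' a' hab' b (by omega) a hab e
        exact h h'
      rw [h0, cond_false]
      exact (hc a (by omega) b hbk (by omega)).resolve_right h
  rcases lt_or_gt_of_ne hab with h | h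
  · exact key a b h hbk
  · rw [hs, bt_comm]; exact key b a h ha

theorem enum_exist (S : Finset V) (k : ℕ) (hk : S.card = k) : ∃ x : ℕ → V,
    (∀ a < k, x a ∈ S) ∧ (∀ p ∈ S, ∃ a < k, p = x a) ∧ ∀ a < k, ∀ b < k, a ≠ b → x a ≠ x b := by
  have e := S.equivFinOfCardEq hk
  refine ⟨fun a => if h : a < k then e.symm ⟨a, h⟩ else 0, ?_, ?_, ?_⟩
  · intro a ha; simp [ha]
  · intro p hp
    refine ⟨e ⟨p, hp⟩, (e ⟨p, hp⟩).2, by simp⟩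
  · intro a ha b hb hab h
    simp only [ha, hb, dif_pos] at h
    have := e.symm.injective (Subtype.ext h)
    exact hab (by simpa using this)

theorem two_cols {col : V → V → ℕ} {M : Finset (Finset V)} (H : Hy col M) {u : V}
    {c c0 c1 : ℕ} (hu : Cl M u) (h3 : ∀ t < 3, t = c ∨ t = c0 ∨ t = c1) {p q : V}
    (hp : p ∈ N col u c) (hq : q ∈ N col u c) (hpq : p ≠ q) : col p q = c0 ∨ col p q = c1 := by
  rcases h3 _ (H.lt p q) with h | h
  · exact absurd h (cl_col H hu hp hq hpq)
  · exact h

theorem lab_exist {col : V → V → ℕ} {M : Finset (Finset V)} (H : Hy col M) {u : V}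
    {c c0 c1 k : ℕ} (hu : Cl M u) (h3 : ∀ t < 3, t = c ∨ t = c0 ∨ t = c1) (hk : k < 7)
    {S : Finset V} (hS : S ⊆ N col u c) (hc : S.card = k) :
    ∃ m < 2 ^ (k * (k - 1) / 2), ∃ x, Lab col u c c0 c1 S k m x := by
  obtain ⟨x, h1, h2, hi⟩ := enum_exist S k hc
  obtain ⟨m, hm, hp⟩ := pt_of (c := c) (c0 := c0) (c1 := c1) (u := u) H.sym hk
    (fun a ha => (mem_N.1 (hS (h1 a ha))).2) hi
    (fun a ha b hb hab => two_cols H hu h3 (hS (h1 a ha)) (hS (h1 b hb)) (hi a ha b hb hab))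
  exact ⟨m, hm, x, hp, h1, h2⟩

/-- The triples `a < b < c < k`. -/
def trips (k : ℕ) : List (ℕ × ℕ × ℕ) :=
  (List.range k).flatMap fun c => (List.range c).flatMap fun b => (List.range b).map fun a => (a, b, c)

/-- Monochromatic triples of a mask. -/
def mono3 (m : ℕ) (t : ℕ × ℕ × ℕ) : Bool :=
  (bt m t.1 t.2.1 == bt m t.1 t.2.2) && (bt m t.1 t.2.1 == bt m t.2.1 t.2.2)

/-- The number of monochromatic triples of a mask. -/
def tc (k m : ℕ) : ℕ := (trips k).countP (mono3 m)

theorem mem_trips {k a b c : ℕ} : (a, b, c) ∈ trips k ↔ a < b ∧ b < c ∧ c < k := by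
  simp only [trips, List.mem_flatMap, List.mem_range, List.mem_map, Prod.mk.injEq]
  constructor
  · rintro ⟨c', hc, b', hb, a', ha, rfl, rfl, rfl⟩; exact ⟨ha, hb, hc⟩
  · rintro ⟨h1, h2, h3⟩; exact ⟨c, h3, b, h2, a, h1, rfl, rfl, rfl⟩

theorem trips_nodup : ∀ k < 7, (trips k).Nodup := by decide +kernel

theorem three_sorted {T : Finset V} {x : ℕ → V} {k : ℕ} (hT : T.card = 3)
    (hx : ∀ p ∈ T, ∃ a < k, p = x a) : ∃ a b c, a < b ∧ b < c ∧ c < k ∧ T = {x a, x b, x c} := by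
  obtain ⟨p, q, r, hpq, hpr, hqr, rfl⟩ := Finset.card_eq_three.1 hT
  obtain ⟨a, ha, rfl⟩ := hx p (by simp)
  obtain ⟨b, hb, rfl⟩ := hx q (by simp)
  obtain ⟨c, hc, rfl⟩ := hx r (by simp)
  have h1 : a ≠ b := fun h => hpq (by rw [h])
  have h2 : a ≠ c := fun h => hpr (by rw [h])
  have h3 : b ≠ c := fun h => hqr (by rw [h])
  rcases lt_or_gt_of_ne h1 with g1 | g1 <;> rcases lt_or_gt_of_ne h2 with g2 | g2 <;>
    rcases lt_or_gt_of_ne h3 with g3 | g3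
  · exact ⟨a, b, c, g1, g3, hc, rfl⟩
  · exact ⟨a, c, b, g2, g3, hb, by ext; simp; tauto⟩
  · omega
  · exact ⟨c, a, b, g2, g1, hb, by ext; simp; tauto⟩
  · exact ⟨b, a, c, g1, g2, hc, by ext; simp; tauto⟩
  · omega
  · exact ⟨b, c, a, g3, g2, ha, by ext; simp; tauto⟩
  · exact ⟨c, b, a, g3, g1, ha, by ext; simp; tauto⟩

theorem bif_inj {c0 c1 : ℕ} (h : c0 ≠ c1) {b b' : Bool}
    (e : (bif b then c1 else c0) = bif b' then c1 else c0) : b = b' := by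
  cases b <;> cases b' <;> simp_all

theorem lab_tt {col : V → V → ℕ} {M : Finset (Finset V)} (H : Hy col M) {u : V}
    {c c0 c1 k m : ℕ} (h01 : c0 ≠ c1) (hk : k < 7) {S : Finset V} {x : ℕ → V}
    (L : Lab col u c c0 c1 S k m x) : tt M S = tc k m := by
  obtain ⟨hP, hm, ho⟩ := L
  have hcard : tc k m = ((trips k).toFinset.filter fun t => mono3 m t = true).card := by
    rw [tc, List.countP_eq_length_filter, ← List.toFinset_filter, List.toFinset_card_of_nodup]
    exact (trips_nodup k hk).filter _
  rw [hcard, tt]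
  symm
  have hxi : ∀ a < k, ∀ b < k, x a = x b → a = b := by
    intro a ha b hb h
    by_contra hc
    exact ((hP a ha).2 b hb hc).1 h
  apply Finset.card_bij (fun t _ => ({x t.1, x t.2.1, x t.2.2} : Finset V))
  · rintro ⟨a, b, d⟩ ht
    rw [Finset.mem_filter, List.mem_toFinset, mem_trips] at ht
    obtain ⟨⟨hab, hbd, hdk⟩, hmo⟩ := ht
    simp only [mono3, Bool.and_eq_true, beq_iff_eq] at hmo
    have e1 := (hP a (by omega)).2 b (by omega) (by omega)
    have e2 := (hP a (by omega)).2 d (by omega) (by omega)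
    have e3 := (hP b (by omega)).2 d (by omega) (by omega)
    rw [Finset.mem_filter]
    constructor
    · refine mem3 H e1.1 e2.1 e3.1 ?_ ?_
      · rw [e1.2, e2.2, hmo.1]
      · rw [e1.2, e3.2, hmo.2]
    · intro p hp
      simp only [Finset.mem_insert, Finset.mem_singleton] at hp
      rcases hp with rfl | rfl | rfl <;> apply hm <;> omega
  · rintro ⟨a, b, d⟩ ht ⟨a', b', d'⟩ ht' e
    rw [Finset.mem_filter, List.mem_toFinset, mem_trips] at ht ht'
    obtain ⟨⟨hab, hbd, hdk⟩, -⟩ := ht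
    obtain ⟨⟨hab', hbd', hdk'⟩, -⟩ := ht'
    simp only at e
    have f : ∀ i ∈ ({a, b, d} : Finset ℕ), i = a' ∨ i = b' ∨ i = d' := by
      intro i hi
      have hik : i < k := by simp at hi; omega
      have : x i ∈ ({x a, x b, x d} : Finset V) := by
        simp at hi ⊢; rcases hi with rfl | rfl | rfl <;> simp
      rw [e] at this
      simp only [Finset.mem_insert, Finset.mem_singleton] at this
      rcases this with h | h | h
      · exact Or.inl (hxi _ hik _ (by omega) h)
      · exact Or.inr (Or.inl (hxi _ hik _ (by omega) h))
      · exact Or.inr (Or.inr (hxi _ hik _ (by omega) h))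
    have f1 := f a (by simp)
    have f2 := f b (by simp)
    have f3 := f d (by simp)
    simp only [Prod.mk.injEq]
    omega
  · intro T hT
    rw [Finset.mem_filter, H.mem] at hT
    obtain ⟨⟨hc3, col', hmono⟩, hTS⟩ := hT
    obtain ⟨a, b, d, hab, hbd, hdk, rfl⟩ := three_sorted hc3 (fun p hp => ho p (hTS hp))
    refine ⟨(a, b, d), ?_, rfl⟩
    rw [Finset.mem_filter, List.mem_toFinset, mem_trips]
    refine ⟨⟨hab, hbd, hdk⟩, ?_⟩
    have e1 := (hP a (by omega)).2 b (by omega) (by omega)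
    have e2 := (hP a (by omega)).2 d (by omega) (by omega)
    have e3 := (hP b (by omega)).2 d (by omega) (by omega)
    have g1 := hmono (x a) (by simp) (x b) (by simp) e1.1
    have g2 := hmono (x a) (by simp) (x d) (by simp) e2.1
    have g3 := hmono (x b) (by simp) (x d) (by simp) e3.1
    simp only [mono3, Bool.and_eq_true, beq_iff_eq]
    exact ⟨bif_inj h01 (by rw [← e1.2, ← e2.2, g1, g2]), bif_inj h01 (by rw [← e1.2, ← e3.2, g1, g3])⟩

/-! ### Embedding of patterns -/

/-- Function update. -/
def upd (f : ℕ → ℕ) (i v j : ℕ) : ℕ := bif Nat.beq j i then v else f j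

/-- Search for an embedding of the mask `m'` in the mask `m` on `k` points (complemented if `fl`),
placing the points `i, i+1, …, i+r-1`. -/
def emb (k m m' : ℕ) (fl : Bool) (ok : ℕ → ℕ → Bool) : ℕ → ℕ → (ℕ → ℕ) → Bool
  | 0, _, _ => true
  | r + 1, i, f => (List.range k).any fun v => ok i v &&
      (((List.range i).all fun a => !Nat.beq (f a) v && (bt m (f a) v == xor fl (bt m' a i))) &&
        emb k m m' fl ok r (i + 1) (upd f i v))

/-- Search for an embedding of `m'` on `k'` points. -/
def embB (k m k' m' : ℕ) (fl : Bool) (ok : ℕ → ℕ → Bool) : Bool := emb k m m' fl ok k' 0 (fun _ => 0)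

/-- The specification of an embedding of the first `n` points. -/
def embP (k m m' : ℕ) (fl : Bool) (ok : ℕ → ℕ → Bool) (n : ℕ) (g : ℕ → ℕ) : Prop :=
  ∀ a < n, g a < k ∧ ok a (g a) = true ∧ ∀ b < a, g b ≠ g a ∧ bt m (g b) (g a) = xor fl (bt m' b a)

theorem upd_ne {f : ℕ → ℕ} {i v j : ℕ} (h : j ≠ i) : upd f i v j = f j := by
  have : Nat.beq j i = false := by rw [← Bool.not_eq_true, beq_iff]; exact h
  simp [upd, this]
theorem upd_eq {f : ℕ → ℕ} {i v : ℕ} : upd f i v i = v := by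
  simp [upd]

theorem emb_spec {k m m' : ℕ} {fl : Bool} {ok : ℕ → ℕ → Bool} (r : ℕ) : ∀ (i : ℕ) (f : ℕ → ℕ),
    emb k m m' fl ok r i f = true → embP k m m' fl ok i f → ∃ g, embP k m m' fl ok (i + r) g := by
  induction r with
  | zero => intro i f _ h; exact ⟨f, h⟩
  | succ r ih =>
    intro i f h hf
    simp only [emb, List.any_eq_true, List.mem_range, Bool.and_eq_true, List.all_eq_true,
      Bool.not_eq_true', beq_iff_eq] at h
    obtain ⟨v, hv, hok, hall, hrec⟩ := h
    obtain ⟨g, hg⟩ := ih (i + 1) _ hrec (by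
      intro a ha
      rcases Nat.lt_succ_iff_lt_or_eq.1 ha with h | rfl
      · obtain ⟨h1, h2, h3⟩ := hf a h
        rw [upd_ne (by omega)]
        refine ⟨h1, h2, fun b hb => ?_⟩
        rw [upd_ne (by omega)]
        exact h3 b hb
      · rw [upd_eq]
        refine ⟨hv, hok, fun b hb => ?_⟩
        rw [upd_ne (by omega)]
        obtain ⟨e1, e2⟩ := hall b hb
        refine ⟨fun e => ?_, e2⟩
        rw [← Bool.not_eq_true, beq_iff] at e1
        exact e1 e)
    exact ⟨g, by rwa [show i + (r + 1) = i + 1 + r by omega]⟩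

theorem embB_spec {k m k' m' : ℕ} {fl : Bool} {ok : ℕ → ℕ → Bool}
    (h : embB k m k' m' fl ok = true) : ∃ g, embP k m m' fl ok k' g := by
  obtain ⟨g, hg⟩ := emb_spec k' 0 _ h (fun a ha => by omega)
  exact ⟨g, by simpa using hg⟩

/-- Transfer of a pattern along an embedding. -/
theorem emb_pt {col : V → V → ℕ} (hs : ∀ a b, col a b = col b a) {u : V} {c c0 c1 k m k' m' : ℕ}
    {fl : Bool} {ok : ℕ → ℕ → Bool} {x : ℕ → V} (hx : Pt col u c c0 c1 k m x)
    (h : embB k m k' m' fl ok = true) : ∃ g : ℕ → ℕ, (∀ a < k', g a < k ∧ ok a (g a) = true) ∧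
      Pt col u c (bif fl then c1 else c0) (bif fl then c0 else c1) k' m' (fun a => x (g a)) := by
  obtain ⟨g, hg⟩ := embB_spec h
  refine ⟨g, fun a ha => ⟨(hg a ha).1, (hg a ha).2.1⟩, ?_⟩
  have key : ∀ a < k', ∀ b < a, g b ≠ g a ∧ col (x (g b)) (x (g a)) =
      bif bt m' b a then (bif fl then c0 else c1) else (bif fl then c1 else c0) := by
    intro a ha b hb
    obtain ⟨h1, _, h2⟩ := hg a ha
    obtain ⟨h3, h4⟩ := h2 b hb
    refine ⟨h3, ?_⟩
    rw [((hx (g b) (hg b (by omega)).1).2 (g a) h1 h3).2, h4]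
    cases fl <;> cases bt m' b a <;> rfl
  intro a ha
  refine ⟨(hx (g a) (hg a ha).1).1, fun b hb hab => ?_⟩
  rcases lt_or_gt_of_ne hab with h | h
  · obtain ⟨e1, e2⟩ := key b hb a h
    exact ⟨((hx (g a) (hg a ha).1).2 (g b) (hg b hb).1 e1).1, e2⟩
  · obtain ⟨e1, e2⟩ := key a ha b h
    refine ⟨((hx (g a) (hg a ha).1).2 (g b) (hg b hb).1 e1.symm).1, ?_⟩
    simp only
    rw [hs, e2, bt_comm]

/-- The neighbours of `u` in colour `c` outside `W` contain the pattern `m`. -/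
def Has (col : V → V → ℕ) (u : V) (c c0 c1 k m : ℕ) (W : Finset V) : Prop :=
  ∃ x, Pt col u c c0 c1 k m x ∧ ∀ a < k, x a ∉ W

theorem has_emb {col : V → V → ℕ} (hs : ∀ a b, col a b = col b a) {u : V} {c c0 c1 k m k' m' : ℕ}
    (fl : Bool) {ok : ℕ → Bool} {x : ℕ → V} (hx : Pt col u c c0 c1 k m x)
    (h : embB k m k' m' fl (fun _ => ok) = true) {W : Finset V}
    (hW : ∀ a < k, ok a = true → x a ∉ W) :
    Has col u c (bif fl then c1 else c0) (bif fl then c0 else c1) k' m' W := by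
  obtain ⟨g, hg, hp⟩ := emb_pt hs hx h
  exact ⟨_, hp, fun a ha => hW _ (hg a ha).1 (hg a ha).2⟩

theorem lab_of_pt {col : V → V → ℕ} {u : V} {c c0 c1 k m : ℕ} {x : ℕ → V} {S : Finset V}
    (hx : Pt col u c c0 c1 k m x) (hS : ∀ a < k, x a ∈ S) (hc : S.card = k) :
    Lab col u c c0 c1 S k m x := by
  refine ⟨hx, hS, ?_⟩
  have hi : Set.InjOn x (Finset.range k : Set ℕ) := by
    intro a ha b hb h
    by_contra hab
    simp only [Finset.coe_range, Set.mem_Iio] at ha hb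
    exact ((hx a ha).2 b hb hab).1 h
  have : (Finset.range k).image x = S := by
    apply Finset.eq_of_subset_of_card_le
    · intro p hp
      rw [Finset.mem_image] at hp
      obtain ⟨a, ha, rfl⟩ := hp
      exact hS a (Finset.mem_range.1 ha)
    · rw [Finset.card_image_of_injOn hi, hc, Finset.card_range]
  intro p hp
  rw [← this, Finset.mem_image] at hp
  obtain ⟨a, ha, rfl⟩ := hp
  exact ⟨a, Finset.mem_range.1 ha, rfl⟩

/-! ### Triangles and cross triangles -/

/-- `T` is not contained in one colour neighbourhood of `u`. -/
def Cross (col : V → V → ℕ) (u : V) (T : Finset V) : Prop := ∃ p ∈ T, ∃ q ∈ T, col u p ≠ col u q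

theorem noX_of {col : V → V → ℕ} {M : Finset (Finset V)} (H : Hy col M) {u : V} {P : V → Prop}
    {Om : V → V → Prop} (h : ∀ T ∈ M, Cross col u T → (∃ p ∈ T, ¬ P p) ∨
      ∃ p ∈ T, ∃ q ∈ T, p ≠ q ∧ Om p q ∧ Om q p) : NoX col u P Om := by
  intro p q r hp hq hr hpq hpr hqr o1 o2 o3 e1 e2
  have hpq' : p ≠ q := fun h => hpq (by rw [h])
  have hpr' : p ≠ r := fun h => hpr (by rw [h])
  rcases h _ (mem3 H hpq' hpr' hqr e1 e2) ⟨p, by simp, q, by simp, hpq⟩ with h | h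
  · obtain ⟨s, hs, hP⟩ := h
    simp only [Finset.mem_insert, Finset.mem_singleton] at hs
    rcases hs with rfl | rfl | rfl <;> exact hP (by assumption)
  · obtain ⟨s, hs, t, ht, hst, ho, ho'⟩ := h
    simp only [Finset.mem_insert, Finset.mem_singleton] at hs ht
    rcases hs with rfl | rfl | rfl <;> rcases ht with rfl | rfl | rfl <;> first
      | exact hst rfl
      | exact o1 (by assumption)
      | exact o2 (by assumption)
      | exact o3 (by assumption)

theorem tt_mono {M : Finset (Finset V)} {S S' : Finset V} (h : S ⊆ S') : tt M S ≤ tt M S' := by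
  apply Finset.card_le_card
  intro T hT
  rw [Finset.mem_filter] at hT ⊢
  exact ⟨hT.1, hT.2.trans h⟩

theorem tt_sum {col : V → V → ℕ} {M : Finset (Finset V)} (H : Hy col M) (S : Finset V) :
    ∑ v ∈ S, tt M (S.erase v) = (S.card - 3) * tt M S := by
  have e : ∀ v ∈ S, tt M (S.erase v) = ∑ T ∈ M.filter (· ⊆ S), if v ∉ T then 1 else 0 := by
    intro v hv
    rw [← Finset.card_filter, Finset.filter_filter, tt]
    congr 1
    ext T
    simp only [Finset.mem_filter, Finset.subset_erase]
  rw [Finset.sum_congr rfl e, Finset.sum_comm]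
  have e2 : ∀ T ∈ M.filter (· ⊆ S), (∑ v ∈ S, if v ∉ T then 1 else 0) = S.card - 3 := by
    intro T hT
    rw [Finset.mem_filter] at hT
    rw [← Finset.card_filter, ← ((H.mem T).1 hT.1).1, ← Finset.card_sdiff_of_subset hT.2]
    congr 1
    ext v; simp
  rw [Finset.sum_congr rfl e2, Finset.sum_const, smul_eq_mul, mul_comm, tt]

/-! ### Classification of the parts -/

/-- Representatives of the masks on five points with one monochromatic triple. -/
def B1 : List ℕ := [86, 94, 222, 116, 117, 237]

/-- Representatives of the masks on six points with two monochromatic triples. -/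
def T2 : List ℕ := [3440, 3448, 3576, 7672, 3873, 3875, 3885, 7916, 3308, 3441, 3452, 3948]

theorem pent_tab : ∀ m < 1024, tc 5 m = 0 → embB 5 m 5 236 false (fun _ _ => true) = true := by
  decide +kernel

theorem five_tab : ∀ m < 1024, tc 5 m = 1 → ∃ b ∈ B1, embB 5 m 5 b false (fun _ _ => true) = true := by
  decide +kernel

theorem three_tab : ∀ m < 8, tc 3 m = 0 → ∃ b ∈ [1, 3], embB 3 m 3 b false (fun _ _ => true) = true := by
  decide +kernel

theorem six_bits : ∀ b ∈ 236 :: B1, ∀ r < 32, ∀ i < 5, bt (b + 1024 * r) i 5 = r.testBit i ∧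
    ∀ j < 5, i ≠ j → bt (b + 1024 * r) i j = bt b i j := by
  decide +kernel

theorem six_tab : ∀ b ∈ 236 :: B1, ∀ r < 32, 2 ≤ tc 6 (b + 1024 * r) ∧ (tc 6 (b + 1024 * r) = 2 →
    ∃ t ∈ T2, embB 6 (b + 1024 * r) 6 t false (fun _ _ => true) = true) := by
  decide +kernel

/-- The masks on five points used in the instances `K1`. -/
def K1l : List ℕ := [86, 94, 222, 116, 117, 77, 87]
/-- The pairs of masks used in the instances `K4`. -/
def K4l : List (ℕ × ℕ) := [(86, 86), (222, 222), (116, 222), (116, 116)]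

theorem L2_all : ∀ m ∈ T2, ∀ m2 ∈ [1, 3], ∃ v FL ts, rcheck 6 3 m m2 v R1 FL ts = true := by
  intro m hm m2 hm2
  simp only [T2, List.mem_cons, List.not_mem_nil, or_false] at hm hm2
  rcases hm with rfl | rfl | rfl | rfl | rfl | rfl | rfl | rfl | rfl | rfl | rfl | rfl <;>
    rcases hm2 with rfl | rfl
  exacts [⟨_, _, _, iL2_1880_1⟩, ⟨_, _, _, iL2_1880_3⟩,
    ⟨_, _, _, iL2_1884_1⟩, ⟨_, _, _, iL2_1884_3⟩,
    ⟨_, _, _, iL2_2012_1⟩, ⟨_, _, _, iL2_2012_3⟩,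
    ⟨_, _, _, iL2_4060_1⟩, ⟨_, _, _, iL2_4060_3⟩,
    ⟨_, _, _, iL2_5905_1⟩, ⟨_, _, _, iL2_5905_3⟩,
    ⟨_, _, _, iL2_5907_1⟩, ⟨_, _, _, iL2_5907_3⟩,
    ⟨_, _, _, iL2_5941_1⟩, ⟨_, _, _, iL2_5941_3⟩,
    ⟨_, _, _, iL2_7100_1⟩, ⟨_, _, _, iL2_7100_3⟩,
    ⟨_, _, _, iL2_956_1⟩, ⟨_, _, _, iL2_956_3⟩,
    ⟨_, _, _, iL2_1881_1⟩, ⟨_, _, _, iL2_1881_3⟩,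
    ⟨_, _, _, iL2_1916_1⟩, ⟨_, _, _, iL2_1916_3⟩,
    ⟨_, _, _, iL2_5948_1⟩, ⟨_, _, _, iL2_5948_3⟩]

theorem K1_all : ∀ m ∈ K1l, ∃ v FL ts, rcheck 5 4 m 13 v R1 FL ts = true := by
  intro m hm
  simp only [K1l, List.mem_cons, List.not_mem_nil, or_false] at hm
  rcases hm with rfl | rfl | rfl | rfl | rfl | rfl | rfl
  exacts [⟨_, _, _, iK1_58⟩,
    ⟨_, _, _, iK1_62⟩,
    ⟨_, _, _, iK1_126⟩,
    ⟨_, _, _, iK1_184⟩,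
    ⟨_, _, _, iK1_185⟩,
    ⟨_, _, _, iK1_29⟩,
    ⟨_, _, _, iK1_59⟩]

/-! ### Configurations -/

/-- A clean vertex `u` and an ordering of the colours. -/
structure Cfg (col : V → V → ℕ) (M : Finset (Finset V)) (u : V) (c0 c1 c2 : ℕ) : Prop where
  H : Hy col M
  hu : Cl M u
  C : Ctx col c0 c1 c2

section
variable {col : V → V → ℕ} {M : Finset (Finset V)} {u : V} {c0 c1 c2 : ℕ}

theorem Cfg.s12 (K : Cfg col M u c0 c1 c2) : Cfg col M u c0 c2 c1 :=
  ⟨K.H, K.hu, K.C.sym, K.C.lt, K.C.h0, K.C.h2, K.C.h1, K.C.h02, K.C.h01, K.C.h12.symm⟩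

theorem Cfg.s01 (K : Cfg col M u c0 c1 c2) : Cfg col M u c1 c0 c2 :=
  ⟨K.H, K.hu, K.C.sym, K.C.lt, K.C.h1, K.C.h0, K.C.h2, K.C.h01.symm, K.C.h12, K.C.h02⟩

theorem Cfg.s02 (K : Cfg col M u c0 c1 c2) : Cfg col M u c2 c1 c0 := K.s01.s12.s01

theorem Cfg.h3 (K : Cfg col M u c0 c1 c2) : ∀ t < 3, t = c0 ∨ t = c1 ∨ t = c2 := by
  obtain ⟨_, _, h0, h1, h2, h01, h02, h12⟩ := K.C
  intro t ht
  omega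

theorem Cfg.five (K : Cfg col M u c0 c1 c2) {S : Finset V} (hS : S ⊆ N col u c0) (hc : S.card = 5)
    (ht : tt M S ≤ 1) : ∃ b ∈ 236 :: B1, tt M S = tc 5 b ∧ ∃ x, Lab col u c0 c1 c2 S 5 b x := by
  obtain ⟨m, hm, x, L⟩ := lab_exist K.H K.hu K.h3 (by norm_num) hS hc
  have e := lab_tt K.H K.C.h12 (by norm_num) L
  have key : ∃ b ∈ 236 :: B1, embB 5 m 5 b false (fun _ _ => true) = true := by
    rcases Nat.le_one_iff_eq_zero_or_eq_one.1 ht with h | h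
    · exact ⟨236, by simp, pent_tab m hm (by rw [← e, h])⟩
    · obtain ⟨b, hb, h'⟩ := five_tab m hm (by rw [← e, h])
      exact ⟨b, List.mem_cons_of_mem _ hb, h'⟩
  obtain ⟨b, hb, h⟩ := key
  obtain ⟨g, hg, hp⟩ := emb_pt K.H.sym L.1 h
  have L' := lab_of_pt hp (fun a ha => L.2.1 _ (hg a ha).1) hc
  exact ⟨b, hb, lab_tt K.H K.C.h12 (by norm_num) L', _, L'⟩

theorem tc_five : tc 5 236 = 0 ∧ ∀ b ∈ B1, tc 5 b = 1 := by decide +kernel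

theorem Cfg.pent_lab (K : Cfg col M u c0 c1 c2) {S : Finset V} (hS : S ⊆ N col u c0)
    (hc : S.card = 5) (ht : tt M S = 0) : ∃ x, Lab col u c0 c1 c2 S 5 236 x := by
  obtain ⟨b, hb, e, x, L⟩ := K.five hS hc (by omega)
  rcases List.mem_cons.1 hb with rfl | hb
  · exact ⟨x, L⟩
  · have := tc_five.2 b hb
    omega

theorem Cfg.one_lab (K : Cfg col M u c0 c1 c2) {S : Finset V} (hS : S ⊆ N col u c0)
    (hc : S.card = 5) (ht : tt M S = 1) : ∃ b ∈ B1, ∃ x, Lab col u c0 c1 c2 S 5 b x := by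
  obtain ⟨b, hb, e, x, L⟩ := K.five hS hc (by omega)
  rcases List.mem_cons.1 hb with rfl | hb
  · have := tc_five.1
    omega
  · exact ⟨b, hb, x, L⟩

theorem Cfg.pent (K : Cfg col M u c0 c1 c2) {S W : Finset V} (hS : S ⊆ N col u c0)
    (hc : S.card = 5) (ht : tt M S = 0) (hW : ∀ p ∈ S, p ∉ W) : Has col u c0 c1 c2 5 236 W := by
  obtain ⟨x, L⟩ := K.pent_lab hS hc ht
  exact ⟨x, L.1, fun a ha => hW _ (L.2.1 a ha)⟩

theorem path_tab : ∀ i < 5, embB 5 236 4 13 false (fun _ v => !Nat.beq v i) = true := by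
  decide +kernel

/-- A path on four points in a pentagon, avoiding one point. -/
theorem Cfg.path (K : Cfg col M u c0 c1 c2) {S W : Finset V} (hS : S ⊆ N col u c0)
    (hc : S.card = 5) (ht : tt M S = 0) {q : V} (hq : q ∈ S) (hW : ∀ p ∈ S, p ≠ q → p ∉ W) :
    Has col u c0 c1 c2 4 13 W := by
  obtain ⟨x, L⟩ := K.pent_lab hS hc ht
  obtain ⟨i, hi, rfl⟩ := L.2.2 q hq
  refine has_emb K.H.sym false L.1 (path_tab i hi) fun a ha h => hW _ (L.2.1 a ha) ?_
  refine ((L.1 a ha).2 i hi ?_).1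
  rintro rfl
  have : Nat.beq a a = true := (beq_iff a a).2 rfl
  rw [this] at h
  exact absurd h (by decide)

theorem Cfg.three (K : Cfg col M u c0 c1 c2) {S W : Finset V} (hS : S ⊆ N col u c0)
    (ht : tt M S < S.card.choose 3) (hW : ∀ p ∈ S, p ∉ W) :
    ∃ b ∈ [1, 3], Has col u c0 c1 c2 3 b W := by
  rw [← Finset.card_powersetCard] at ht
  obtain ⟨T, hT, hn⟩ := Finset.exists_mem_notMem_of_card_lt_card ht
  rw [Finset.mem_powersetCard] at hT
  obtain ⟨m, hm, x, L⟩ := lab_exist K.H K.hu K.h3 (by norm_num) (hT.1.trans hS) hT.2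
  have e := lab_tt K.H K.C.h12 (by norm_num) L
  have e0 : tt M T = 0 := by
    rw [tt, Finset.card_eq_zero, Finset.filter_eq_empty_iff]
    intro T' hT' hs
    have : T' = T := Finset.eq_of_subset_of_card_le hs (by rw [((K.H.mem T').1 hT').1, hT.2])
    subst this
    exact hn (Finset.mem_filter.2 ⟨hT', hT.1⟩)
  obtain ⟨b, hb, h⟩ := three_tab m hm (by rw [← e, e0])
  exact ⟨b, hb, has_emb K.H.sym false (ok := fun _ => true) L.1 h
    fun a ha _ => hW _ (hT.1 (L.2.1 a ha))⟩

theorem Cfg.six (K : Cfg col M u c0 c1 c2) {S : Finset V} (hS : S ⊆ N col u c0) (hc : S.card = 6)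
    (ht : tt M S ≤ 3) : ∃ b ∈ 236 :: B1, ∃ r < 32, ∃ x, Lab col u c0 c1 c2 S 6 (b + 1024 * r) x := by
  obtain ⟨v, hv, h1⟩ : ∃ v ∈ S, tt M (S.erase v) ≤ 1 := by
    by_contra! hcon
    have := Finset.card_nsmul_le_sum S (fun v => tt M (S.erase v)) 2 (fun v hv => hcon v hv)
    rw [tt_sum K.H, hc, smul_eq_mul] at this
    omega
  obtain ⟨b, hb, -, x, L⟩ := K.five (S := S.erase v) ((Finset.erase_subset _ _).trans hS)
    (by rw [Finset.card_erase_of_mem hv, hc]) h1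
  obtain ⟨g, hg⟩ : ∃ g : ℕ → Bool, ∀ i, g i = true ↔ col (x i) v = c2 := by
    classical
    exact ⟨fun i => decide _, fun i => decide_eq_true_iff⟩
  obtain ⟨r, hr, hb'⟩ := bits_exist g 5
  refine ⟨b, hb, r, hr, fun i => if i = 5 then v else x i, ?_⟩
  have hxv : ∀ a < 5, x a ≠ v ∧ col (x a) v = bif r.testBit a then c2 else c1 := by
    intro a ha
    have hm := L.2.1 a ha
    rw [Finset.mem_erase] at hm
    refine ⟨hm.1, ?_⟩
    rw [hb' a ha]
    rcases two_cols K.H K.hu K.h3 (hS hm.2) (hS hv) hm.1 with h | h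
    · have : g a = false := by
        rw [← Bool.not_eq_true, hg, h]; exact K.C.h12
      rw [this, h]; rfl
    · rw [(hg a).2 h, h]; rfl
  apply lab_of_pt _ _ hc
  · intro a ha
    by_cases ha5 : a = 5
    · subst ha5
      refine ⟨by simpa using (mem_N.1 (hS hv)).2, fun c hcb hne => ?_⟩
      have hc5 : c < 5 := by omega
      simp only [if_true, if_neg hne.symm]
      rw [bt_comm, (six_bits b hb r hr c hc5).1, K.H.sym]
      exact ⟨(hxv c hc5).1.symm, (hxv c hc5).2⟩
    · have ha' : a < 5 := by omega
      simp only [if_neg ha5]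
      refine ⟨(L.1 a ha').1, fun c hcb hne => ?_⟩
      by_cases hc5 : c = 5
      · subst hc5
        simp only [if_true]
        rw [(six_bits b hb r hr a ha').1]
        exact hxv a ha'
      · have hc' : c < 5 := by omega
        simp only [if_neg hc5]
        rw [(six_bits b hb r hr a ha').2 c hc' hne]
        exact (L.1 a ha').2 c hc' hne
  · intro a ha
    by_cases ha5 : a = 5
    · simpa [ha5] using hv
    · simp only [if_neg ha5]
      exact (Finset.mem_erase.1 (L.2.1 a (by omega))).2

theorem Cfg.six_ge (K : Cfg col M u c0 c1 c2) {S : Finset V} (hS : S ⊆ N col u c0)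
    (hc : S.card = 6) : 2 ≤ tt M S := by
  by_contra h
  obtain ⟨b, hb, r, hr, x, L⟩ := K.six hS hc (by omega)
  have := lab_tt K.H K.C.h12 (by norm_num) L
  have := (six_tab b hb r hr).1
  omega

theorem Cfg.six_two (K : Cfg col M u c0 c1 c2) {S : Finset V} (hS : S ⊆ N col u c0)
    (hc : S.card = 6) (ht : tt M S = 2) : ∃ t ∈ T2, ∃ x, Lab col u c0 c1 c2 S 6 t x := by
  obtain ⟨b, hb, r, hr, x, L⟩ := K.six hS hc (by omega)
  have e := lab_tt K.H K.C.h12 (by norm_num) L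
  obtain ⟨t, ht, h⟩ := (six_tab b hb r hr).2 (by omega)
  obtain ⟨g, hg, hp⟩ := emb_pt K.H.sym L.1 h
  exact ⟨t, ht, _, lab_of_pt hp (fun a ha => L.2.1 _ (hg a ha).1) hc⟩

theorem Cfg.seven (K : Cfg col M u c0 c1 c2) {S : Finset V} (hS : S ⊆ N col u c0)
    (hc : S.card = 7) : 4 ≤ tt M S := by
  have := Finset.card_nsmul_le_sum S (fun v => tt M (S.erase v)) 2 (fun v hv =>
    K.six_ge ((Finset.erase_subset _ _).trans hS) (by rw [Finset.card_erase_of_mem hv, hc]))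
  rw [tt_sum K.H, hc, smul_eq_mul] at this
  omega

theorem Cfg.le_seven (K : Cfg col M u c0 c1 c2) : (N col u c0).card ≤ 7 := by
  by_contra h
  obtain ⟨S, hS, hc⟩ := Finset.exists_subset_card_eq (show 8 ≤ (N col u c0).card by omega)
  have := Finset.card_nsmul_le_sum S (fun v => tt M (S.erase v)) 4 (fun v hv =>
    K.seven ((Finset.erase_subset _ _).trans hS) (by rw [Finset.card_erase_of_mem hv, hc]))
  rw [tt_sum K.H, hc, smul_eq_mul] at this
  have h4 : tt M S ≤ M.card := Finset.card_filter_le _ _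
  have := K.H.card
  omega

open Classical in
/-- The cross triangles. -/
def CX (col : V → V → ℕ) (M : Finset (Finset V)) (u : V) : Finset (Finset V) :=
  M.filter (Cross col u)

theorem mem_CX {T : Finset V} : T ∈ CX col M u ↔ T ∈ M ∧ Cross col u T := by
  classical
  simp [CX]

theorem Cfg.in_N (K : Cfg col M u c0 c1 c2) {T : Finset V} (hT : T ∈ M) (hX : ¬ Cross col u T) :
    T ⊆ N col u c0 ∨ T ⊆ N col u c1 ∨ T ⊆ N col u c2 := by
  have h3 := ((K.H.mem T).1 hT).1
  obtain ⟨p, hp⟩ : T.Nonempty := by rw [← Finset.card_pos, h3]; norm_num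
  have key : ∀ c, col u p = c → T ⊆ N col u c := by
    intro c hc q hq
    rw [mem_N]
    refine ⟨fun e => K.hu T hT (e ▸ hq), ?_⟩
    by_contra hne
    exact hX ⟨p, hp, q, hq, by rw [hc]; exact Ne.symm hne⟩
  rcases K.h3 _ (K.H.lt u p) with h | h | h
  · exact Or.inl (key _ h)
  · exact Or.inr (Or.inl (key _ h))
  · exact Or.inr (Or.inr (key _ h))

theorem Cfg.count (K : Cfg col M u c0 c1 c2) :
    tt M (N col u c0) + tt M (N col u c1) + tt M (N col u c2) + (CX col M u).card = M.card := by
  classical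
  have hne : ∀ T ∈ M, ∃ p, p ∈ T := by
    intro T hT
    have h3 := ((K.H.mem T).1 hT).1
    obtain ⟨p, hp⟩ : T.Nonempty := by rw [← Finset.card_pos, h3]; norm_num
    exact ⟨p, hp⟩
  have hdis : ∀ c c', c ≠ c' → Disjoint (M.filter (· ⊆ N col u c)) (M.filter (· ⊆ N col u c')) := by
    intro c c' h
    rw [Finset.disjoint_left]
    intro T hT hT'
    rw [Finset.mem_filter] at hT hT'
    obtain ⟨p, hp⟩ := hne T hT.1
    exact h (by rw [← (mem_N.1 (hT.2 hp)).2, ← (mem_N.1 (hT'.2 hp)).2])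
  have hdx : ∀ c, Disjoint (M.filter (· ⊆ N col u c)) (CX col M u) := by
    intro c
    rw [Finset.disjoint_left]
    intro T hT hT'
    rw [Finset.mem_filter] at hT
    obtain ⟨-, p, hp, q, hq, h⟩ := mem_CX.1 hT'
    exact h (by rw [(mem_N.1 (hT.2 hp)).2, (mem_N.1 (hT.2 hq)).2])
  unfold tt
  rw [← Finset.card_union_of_disjoint (hdis _ _ K.C.h01), ← Finset.card_union_of_disjoint,
    ← Finset.card_union_of_disjoint]
  · congr 1
    ext T
    simp only [Finset.mem_union, Finset.mem_filter, mem_CX]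
    constructor
    · tauto
    · intro hT
      by_cases h : Cross col u T
      · tauto
      · have := K.in_N hT h
        tauto
  · rw [Finset.disjoint_union_left, Finset.disjoint_union_left]
    exact ⟨⟨hdx _, hdx _⟩, hdx _⟩
  · rw [Finset.disjoint_union_left]
    exact ⟨hdis _ _ K.C.h02, hdis _ _ K.C.h12⟩

theorem Cfg.cards (K : Cfg col M u c0 c1 c2) :
    (N col u c0).card + (N col u c1).card + (N col u c2).card = 16 := by
  have hdis : ∀ c c', c ≠ c' → Disjoint (N col u c) (N col u c') := by
    intro c c' h
    rw [Finset.disjoint_left]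
    intro p hp hp'
    exact h (by rw [← (mem_N.1 hp).2, ← (mem_N.1 hp').2])
  rw [← Finset.card_union_of_disjoint (hdis _ _ K.C.h01), ← Finset.card_union_of_disjoint]
  · have : N col u c0 ∪ N col u c1 ∪ N col u c2 = Finset.univ.erase u := by
      ext p
      simp only [Finset.mem_union, mem_N, Finset.mem_erase, Finset.mem_univ, and_true]
      have := K.h3 _ (K.H.lt u p)
      tauto
    rw [this, Finset.card_erase_of_mem (Finset.mem_univ _)]
    rfl
  · rw [Finset.disjoint_union_left]
    exact ⟨hdis _ _ K.C.h02, hdis _ _ K.C.h12⟩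

/-! ### The instances, in terms of patterns -/

/-- `W` meets all cross triangles. -/
def Hit (col : V → V → ℕ) (M : Finset (Finset V)) (u : V) (W : Finset V) : Prop :=
  ∀ T ∈ CX col M u, ∃ p ∈ T, p ∈ W

theorem Cfg.rows (K : Cfg col M u c0 c1 c2) {W : Finset V} (hW : Hit col M u W)
    {n1 n3 m0 m2 : ℕ} (hx : Has col u c0 c1 c2 n1 m0 W) (hy : Has col u c1 c0 c2 5 236 W)
    (hz : Has col u c2 c0 c1 n3 m2 W) {R : List (List ℕ)} (hR : rowsOK R)
    (h : ∃ v FL ts, rcheck n1 n3 m0 m2 v R FL ts = true) : False := by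
  obtain ⟨x, hx, hxW⟩ := hx
  obtain ⟨y, hy, hyW⟩ := hy
  obtain ⟨z, hz, hzW⟩ := hz
  obtain ⟨v, FL, ts, h⟩ := h
  refine rows_sound K.C u hx hy hz (noX_of K.H ?_) hR h
  intro T hT hX
  obtain ⟨p, hp, hpW⟩ := hW T (mem_CX.2 ⟨hT, hX⟩)
  refine Or.inl ⟨p, hp, ?_⟩
  rintro (⟨a, ha, rfl⟩ | ⟨a, ha, rfl⟩ | ⟨a, ha, rfl⟩)
  · exact hxW a ha hpW
  · exact hyW a ha hpW
  · exact hzW a ha hpW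

theorem Cfg.L2 (K : Cfg col M u c0 c1 c2) {W : Finset V} (hW : Hit col M u W)
    {S0 S1 S2 : Finset V} (h0 : S0 ⊆ N col u c0) (h1 : S1 ⊆ N col u c1) (h2 : S2 ⊆ N col u c2)
    (k0 : S0.card = 6) (k1 : S1.card = 5) (t0 : tt M S0 = 2) (t1 : tt M S1 = 0)
    (t2 : tt M S2 < S2.card.choose 3)
    (w0 : ∀ p ∈ S0, p ∉ W) (w1 : ∀ p ∈ S1, p ∉ W) (w2 : ∀ p ∈ S2, p ∉ W) : False := by
  obtain ⟨m, hm, x, L⟩ := K.six_two h0 k0 t0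
  obtain ⟨b, hb, hz⟩ := K.s02.s12.three h2 t2 w2
  exact K.rows hW ⟨x, L.1, fun a ha => w0 _ (L.2.1 a ha)⟩ (K.s01.pent h1 k1 t1 w1) hz R1_ok
    (L2_all m hm b hb)

theorem Cfg.K1 (K : Cfg col M u c0 c1 c2) {W : Finset V} (hW : Hit col M u W) {m : ℕ}
    (hm : m ∈ K1l) (hx : Has col u c0 c1 c2 5 m W) (hy : Has col u c1 c0 c2 5 236 W)
    (hz : Has col u c2 c0 c1 4 13 W) : False := K.rows hW hx hy hz R1_ok (K1_all m hm)

theorem Cfg.K7 (K : Cfg col M u c0 c1 c2) {W : Finset V} (hW : Hit col M u W)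
    (hx : Has col u c0 c1 c2 3 0 W) (hy : Has col u c1 c0 c2 5 236 W)
    (hz : Has col u c2 c0 c1 5 236 W) : False := K.rows hW hx hy hz R1_ok ⟨_, _, _, iK7⟩

theorem Cfg.K6 (K : Cfg col M u c0 c1 c2) {W : Finset V} (hW : Hit col M u W)
    (hx : Has col u c0 c1 c2 4 12 W) (hy : Has col u c1 c0 c2 5 236 W)
    (hz : Has col u c2 c0 c1 5 236 W) : False := K.rows hW hx hy hz R1_ok ⟨_, _, _, iK6⟩

theorem Cfg.L4 (K : Cfg col M u c0 c1 c2) {W : Finset V} (hW : Hit col M u W)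
    (hx : Has col u c0 c1 c2 6 3958 W) (hy : Has col u c1 c0 c2 5 236 W)
    (hz : Has col u c2 c0 c1 4 13 W) : False := K.rows hW hx hy hz R1_ok ⟨_, _, _, iL4⟩

theorem K4_all : ∀ e ∈ K4l, ∃ v FL ts, rcheck 5 5 (1023 - e.1) e.2 v R2 FL ts = true := by
  intro e he
  simp only [K4l, List.mem_cons, List.not_mem_nil, or_false] at he
  rcases he with rfl | rfl | rfl | rfl
  exacts [⟨_, _, _, iK4_58_58⟩, ⟨_, _, _, iK4_126_126⟩, ⟨_, _, _, iK4_184_126⟩,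
    ⟨_, _, _, iK4_184_184⟩]

theorem compl_tab : ∀ e ∈ K4l, ∀ i < 5, ∀ j < 5, i ≠ j → bt (1023 - e.1) i j = !bt e.1 i j := by
  decide +kernel

/-- Here the pentagon is in the last part. -/
theorem Cfg.K4 (K : Cfg col M u c0 c1 c2) {W : Finset V} (hW : Hit col M u W) {e : ℕ × ℕ}
    (he : e ∈ K4l) (hx : Has col u c0 c1 c2 5 e.1 W) (hy : Has col u c1 c0 c2 5 e.2 W)
    (hz : Has col u c2 c0 c1 5 236 W) : False := by
  refine K.s12.rows hW ?_ hz hy R2_ok (K4_all e he)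
  obtain ⟨x, hx, hxW⟩ := hx
  refine ⟨x, fun a ha => ⟨(hx a ha).1, fun b hb hab => ⟨((hx a ha).2 b hb hab).1, ?_⟩⟩, hxW⟩
  rw [((hx a ha).2 b hb hab).2, compl_tab e he a ha b hb hab]
  cases bt e.1 a b <;> rfl
end

/-! ### Instances with omitted pairs -/

/-- Embeddings sending `a` to `i`. -/
def pin1 (a i p v : ℕ) : Bool := !Nat.beq p a || Nat.beq v i
/-- Embeddings sending `a` to `i` and `b` to `j`. -/
def pin2 (a i b j p v : ℕ) : Bool := pin1 a i p v && pin1 b j p v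

theorem pin1_eq {a i v : ℕ} (h : pin1 a i a v = true) : v = i := by
  have : Nat.beq a a = true := (beq_iff a a).2 rfl
  simpa [pin1, this] using h

theorem pin2_eq {a i b j p v : ℕ} (h : pin2 a i b j p v = true) : (p = a → v = i) ∧ (p = b → v = j) := by
  rw [pin2, Bool.and_eq_true] at h
  exact ⟨fun e => by subst e; exact pin1_eq h.1, fun e => by subst e; exact pin1_eq h.2⟩

theorem R3_all : ∀ f ∈ [(3308, 4, 0), (3308, 4, 5), (3441, 5, 0)], ∃ FL t,
    icheck 6 5 5 f.1 236 236 [(f.2.1, 6), (f.2.2, 11)] [] FL t = true := by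
  intro f hf
  simp only [List.mem_cons, List.not_mem_nil, or_false] at hf
  rcases hf with rfl | rfl | rfl
  exacts [⟨_, _, iR3_956_4_0⟩, ⟨_, _, iR3_956_4_5⟩, ⟨_, _, iR3_1881_5_0⟩]

theorem Z_all : ∀ f ∈ [(3308, 4), (3441, 5)], ∀ e1 ∈ [(0, 1), (2, 3)], ∀ e2 ∈ [(0, 1), (1, 3)],
    ∃ FL t, icheck 6 5 5 f.1 236 236 [(6, 6 + e1.2), (11, 11 + e2.2)]
      [(f.2, 6, e1.1), (f.2, 6 + e1.2, e1.1), (f.2, 11, e2.1), (f.2, 11 + e2.2, e2.1)] FL t = true := by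
  intro f hf e1 h1 e2 h2
  simp only [List.mem_cons, List.not_mem_nil, or_false] at hf h1 h2
  rcases hf with rfl | rfl <;> rcases h1 with rfl | rfl <;> rcases h2 with rfl | rfl
  exacts [⟨_, _, iZ_956_0_0⟩, ⟨_, _, iZ_956_0_1⟩, ⟨_, _, iZ_956_2_0⟩, ⟨_, _, iZ_956_2_1⟩,
    ⟨_, _, iZ_1881_0_0⟩, ⟨_, _, iZ_1881_0_1⟩, ⟨_, _, iZ_1881_2_0⟩, ⟨_, _, iZ_1881_2_1⟩]

theorem rot1_tab : ∀ i < 5, embB 5 236 5 236 false (pin1 0 i) = true := by decide +kernel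

theorem rot2_tab : ∀ i < 5, ∀ j < 5, i ≠ j →
    embB 5 236 5 236 false (pin2 0 i (bif bt 236 i j then 3 else 1) j) = true := by decide +kernel

section
variable {col : V → V → ℕ} {M : Finset (Finset V)} {u : V} {c0 c1 c2 : ℕ}

theorem Cfg.pent1 (K : Cfg col M u c0 c1 c2) {S : Finset V} (hS : S ⊆ N col u c0)
    (hc : S.card = 5) (ht : tt M S = 0) {b : V} (hb : b ∈ S) :
    ∃ y, Pt col u c0 c1 c2 5 236 y ∧ y 0 = b := by
  obtain ⟨x, L⟩ := K.pent_lab hS hc ht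
  obtain ⟨i, hi, rfl⟩ := L.2.2 b hb
  obtain ⟨g, hg, hp⟩ := emb_pt K.H.sym L.1 (rot1_tab i hi)
  exact ⟨_, hp, congrArg x (pin1_eq (hg 0 (by norm_num)).2)⟩

theorem Cfg.pent2 (K : Cfg col M u c0 c1 c2) {S : Finset V} (hS : S ⊆ N col u c0)
    (hc : S.card = 5) (ht : tt M S = 0) {b b' : V} (hb : b ∈ S) (hb' : b' ∈ S) (hne : b ≠ b') :
    ∃ y, Pt col u c0 c1 c2 5 236 y ∧ y 0 = b ∧
      ((col b b' = c1 ∧ y 1 = b') ∨ (col b b' = c2 ∧ y 3 = b')) := by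
  obtain ⟨x, L⟩ := K.pent_lab hS hc ht
  obtain ⟨i, hi, rfl⟩ := L.2.2 b hb
  obtain ⟨j, hj, rfl⟩ := L.2.2 b' hb'
  have hij : i ≠ j := fun h => hne (by rw [h])
  obtain ⟨g, hg, hp⟩ := emb_pt K.H.sym L.1 (rot2_tab i hi j hj hij)
  have e0 := (pin2_eq (hg 0 (by norm_num)).2).1 rfl
  have e1 := (pin2_eq (hg 1 (by norm_num)).2).2
  have e3 := (pin2_eq (hg 3 (by norm_num)).2).2
  have ec := ((L.1 i hi).2 j hj hij).2
  refine ⟨_, hp, congrArg x e0, ?_⟩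
  cases h : bt 236 i j
  · rw [h] at e1 ec
    exact Or.inl ⟨ec, congrArg x (e1 rfl)⟩
  · rw [h] at e3 ec
    exact Or.inr ⟨ec, congrArg x (e3 rfl)⟩

theorem Cfg.R3 (K : Cfg col M u c0 c1 c2) {f : ℕ × ℕ × ℕ}
    (hf : f ∈ [(3308, 4, 0), (3308, 4, 5), (3441, 5, 0)]) {x : ℕ → V}
    (hx : Pt col u c0 c1 c2 6 f.1 x) (k1 : (N col u c1).card = 5) (k2 : (N col u c2).card = 5)
    (t1 : tt M (N col u c1) = 0) (t2 : tt M (N col u c2) = 0) {b c : V} (hb : b ∈ N col u c1)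
    (hc : c ∈ N col u c2) (hX : ∀ T ∈ CX col M u, (x f.2.1 ∈ T ∧ b ∈ T) ∨ (x f.2.2 ∈ T ∧ c ∈ T)) :
    False := by
  obtain ⟨y, hy, rfl⟩ := K.s01.pent1 subset_rfl k1 t1 hb
  obtain ⟨z, hz, rfl⟩ := K.s02.s12.pent1 subset_rfl k2 t2 hc
  obtain ⟨FL, t, h⟩ := R3_all f hf
  have hf6 : f.2.1 < 6 ∧ f.2.2 < 6 := by
    simp only [List.mem_cons, List.not_mem_nil, or_false] at hf
    rcases hf with rfl | rfl | rfl <;> norm_num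
  have e1 : cat 6 5 x y z f.2.1 = x f.2.1 := cat0 _ _ _ _ _ hf6.1
  have e2 : cat 6 5 x y z f.2.2 = x f.2.2 := cat0 _ _ _ _ _ hf6.2
  have hbx : ∀ i < 6, x i ≠ y 0 := fun i hi e => by
    have := (hx i hi).1
    rw [e, (mem_N.1 hb).2] at this
    exact K.C.h01 this.symm
  have hcx : ∀ i < 6, x i ≠ z 0 := fun i hi e => by
    have := (hx i hi).1
    rw [e, (mem_N.1 hc).2] at this
    exact K.C.h02 this.symm
  refine inst_sound K.C u hx hy hz (noX_of K.H ?_) (by simp) (by simp; omega) h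
  intro T hT hCr
  refine Or.inr ?_
  rcases hX T (mem_CX.2 ⟨hT, hCr⟩) with ⟨h1, h2⟩ | ⟨h1, h2⟩
  · exact ⟨_, h1, _, h2, hbx _ hf6.1, ⟨_, List.mem_cons_self, Or.inl ⟨e1.symm, rfl⟩⟩,
      ⟨_, List.mem_cons_self, Or.inr ⟨rfl, e1.symm⟩⟩⟩
  · exact ⟨_, h1, _, h2, hcx _ hf6.2, ⟨(f.2.2, 11), by simp, Or.inl ⟨e2.symm, rfl⟩⟩,
      ⟨(f.2.2, 11), by simp, Or.inr ⟨rfl, e2.symm⟩⟩⟩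

theorem Cfg.Z (K : Cfg col M u c0 c1 c2) {f : ℕ × ℕ}
    (hf : f ∈ [(3308, 4), (3441, 5)]) {x : ℕ → V}
    (hx : Pt col u c0 c1 c2 6 f.1 x) (k1 : (N col u c1).card = 5) (k2 : (N col u c2).card = 5)
    (t1 : tt M (N col u c1) = 0) (t2 : tt M (N col u c2) = 0) {b b' c c' : V}
    (hb : b ∈ N col u c1) (hb' : b' ∈ N col u c1) (hbb : b ≠ b')
    (hc : c ∈ N col u c2) (hc' : c' ∈ N col u c2) (hcc : c ≠ c')
    (m1 : col (x f.2) b = col b b') (m1' : col (x f.2) b' = col b b')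
    (m2 : col (x f.2) c = col c c') (m2' : col (x f.2) c' = col c c')
    (hX : ∀ T ∈ CX col M u, (b ∈ T ∧ b' ∈ T) ∨ (c ∈ T ∧ c' ∈ T)) : False := by
  obtain ⟨y, hy, rfl, hyb⟩ := K.s01.pent2 subset_rfl k1 t1 hb hb' hbb
  obtain ⟨z, hz, rfl, hzc⟩ := K.s02.s12.pent2 subset_rfl k2 t2 hc hc' hcc
  have r0 : rol c0 c1 c0 = 0 := by simp [rol]
  have r1 : rol c0 c1 c1 = 1 := by simp [rol, K.C.h01.symm]
  have r2 : rol c0 c1 c2 = 2 := by simp [rol, K.C.h02.symm, K.C.h12.symm]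
  obtain ⟨e1, he1, q1, q1'⟩ : ∃ e1 ∈ [((0 : ℕ), (1 : ℕ)), (2, 3)], rol c0 c1 (col (y 0) b') = e1.1 ∧
      y e1.2 = b' := by
    rcases hyb with ⟨h, h'⟩ | ⟨h, h'⟩
    · exact ⟨(0, 1), by simp, by rw [h, r0], h'⟩
    · exact ⟨(2, 3), by simp, by rw [h, r2], h'⟩
  obtain ⟨e2, he2, q2, q2'⟩ : ∃ e2 ∈ [((0 : ℕ), (1 : ℕ)), (1, 3)], rol c0 c1 (col (z 0) c') = e2.1 ∧
      z e2.2 = c' := by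
    rcases hzc with ⟨h, h'⟩ | ⟨h, h'⟩
    · exact ⟨(0, 1), by simp, by rw [h, r0], h'⟩
    · exact ⟨(1, 3), by simp, by rw [h, r1], h'⟩
  obtain ⟨FL, t, h⟩ := Z_all f hf e1 he1 e2 he2
  have hf6 : f.2 < 6 := by
    simp only [List.mem_cons, List.not_mem_nil, or_false] at hf
    rcases hf with rfl | rfl <;> norm_num
  have he15 : e1.2 < 5 := by
    simp only [List.mem_cons, List.not_mem_nil, or_false] at he1
    rcases he1 with rfl | rfl <;> norm_num
  have he25 : e2.2 < 5 := by
    simp only [List.mem_cons, List.not_mem_nil, or_false] at he2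
    rcases he2 with rfl | rfl <;> norm_num
  have g1 : cat 6 5 x y z f.2 = x f.2 := cat0 _ _ _ _ _ hf6
  have g2 : cat 6 5 x y z 6 = y 0 := rfl
  have g3 : cat 6 5 x y z 11 = z 0 := rfl
  have g4 : cat 6 5 x y z (6 + e1.2) = b' := by rw [cat1 _ _ _ _ _ he15, q1']
  have g5 : cat 6 5 x y z (11 + e2.2) = c' := by
    rw [← q2']; exact cat2 6 5 x y z
  refine inst_sound K.C u hx hy hz (noX_of K.H ?_) ?_ (by simp; omega) h
  · intro T hT hCr
    refine Or.inr ?_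
    rcases hX T (mem_CX.2 ⟨hT, hCr⟩) with ⟨h1, h2⟩ | ⟨h1, h2⟩
    · exact ⟨_, h1, _, h2, hbb, ⟨_, List.mem_cons_self, Or.inl ⟨rfl, g4.symm⟩⟩,
        ⟨_, List.mem_cons_self, Or.inr ⟨g4.symm, rfl⟩⟩⟩
    · exact ⟨_, h1, _, h2, hcc, ⟨(11, 11 + e2.2), by simp, Or.inl ⟨rfl, g5.symm⟩⟩,
        ⟨(11, 11 + e2.2), by simp, Or.inr ⟨g5.symm, rfl⟩⟩⟩
  · intro e he
    simp only [List.mem_cons, List.not_mem_nil, or_false] at he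
    rcases he with rfl | rfl | rfl | rfl
    · simp only [g1, g2, m1, q1]
    · simp only [g1, g4, m1', q1]
    · simp only [g1, g3, m2, q2]
    · simp only [g1, g5, m2', q2]
end

/-! ### The case of two triangles in the large part -/

/-- Avoid one point. -/
def av (i : ℕ) (v : ℕ) : Bool := !Nat.beq v i
/-- Avoid two points. -/
def av2 (i j : ℕ) (v : ℕ) : Bool := !Nat.beq v i && !Nat.beq v j

theorem av_ne {i v : ℕ} (h : av i v = true) : v ≠ i := by
  rintro rfl
  have : Nat.beq v v = true := (beq_iff v v).2 rfl
  rw [av, this] at h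
  exact absurd h (by decide)

theorem av2_ne {i j v : ℕ} (h : av2 i j v = true) : v ≠ i ∧ v ≠ j := by
  rw [av2, Bool.and_eq_true] at h
  exact ⟨av_ne h.1, av_ne h.2⟩

/-- The masks used in the instances `R3`. -/
def R3l : List (ℕ × ℕ × ℕ) := [(3308, 4, 0), (3308, 4, 5), (3441, 5, 0)]
/-- The masks used in the instances `Z`. -/
def Zl : List (ℕ × ℕ) := [(3308, 4), (3441, 5)]

/-- The options for two cross triangles. -/
def t200 (m i j : ℕ) : Bool :=
  (K1l.any fun p => embB 6 m 5 p false fun _ => av i) ||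
  ((K1l.any fun p => embB 6 m 5 p true fun _ => av j) ||
  (embB 6 m 3 0 false (fun _ => av2 i j) || (embB 6 m 3 0 true (fun _ => av2 i j) ||
  (embB 6 m 4 12 false (fun _ => av2 i j) || (embB 6 m 4 12 true (fun _ => av2 i j) ||
  ((R3l.any fun f => embB 6 m 6 f.1 false (pin2 f.2.1 i f.2.2 j)) ||
  (R3l.any fun f => embB 6 m 6 f.1 true (pin2 f.2.1 j f.2.2 i))))))))

theorem t200_tab : ∀ m ∈ T2, ∀ i < 6, ∀ j < 6, i ≠ j → t200 m i j = true := by decide +kernel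

theorem t200_diag : ∀ m ∈ T2, ∀ i < 6, t200 m i i = true ∨
    (Zl.any fun f => embB 6 m 6 f.1 false (pin1 f.2 i)) = true ∨
    (Zl.any fun f => embB 6 m 6 f.1 true (pin1 f.2 i)) = true := by decide +kernel

section
variable {col : V → V → ℕ} {M : Finset (Finset V)} {u : V} {c0 c1 c2 : ℕ}

theorem N_disj {c c' : ℕ} (h : c ≠ c') {p : V} (hp : p ∈ N col u c) : p ∉ N col u c' := by
  intro hp'
  exact h (by rw [← (mem_N.1 hp).2, ← (mem_N.1 hp').2])

theorem hit_exist {B : Finset V} (h : ∀ T ∈ CX col M u, ∃ p ∈ T, p ∈ B) :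
    ∃ W ⊆ B, W.card ≤ (CX col M u).card ∧ Hit col M u W := by
  choose! f hf using h
  refine ⟨(CX col M u).image f, ?_, Finset.card_image_le, ?_⟩
  · intro p hp
    obtain ⟨T, hT, rfl⟩ := Finset.mem_image.1 hp
    exact (hf T hT).2
  · intro T hT
    exact ⟨f T, (hf T hT).1, Finset.mem_image_of_mem f hT⟩

/-- Two triangles in the part of size six, one pentagon avoiding all cross triangles. -/
theorem Cfg.L2hit (K : Cfg col M u c0 c1 c2) (k0 : (N col u c0).card = 6)
    (k1 : (N col u c1).card = 5) (k2 : (N col u c2).card = 5)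
    (t0 : tt M (N col u c0) = 2) (t1 : tt M (N col u c1) = 0)
    (t2 : tt M (N col u c2) + (CX col M u).card ≤ 2)
    (h : ∀ T ∈ CX col M u, ∃ p ∈ T, p ∈ N col u c2) : False := by
  obtain ⟨W, hWB, hWc, hW⟩ := hit_exist h
  refine K.L2 hW (S0 := N col u c0) (S1 := N col u c1) (S2 := N col u c2 \ W) subset_rfl subset_rfl
    Finset.sdiff_subset k0 k1 t0 t1 ?_ (fun p hp hp' => N_disj K.C.h02 hp (hWB hp'))
    (fun p hp hp' => N_disj K.C.h12 hp (hWB hp')) (fun p hp => (Finset.mem_sdiff.1 hp).2)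
  have e : (N col u c2 \ W).card = 5 - W.card := by rw [Finset.card_sdiff_of_subset hWB, k2]
  have e2 : tt M (N col u c2 \ W) ≤ tt M (N col u c2) := tt_mono Finset.sdiff_subset
  have hc : W.card = 0 ∨ W.card = 1 ∨ W.card = 2 := by omega
  rcases hc with hc | hc | hc <;> rw [e, hc] <;> simp [Nat.choose] <;> omega

theorem Cfg.core200 (K : Cfg col M u c0 c1 c2) (k1 : (N col u c1).card = 5)
    (k2 : (N col u c2).card = 5) (t1 : tt M (N col u c1) = 0) (t2 : tt M (N col u c2) = 0)
    {m : ℕ} {x : ℕ → V} (L : Lab col u c0 c1 c2 (N col u c0) 6 m x) {i j : ℕ} (hi : i < 6)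
    (hj : j < 6) {b c : V} (hb : b ∈ N col u c1) (hc : c ∈ N col u c2)
    (hX : ∀ T ∈ CX col M u, (x i ∈ T ∧ b ∈ T) ∨ (x j ∈ T ∧ c ∈ T)) (ht : t200 m i j = true) :
    False := by
  have hN : ∀ a < 6, x a ∈ N col u c0 := L.2.1
  have hne : ∀ a < 6, ∀ b < 6, a ≠ b → x a ≠ x b := fun a ha b hb hab => ((L.1 a ha).2 b hb hab).1
  have W1 : Hit col M u {x i, c} := by
    intro T hT
    rcases hX T hT with h | h
    · exact ⟨x i, h.1, by simp⟩
    · exact ⟨c, h.2, by simp⟩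
  have W2 : Hit col M u {x j, b} := by
    intro T hT
    rcases hX T hT with h | h
    · exact ⟨b, h.2, by simp⟩
    · exact ⟨x j, h.1, by simp⟩
  have W3 : Hit col M u {x i, x j} := by
    intro T hT
    rcases hX T hT with h | h
    · exact ⟨x i, h.1, by simp⟩
    · exact ⟨x j, h.1, by simp⟩
  have w1 : ∀ a < 6, av i a = true → x a ∉ ({x i, c} : Finset V) := by
    intro a ha h h'
    rw [Finset.mem_insert, Finset.mem_singleton] at h'
    rcases h' with h' | h'
    · exact hne a ha i hi (av_ne h) h'
    · exact N_disj K.C.h02 (hN a ha) (h' ▸ hc)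
  have w2 : ∀ a < 6, av j a = true → x a ∉ ({x j, b} : Finset V) := by
    intro a ha h h'
    rw [Finset.mem_insert, Finset.mem_singleton] at h'
    rcases h' with h' | h'
    · exact hne a ha j hj (av_ne h) h'
    · exact N_disj K.C.h01 (hN a ha) (h' ▸ hb)
  have w3 : ∀ a < 6, av2 i j a = true → x a ∉ ({x i, x j} : Finset V) := by
    intro a ha h h'
    rw [Finset.mem_insert, Finset.mem_singleton] at h'
    rcases h' with h' | h'
    · exact hne a ha i hi (av2_ne h).1 h'
    · exact hne a ha j hj (av2_ne h).2 h'
  have B3 : ∀ p ∈ N col u c1, p ∉ ({x i, x j} : Finset V) := by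
    intro p hp h'
    rw [Finset.mem_insert, Finset.mem_singleton] at h'
    rcases h' with h' | h'
    · exact N_disj K.C.h01.symm hp (h' ▸ hN i hi)
    · exact N_disj K.C.h01.symm hp (h' ▸ hN j hj)
  have C3 : ∀ p ∈ N col u c2, p ∉ ({x i, x j} : Finset V) := by
    intro p hp h'
    rw [Finset.mem_insert, Finset.mem_singleton] at h'
    rcases h' with h' | h'
    · exact N_disj K.C.h02.symm hp (h' ▸ hN i hi)
    · exact N_disj K.C.h02.symm hp (h' ▸ hN j hj)
  have PB := K.s01.pent subset_rfl k1 t1 B3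
  have PC := K.s02.s12.pent subset_rfl k2 t2 C3
  rw [t200, Bool.or_eq_true, Bool.or_eq_true, Bool.or_eq_true, Bool.or_eq_true, Bool.or_eq_true,
    Bool.or_eq_true, Bool.or_eq_true] at ht
  rcases ht with h | h | h | h | h | h | h | h
  · obtain ⟨p, hp, h⟩ := List.any_eq_true.1 h
    refine K.K1 W1 hp (has_emb K.H.sym false L.1 h w1) (K.s01.pent subset_rfl k1 t1 ?_)
      (K.s02.s12.path subset_rfl k2 t2 hc ?_)
    · intro p hp h'
      rw [Finset.mem_insert, Finset.mem_singleton] at h'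
      rcases h' with h' | h'
      · exact N_disj K.C.h01.symm hp (h' ▸ hN i hi)
      · exact N_disj K.C.h12 hp (h' ▸ hc)
    · intro p hp hpc h'
      rw [Finset.mem_insert, Finset.mem_singleton] at h'
      rcases h' with h' | h'
      · exact N_disj K.C.h02.symm hp (h' ▸ hN i hi)
      · exact hpc h'
  · obtain ⟨p, hp, h⟩ := List.any_eq_true.1 h
    refine K.s12.K1 W2 hp (has_emb K.H.sym true L.1 h w2) (K.s02.s12.pent subset_rfl k2 t2 ?_)
      (K.s01.path subset_rfl k1 t1 hb ?_)
    · intro p hp h'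
      rw [Finset.mem_insert, Finset.mem_singleton] at h'
      rcases h' with h' | h'
      · exact N_disj K.C.h02.symm hp (h' ▸ hN j hj)
      · exact N_disj K.C.h12.symm hp (h' ▸ hb)
    · intro p hp hpc h'
      rw [Finset.mem_insert, Finset.mem_singleton] at h'
      rcases h' with h' | h'
      · exact N_disj K.C.h01.symm hp (h' ▸ hN j hj)
      · exact hpc h'
  · exact K.K7 W3 (has_emb K.H.sym false L.1 h w3) PB PC
  · exact K.s12.K7 W3 (has_emb K.H.sym true L.1 h w3) PC PB
  · exact K.K6 W3 (has_emb K.H.sym false L.1 h w3) PB PC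
  · exact K.s12.K6 W3 (has_emb K.H.sym true L.1 h w3) PC PB
  · obtain ⟨f, hf, h⟩ := List.any_eq_true.1 h
    have hf6 : f.2.1 < 6 ∧ f.2.2 < 6 := by
      simp only [R3l, List.mem_cons, List.not_mem_nil, or_false] at hf
      rcases hf with rfl | rfl | rfl <;> norm_num
    obtain ⟨g, hg, hp⟩ := emb_pt K.H.sym L.1 h
    refine K.R3 hf hp k1 k2 t1 t2 hb hc ?_
    rw [(pin2_eq (hg _ hf6.1).2).1 rfl, (pin2_eq (hg _ hf6.2).2).2 rfl]
    exact hX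
  · obtain ⟨f, hf, h⟩ := List.any_eq_true.1 h
    have hf6 : f.2.1 < 6 ∧ f.2.2 < 6 := by
      simp only [R3l, List.mem_cons, List.not_mem_nil, or_false] at hf
      rcases hf with rfl | rfl | rfl <;> norm_num
    obtain ⟨g, hg, hp⟩ := emb_pt K.H.sym L.1 h
    refine K.s12.R3 hf hp k2 k1 t2 t1 hc hb ?_
    rw [(pin2_eq (hg _ hf6.1).2).1 rfl, (pin2_eq (hg _ hf6.2).2).2 rfl]
    exact fun T hT => (hX T hT).symm

theorem Cfg.Zdiag (K : Cfg col M u c0 c1 c2) (k1 : (N col u c1).card = 5)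
    (k2 : (N col u c2).card = 5) (t1 : tt M (N col u c1) = 0) (t2 : tt M (N col u c2) = 0)
    {x : ℕ → V} {i : ℕ} {f : ℕ × ℕ} (hf : f ∈ Zl) {g : ℕ → ℕ}
    (hg : g f.2 = i) (hp : Pt col u c0 c1 c2 6 f.1 fun a => x (g a)) {b b' c c' : V}
    (hb : b ∈ N col u c1) (hb' : b' ∈ N col u c1) (hbb : b ≠ b')
    (hc : c ∈ N col u c2) (hc' : c' ∈ N col u c2) (hcc : c ≠ c')
    (h1 : {x i, b, b'} ∈ M) (h2 : {x i, c, c'} ∈ M) (hi : x i ∈ N col u c0)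
    (hX : ∀ T ∈ CX col M u, T = {x i, b, b'} ∨ T = {x i, c, c'}) : False := by
  have mono : ∀ d d' : V, d ≠ d' → x i ≠ d → x i ≠ d' → {x i, d, d'} ∈ M →
      col (x i) d = col d d' ∧ col (x i) d' = col d d' := by
    intro d d' h h' h'' hM
    obtain ⟨k, hk⟩ := ((K.H.mem _).1 hM).2
    have e1 := hk (x i) (by simp) d (by simp) h'
    have e2 := hk (x i) (by simp) d' (by simp) h''
    have e3 := hk d (by simp) d' (by simp) h
    exact ⟨by rw [e1, e3], by rw [e2, e3]⟩
  have nb : ∀ d ∈ N col u c1, x i ≠ d := fun d hd e => N_disj K.C.h01 hi (e ▸ hd)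
  have nc : ∀ d ∈ N col u c2, x i ≠ d := fun d hd e => N_disj K.C.h02 hi (e ▸ hd)
  obtain ⟨m1, m1'⟩ := mono b b' hbb (nb _ hb) (nb _ hb') h1
  obtain ⟨m2, m2'⟩ := mono c c' hcc (nc _ hc) (nc _ hc') h2
  subst hg
  refine K.Z hf hp k1 k2 t1 t2 hb hb' hbb hc hc' hcc m1 m1' m2 m2' ?_
  intro T hT
  rcases hX T hT with rfl | rfl
  · exact Or.inl ⟨by simp, by simp⟩
  · exact Or.inr ⟨by simp, by simp⟩

/-- A cross triangle with no point in the third part, and one point in the first. -/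
theorem Cfg.split (K : Cfg col M u c0 c1 c2) {T : Finset V} (hT : T ∈ CX col M u)
    (h2 : ∀ p ∈ T, p ∉ N col u c2) :
    (∃ a ∈ T, a ∈ N col u c0) ∧ ∃ b ∈ T, b ∈ N col u c1 := by
  obtain ⟨hM, p, hp, q, hq, hpq⟩ := mem_CX.1 hT
  have key : ∀ p ∈ T, p ∈ N col u c0 ∨ p ∈ N col u c1 := by
    intro p hp
    have hpu : p ≠ u := fun e => K.hu T hM (e ▸ hp)
    rcases K.h3 _ (K.H.lt u p) with h | h | h
    · exact Or.inl (mem_N.2 ⟨hpu, h⟩)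
    · exact Or.inr (mem_N.2 ⟨hpu, h⟩)
    · exact absurd (mem_N.2 ⟨hpu, h⟩) (h2 p hp)
  rcases key p hp with h | h <;> rcases key q hq with h' | h'
  · exact absurd (by rw [(mem_N.1 h).2, (mem_N.1 h').2]) hpq
  · exact ⟨⟨p, hp, h⟩, q, hq, h'⟩
  · exact ⟨⟨q, hq, h'⟩, p, hp, h⟩
  · exact absurd (by rw [(mem_N.1 h).2, (mem_N.1 h').2]) hpq

theorem Cfg.form (K : Cfg col M u c0 c1 c2) {T : Finset V} (hM : T ∈ M) {a : V}
    (h2 : ∀ p ∈ T, p ∉ N col u c2) (ha : a ∈ T) (h : ∀ p ∈ T, p ∈ N col u c0 → p = a) :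
    ∃ b b', b ∈ N col u c1 ∧ b' ∈ N col u c1 ∧ b ≠ b' ∧ T = {a, b, b'} := by
  have hc := ((K.H.mem T).1 hM).1
  have hc' : (T.erase a).card = 2 := by rw [Finset.card_erase_of_mem ha, hc]
  obtain ⟨b, b', hbb, e⟩ := Finset.card_eq_two.1 hc'
  have key : ∀ p ∈ T.erase a, p ∈ N col u c1 := by
    intro p hp
    obtain ⟨hpa, hp⟩ := Finset.mem_erase.1 hp
    have hpu : p ≠ u := fun e => K.hu T hM (e ▸ hp)
    rcases K.h3 _ (K.H.lt u p) with h' | h' | h'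
    · exact absurd (h p hp (mem_N.2 ⟨hpu, h'⟩)) hpa
    · exact mem_N.2 ⟨hpu, h'⟩
    · exact absurd (mem_N.2 ⟨hpu, h'⟩) (h2 p hp)
  exact ⟨b, b', key b (by rw [e]; simp), key b' (by rw [e]; simp), hbb,
    by rw [← e, Finset.insert_erase ha]⟩

theorem Cfg.case200 (K : Cfg col M u c0 c1 c2) (k0 : (N col u c0).card = 6)
    (k1 : (N col u c1).card = 5) (k2 : (N col u c2).card = 5)
    (t0 : tt M (N col u c0) = 2) (t1 : tt M (N col u c1) = 0) (t2 : tt M (N col u c2) = 0)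
    (hx : (CX col M u).card ≤ 2) : False := by
  by_cases hB : ∀ T ∈ CX col M u, ∃ p ∈ T, p ∈ N col u c1
  · exact K.s12.L2hit k0 k2 k1 t0 t2 (by omega) hB
  by_cases hC : ∀ T ∈ CX col M u, ∃ p ∈ T, p ∈ N col u c2
  · exact K.L2hit k0 k1 k2 t0 t1 (by omega) hC
  push Not at hB hC
  obtain ⟨T1, hT1, hC1⟩ := hC
  obtain ⟨T2', hT2, hB2⟩ := hB
  obtain ⟨⟨a1, ha1, ha1'⟩, b, hb, hb'⟩ := K.split hT1 hC1
  obtain ⟨⟨a2, ha2, ha2'⟩, c, hc, hc'⟩ := K.s12.split hT2 hB2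
  have hX : ∀ T ∈ CX col M u, T = T1 ∨ T = T2' := by
    have hne : T1 ≠ T2' := fun e => hB2 b (e ▸ hb) hb'
    have : ({T1, T2'} : Finset (Finset V)) = CX col M u := by
      apply Finset.eq_of_subset_of_card_le
      · intro T hT
        rw [Finset.mem_insert, Finset.mem_singleton] at hT
        rcases hT with rfl | rfl <;> assumption
      · rw [Finset.card_pair hne]; exact hx
    intro T hT
    rw [← this, Finset.mem_insert, Finset.mem_singleton] at hT
    exact hT
  obtain ⟨m, hm, x, L⟩ := K.six_two subset_rfl k0 t0
  have core : ∀ a1 a2, a1 ∈ T1 → a2 ∈ T2' → a1 ∈ N col u c0 → a2 ∈ N col u c0 → a1 = a2 := by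
    intro a1 a2 h1 h2 h1' h2'
    by_contra hne
    obtain ⟨i, hi, rfl⟩ := L.2.2 a1 h1'
    obtain ⟨j, hj, rfl⟩ := L.2.2 a2 h2'
    refine K.core200 k1 k2 t1 t2 L hi hj hb' hc' ?_ (t200_tab m hm i hi j hj ?_)
    · intro T hT
      rcases hX T hT with rfl | rfl
      · exact Or.inl ⟨h1, hb⟩
      · exact Or.inr ⟨h2, hc⟩
    · rintro rfl; exact hne rfl
  have e : a1 = a2 := core a1 a2 ha1 ha2 ha1' ha2'
  subst e
  obtain ⟨b1, b2, hb1, hb2, hbb, e1⟩ := K.form (mem_CX.1 hT1).1 hC1 ha1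
    (fun p hp hpA => core p a1 hp ha2 hpA ha1')
  obtain ⟨d1, d2, hd1, hd2, hdd, e2⟩ := K.s12.form (mem_CX.1 hT2).1 hB2 ha2
    (fun p hp hpA => (core a1 p ha1 hp ha1' hpA).symm)
  obtain ⟨i, hi, rfl⟩ := L.2.2 a1 ha1'
  subst e1 e2
  have hM1 := (mem_CX.1 hT1).1
  have hM2 := (mem_CX.1 hT2).1
  rcases t200_diag m hm i hi with h | h | h
  · refine K.core200 k1 k2 t1 t2 L hi hi hb' hc' ?_ h
    intro T hT
    rcases hX T hT with rfl | rfl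
    · exact Or.inl ⟨ha1, hb⟩
    · exact Or.inr ⟨ha2, hc⟩
  · obtain ⟨f, hf, h⟩ := List.any_eq_true.1 h
    have hf6 : f.2 < 6 := by
      simp only [Zl, List.mem_cons, List.not_mem_nil, or_false] at hf
      rcases hf with rfl | rfl <;> norm_num
    obtain ⟨g, hg, hp⟩ := emb_pt K.H.sym L.1 h
    exact K.Zdiag k1 k2 t1 t2 hf (pin1_eq (hg _ hf6).2) hp hb1 hb2 hbb hd1 hd2 hdd hM1 hM2 ha1' hX
  · obtain ⟨f, hf, h⟩ := List.any_eq_true.1 h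
    have hf6 : f.2 < 6 := by
      simp only [Zl, List.mem_cons, List.not_mem_nil, or_false] at hf
      rcases hf with rfl | rfl <;> norm_num
    obtain ⟨g, hg, hp⟩ := emb_pt K.H.sym L.1 h
    exact K.s12.Zdiag k2 k1 t2 t1 hf (pin1_eq (hg _ hf6).2) hp hd1 hd2 hdd hb1 hb2 hbb hM2 hM1 ha1'
      (fun T hT => (hX T hT).symm)
end

/-! ### The remaining cases -/

/-- The options for one triangle in a part of size five. -/
def o210 (m mb i : ℕ) : Bool :=
  ((embB 5 mb 4 13 false fun _ _ => true) && K1l.any fun p => embB 6 m 5 p true fun _ => av i) ||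
  (((embB 6 m 4 13 false fun _ => av i) && K1l.any fun p => embB 5 mb 5 p true fun _ _ => true) ||
  (((embB 6 m 5 236 false fun _ _ => true) && K1l.any fun p => embB 5 mb 5 p false fun _ _ => true) ||
  ((K4l.any fun e => (embB 5 mb 5 e.2 false fun _ _ => true) && embB 6 m 5 e.1 false fun _ => av i) ||
  ((embB 5 mb 5 116 false fun _ _ => true) && embB 6 m 5 222 false fun _ => av i))))

theorem o210_tab : ∀ m ∈ T2, ∀ mb ∈ B1, ∀ i < 6, o210 m mb i = true := by decide +kernel

theorem o310_tab : ∀ b ∈ 236 :: B1, ∀ r < 32, tc 6 (b + 1024 * r) = 3 → ∀ mb ∈ B1,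
    o210 (b + 1024 * r) mb 6 = true := by decide +kernel

theorem o300_tab : ∀ b ∈ 236 :: B1, ∀ r < 32, tc 6 (b + 1024 * r) = 3 →
    (K1l.any fun p => embB 6 (b + 1024 * r) 5 p false fun _ _ => true) = true ∨
    embB 6 (b + 1024 * r) 6 3958 false (fun _ _ => true) = true := by decide +kernel

theorem mono_tab : ∀ m < 8, tc 3 m ≠ 0 → embB 3 m 3 0 false (fun _ _ => true) = true ∨
    embB 3 m 3 0 true (fun _ _ => true) = true := by decide +kernel

section
variable {col : V → V → ℕ} {M : Finset (Finset V)} {u : V} {c0 c1 c2 : ℕ}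

theorem Cfg.core210 (K : Cfg col M u c0 c1 c2) (k2 : (N col u c2).card = 5)
    (t2 : tt M (N col u c2) = 0) {m mb i : ℕ} {x y : ℕ → V}
    (L : Lab col u c0 c1 c2 (N col u c0) 6 m x) (L' : Lab col u c1 c0 c2 (N col u c1) 5 mb y)
    {W : Finset V} (hW : Hit col M u W) (w0 : ∀ a < 6, av i a = true → x a ∉ W)
    (w1 : ∀ p ∈ N col u c1, p ∉ W) (w2 : ∀ p ∈ N col u c2, p ∉ W)
    {c : V} (hc : c ∈ N col u c2) (hWc : Hit col M u {c}) (h : o210 m mb i = true) : False := by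
  have v0 : ∀ a < 6, x a ∉ ({c} : Finset V) := by
    intro a ha h
    rw [Finset.mem_singleton] at h
    exact N_disj K.C.h02 (L.2.1 a ha) (h ▸ hc)
  have v1 : ∀ a < 5, y a ∉ ({c} : Finset V) := by
    intro a ha h
    rw [Finset.mem_singleton] at h
    exact N_disj K.C.h12 (L'.2.1 a ha) (h ▸ hc)
  have y1 : ∀ a < 5, y a ∉ W := fun a ha => w1 _ (L'.2.1 a ha)
  rw [o210, Bool.or_eq_true, Bool.or_eq_true, Bool.or_eq_true, Bool.or_eq_true] at h
  rcases h with h | h | h | h | h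
  · rw [Bool.and_eq_true] at h
    obtain ⟨p, hp, h'⟩ := List.any_eq_true.1 h.2
    exact K.s12.K1 hW hp (has_emb K.H.sym true L.1 h' w0) (K.s02.s12.pent subset_rfl k2 t2 w2)
      (has_emb K.H.sym false (ok := fun _ => true) L'.1 h.1 fun a ha _ => y1 a ha)
  · rw [Bool.and_eq_true] at h
    obtain ⟨p, hp, h'⟩ := List.any_eq_true.1 h.2
    exact K.s01.s12.K1 hW hp
      (has_emb K.H.sym true (ok := fun _ => true) L'.1 h' fun a ha _ => y1 a ha)
      (K.s02.pent subset_rfl k2 t2 w2) (has_emb K.H.sym false L.1 h.1 w0)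
  · rw [Bool.and_eq_true] at h
    obtain ⟨p, hp, h'⟩ := List.any_eq_true.1 h.2
    refine K.s01.K1 hWc hp
      (has_emb K.H.sym false (ok := fun _ => true) L'.1 h' fun a ha _ => v1 a ha)
      (has_emb K.H.sym false (ok := fun _ => true) L.1 h.1 fun a ha _ => v0 a ha)
      (K.s02.path subset_rfl k2 t2 hc ?_)
    intro p hp hpc hpc'
    exact hpc (Finset.mem_singleton.1 hpc')
  · obtain ⟨e, he, h⟩ := List.any_eq_true.1 h
    rw [Bool.and_eq_true] at h
    exact K.K4 hW he (has_emb K.H.sym false L.1 h.2 w0)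
      (has_emb K.H.sym false (ok := fun _ => true) L'.1 h.1 fun a ha _ => y1 a ha)
      (K.s02.s12.pent subset_rfl k2 t2 w2)
  · rw [Bool.and_eq_true] at h
    exact K.s01.K4 hW (e := (116, 222)) (by decide)
      (has_emb K.H.sym false (ok := fun _ => true) L'.1 h.1 fun a ha _ => y1 a ha)
      (has_emb K.H.sym false L.1 h.2 w0) (K.s02.pent subset_rfl k2 t2 w2)

theorem Cfg.case210 (K : Cfg col M u c0 c1 c2) (k0 : (N col u c0).card = 6)
    (k1 : (N col u c1).card = 5) (k2 : (N col u c2).card = 5)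
    (t0 : tt M (N col u c0) = 2) (t1 : tt M (N col u c1) = 1) (t2 : tt M (N col u c2) = 0)
    (hx : (CX col M u).card ≤ 1) : False := by
  by_cases hB : ∀ T ∈ CX col M u, ∃ p ∈ T, p ∈ N col u c1
  · exact K.s12.L2hit k0 k2 k1 t0 t2 (by omega) hB
  push Not at hB
  obtain ⟨T, hT, hB⟩ := hB
  obtain ⟨⟨a, ha, haA⟩, c, hc, hcC⟩ := K.s12.split hT hB
  have hX : ∀ T' ∈ CX col M u, T' = T := fun T' hT' => Finset.card_le_one.1 hx _ hT' _ hT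
  obtain ⟨m, hm, x, L⟩ := K.six_two subset_rfl k0 t0
  obtain ⟨mb, hmb, y, L'⟩ := K.s01.one_lab subset_rfl k1 t1
  obtain ⟨i, hi, rfl⟩ := L.2.2 a haA
  refine K.core210 k2 t2 L L' (i := i) (W := {x i}) ?_ ?_ ?_ ?_ hcC ?_ (o210_tab m hm mb hmb i hi)
  · intro T' hT'
    rw [hX T' hT']
    exact ⟨_, ha, by simp⟩
  · intro a' ha' h h'
    rw [Finset.mem_singleton] at h'
    exact ((L.1 a' ha').2 i hi (av_ne h)).1 h'
  · intro p hp h'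
    rw [Finset.mem_singleton] at h'
    exact N_disj K.C.h01.symm hp (h' ▸ haA)
  · intro p hp h'
    rw [Finset.mem_singleton] at h'
    exact N_disj K.C.h02.symm hp (h' ▸ haA)
  · intro T' hT'
    rw [hX T' hT']
    exact ⟨_, hc, by simp⟩

theorem Cfg.case310 (K : Cfg col M u c0 c1 c2) (k0 : (N col u c0).card = 6)
    (k1 : (N col u c1).card = 5) (k2 : (N col u c2).card = 5)
    (t0 : tt M (N col u c0) = 3) (t1 : tt M (N col u c1) = 1) (t2 : tt M (N col u c2) = 0)
    (hx : (CX col M u).card = 0) : False := by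
  rw [Finset.card_eq_zero] at hx
  obtain ⟨b, hb, r, hr, x, L⟩ := K.six subset_rfl k0 (by omega)
  have e := lab_tt K.H K.C.h12 (by norm_num) L
  obtain ⟨mb, hmb, y, L'⟩ := K.s01.one_lab subset_rfl k1 t1
  obtain ⟨c, hc⟩ : (N col u c2).Nonempty := by rw [← Finset.card_pos, k2]; norm_num
  have hW : ∀ W, Hit col M u W := fun W T hT => by rw [hx] at hT; simp at hT
  exact K.core210 k2 t2 L L' (i := 6) (W := ∅) (hW _) (by simp) (by simp) (by simp) hc (hW _)
    (o310_tab b hb r hr (by omega) mb hmb)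

theorem Cfg.core300 (K : Cfg col M u c0 c1 c2) (k0 : (N col u c0).card = 6)
    (k1 : (N col u c1).card = 5) (k2 : (N col u c2).card = 5)
    (t0 : tt M (N col u c0) = 3) (t1 : tt M (N col u c1) = 0) (t2 : tt M (N col u c2) = 0)
    {c : V} (hc : c ∈ N col u c2) (hW : Hit col M u {c}) : False := by
  obtain ⟨b, hb, r, hr, x, L⟩ := K.six subset_rfl k0 (by omega)
  have e := lab_tt K.H K.C.h12 (by norm_num) L
  have v0 : ∀ a < 6, x a ∉ ({c} : Finset V) := by
    intro a ha h
    rw [Finset.mem_singleton] at h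
    exact N_disj K.C.h02 (L.2.1 a ha) (h ▸ hc)
  have hy : Has col u c1 c0 c2 5 236 {c} := by
    refine K.s01.pent subset_rfl k1 t1 fun p hp h => ?_
    rw [Finset.mem_singleton] at h
    exact N_disj K.C.h12 hp (h ▸ hc)
  have hz : Has col u c2 c0 c1 4 13 {c} := K.s02.s12.path subset_rfl k2 t2 hc
    fun p hp hpc hpc' => hpc (Finset.mem_singleton.1 hpc')
  rcases o300_tab b hb r hr (by omega) with h | h
  · obtain ⟨p, hp, h⟩ := List.any_eq_true.1 h
    exact K.K1 hW hp (has_emb K.H.sym false (ok := fun _ => true) L.1 h fun a ha _ => v0 a ha) hy hz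
  · exact K.L4 hW (has_emb K.H.sym false (ok := fun _ => true) L.1 h fun a ha _ => v0 a ha) hy hz

theorem Cfg.case300 (K : Cfg col M u c0 c1 c2) (k0 : (N col u c0).card = 6)
    (k1 : (N col u c1).card = 5) (k2 : (N col u c2).card = 5)
    (t0 : tt M (N col u c0) = 3) (t1 : tt M (N col u c1) = 0) (t2 : tt M (N col u c2) = 0)
    (hx : (CX col M u).card ≤ 1) : False := by
  by_cases h : ∃ T ∈ CX col M u, ∀ p ∈ T, p ∉ N col u c2
  · obtain ⟨T, hT, hC⟩ := h
    obtain ⟨-, b, hb, hb'⟩ := K.split hT hC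
    refine K.s12.core300 k0 k2 k1 t0 t2 t1 hb' fun T' hT' => ?_
    rw [Finset.card_le_one.1 hx _ hT' _ hT]
    exact ⟨_, hb, by simp⟩
  · push Not at h
    by_cases h0 : ∃ T, T ∈ CX col M u
    · obtain ⟨T, hT⟩ := h0
      obtain ⟨c, hc, hc'⟩ := h T hT
      refine K.core300 k0 k1 k2 t0 t1 t2 hc' fun T' hT' => ?_
      rw [Finset.card_le_one.1 hx _ hT' _ hT]
      exact ⟨_, hc, by simp⟩
    · obtain ⟨c, hc⟩ : (N col u c2).Nonempty := by rw [← Finset.card_pos, k2]; norm_num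
      exact K.core300 k0 k1 k2 t0 t1 t2 hc fun T' hT' => absurd ⟨T', hT'⟩ h0

theorem Cfg.case400 (K : Cfg col M u c0 c1 c2) (k1 : (N col u c1).card = 5)
    (k2 : (N col u c2).card = 5) (t0 : tt M (N col u c0) ≠ 0) (t1 : tt M (N col u c1) = 0)
    (t2 : tt M (N col u c2) = 0) (hx : (CX col M u).card = 0) : False := by
  rw [Finset.card_eq_zero] at hx
  have hW : Hit col M u ∅ := fun T hT => by rw [hx] at hT; simp at hT
  rw [tt, ← Nat.pos_iff_ne_zero, Finset.card_pos] at t0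
  obtain ⟨T, hT⟩ := t0
  rw [Finset.mem_filter] at hT
  obtain ⟨m, hm, x, L⟩ := lab_exist K.H K.hu K.h3 (by norm_num) hT.2 ((K.H.mem T).1 hT.1).1
  have e := lab_tt K.H K.C.h12 (by norm_num) L
  have e' : tt M T ≠ 0 := by
    rw [tt, ← Nat.pos_iff_ne_zero, Finset.card_pos]
    exact ⟨T, Finset.mem_filter.2 ⟨hT.1, subset_rfl⟩⟩
  have PB := K.s01.pent (W := ∅) subset_rfl k1 t1 (by simp)
  have PC := K.s02.s12.pent (W := ∅) subset_rfl k2 t2 (by simp)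
  rcases mono_tab m hm (by omega) with h | h
  · exact K.K7 hW (has_emb K.H.sym false (ok := fun _ => true) L.1 h (by simp)) PB PC
  · exact K.s12.K7 hW (has_emb K.H.sym true (ok := fun _ => true) L.1 h (by simp)) PC PB

theorem Cfg.case754 (K : Cfg col M u c0 c1 c2) (k0 : (N col u c0).card = 7)
    (k1 : (N col u c1).card = 5) (k2 : (N col u c2).card = 4) : False := by
  have h4 := K.seven subset_rfl k0
  have hc := K.count
  have hM := K.H.card
  have hx : (CX col M u).card = 0 := by omega
  rw [Finset.card_eq_zero] at hx
  have hW : Hit col M u ∅ := fun T hT => by rw [hx] at hT; simp at hT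
  obtain ⟨v, hv, h1⟩ : ∃ v ∈ N col u c0, tt M ((N col u c0).erase v) ≤ 2 := by
    by_contra! hcon
    have := Finset.card_nsmul_le_sum (N col u c0) (fun v => tt M ((N col u c0).erase v)) 3
      (fun v hv => hcon v hv)
    rw [tt_sum K.H, k0, smul_eq_mul] at this
    omega
  have hs : (N col u c0).erase v ⊆ N col u c0 := Finset.erase_subset _ _
  have k6 : ((N col u c0).erase v).card = 6 := by rw [Finset.card_erase_of_mem hv, k0]
  have := K.six_ge hs k6
  refine K.L2 hW hs subset_rfl (subset_refl (N col u c2)) k6 k1 (by omega) (by omega) ?_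
    (by simp) (by simp) (by simp)
  rw [k2]
  simp [Nat.choose]
  omega

/-- The first type of vertices not treated directly. -/
def Bad1 (col : V → V → ℕ) (M : Finset (Finset V)) (u : V) (c0 c1 c2 : ℕ) : Prop :=
  CX col M u = ∅ ∧ M.card = 4 ∧ (N col u c0).card = 6 ∧ (N col u c1).card = 6 ∧
  (N col u c2).card = 4 ∧ tt M (N col u c0) = 2 ∧ tt M (N col u c1) = 2 ∧ tt M (N col u c2) = 0 ∧
  (∀ v ∈ N col u c0, tt M ((N col u c0).erase v) ≠ 0) ∧
  ∀ v ∈ N col u c1, tt M ((N col u c1).erase v) ≠ 0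

/-- The second type of vertices not treated directly. -/
def Bad2 (col : V → V → ℕ) (M : Finset (Finset V)) (u : V) (c0 c1 c2 : ℕ) : Prop :=
  CX col M u = ∅ ∧ M.card = 4 ∧ (N col u c0).card = 6 ∧ (N col u c1).card = 5 ∧
  (N col u c2).card = 5 ∧ tt M (N col u c0) = 2 ∧ tt M (N col u c1) = 1 ∧ tt M (N col u c2) = 1

theorem Cfg.case664 (K : Cfg col M u c0 c1 c2) (k0 : (N col u c0).card = 6)
    (k1 : (N col u c1).card = 6) (k2 : (N col u c2).card = 4) : Bad1 col M u c0 c1 c2 := by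
  have h0 := K.six_ge subset_rfl k0
  have h1 := K.s01.six_ge subset_rfl k1
  have hc := K.count
  have hM := K.H.card
  have hx : CX col M u = ∅ := by
    rw [← Finset.card_eq_zero]; omega
  have hW : Hit col M u ∅ := fun T hT => by rw [hx] at hT; simp at hT
  have t3 : tt M (N col u c2) < (N col u c2).card.choose 3 := by
    rw [k2]
    simp [Nat.choose]
    omega
  refine ⟨hx, by omega, k0, k1, k2, by omega, by omega, by omega, ?_, ?_⟩
  · intro v hv h
    exact K.s01.L2 hW subset_rfl (Finset.erase_subset v _) (subset_refl (N col u c2)) k1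
      (by rw [Finset.card_erase_of_mem hv, k0]) (by omega) h t3 (by simp) (by simp) (by simp)
  · intro v hv h
    exact K.L2 hW subset_rfl (Finset.erase_subset v _) (subset_refl (N col u c2)) k0
      (by rw [Finset.card_erase_of_mem hv, k1]) (by omega) h t3 (by simp) (by simp) (by simp)

theorem Cfg.case655 (K : Cfg col M u c0 c1 c2) (k0 : (N col u c0).card = 6)
    (k1 : (N col u c1).card = 5) (k2 : (N col u c2).card = 5) : Bad2 col M u c0 c1 c2 := by
  have h0 := K.six_ge subset_rfl k0
  have hc := K.count
  have hM := K.H.card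
  by_contra hB
  have hB' : ¬ (tt M (N col u c0) = 2 ∧ tt M (N col u c1) = 1 ∧ tt M (N col u c2) = 1) := by
    rintro ⟨e0, e1, e2⟩
    exact hB ⟨by rw [← Finset.card_eq_zero]; omega, by omega, k0, k1, k2, e0, e1, e2⟩
  have hcases : tt M (N col u c0) = 2 ∨ tt M (N col u c0) = 3 ∨ tt M (N col u c0) = 4 := by omega
  rcases hcases with e0 | e0 | e0
  · have h1 : tt M (N col u c1) = 0 ∨ tt M (N col u c1) = 1 ∨ tt M (N col u c1) = 2 := by omega
    rcases h1 with e1 | e1 | e1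
    · have h2 : tt M (N col u c2) = 0 ∨ tt M (N col u c2) = 1 ∨ tt M (N col u c2) = 2 := by omega
      rcases h2 with e2 | e2 | e2
      · exact K.case200 k0 k1 k2 e0 e1 e2 (by omega)
      · exact K.s12.case210 k0 k2 k1 e0 e2 e1 (by omega)
      · refine K.L2hit k0 k1 k2 e0 e1 (by omega) ?_
        have : CX col M u = ∅ := by rw [← Finset.card_eq_zero]; omega
        rw [this]; simp
    · exact K.case210 k0 k1 k2 e0 e1 (by omega) (by omega)
    · refine K.s12.L2hit k0 k2 k1 e0 (by omega) (by omega) ?_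
      have : CX col M u = ∅ := by rw [← Finset.card_eq_zero]; omega
      rw [this]; simp
  · by_cases e1 : tt M (N col u c1) = 0
    · by_cases e2 : tt M (N col u c2) = 0
      · exact K.case300 k0 k1 k2 e0 e1 e2 (by omega)
      · exact K.s12.case310 k0 k2 k1 e0 (by omega) e1 (by omega)
    · exact K.case310 k0 k1 k2 e0 (by omega) (by omega) (by omega)
  · exact K.case400 k1 k2 (by omega) (by omega) (by omega) (by omega)

theorem Cfg.le_five (K : Cfg col M u c0 c1 c2) (h : tt M (N col u c0) ≤ 1) :
    (N col u c0).card ≤ 5 := by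
  by_contra hc
  obtain ⟨S, hS, hc⟩ := Finset.exists_subset_card_eq (show 6 ≤ (N col u c0).card by omega)
  have := K.six_ge hS hc
  have := tt_mono (M := M) hS
  omega

theorem sizes {x0 x1 x2 t0 t1 t2 : ℕ} (hs : x0 + x1 + x2 = 16) (hc : t0 + t1 + t2 ≤ 4)
    (n0 : x0 ≤ 7) (n1 : x1 ≤ 7) (n2 : x2 ≤ 7) (l0 : t0 ≤ 1 → x0 ≤ 5) (l1 : t1 ≤ 1 → x1 ≤ 5)
    (l2 : t2 ≤ 1 → x2 ≤ 5) (s0 : x0 = 7 → 4 ≤ t0) (s1 : x1 = 7 → 4 ≤ t1) (s2 : x2 = 7 → 4 ≤ t2) :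
    (x0 = 7 ∧ x1 = 5 ∧ x2 = 4) ∨ (x0 = 7 ∧ x1 = 4 ∧ x2 = 5) ∨ (x0 = 5 ∧ x1 = 7 ∧ x2 = 4) ∨
      (x0 = 4 ∧ x1 = 7 ∧ x2 = 5) ∨ (x0 = 5 ∧ x1 = 4 ∧ x2 = 7) ∨ (x0 = 4 ∧ x1 = 5 ∧ x2 = 7) ∨
      (x0 = 6 ∧ x1 = 6 ∧ x2 = 4) ∨ (x0 = 6 ∧ x1 = 4 ∧ x2 = 6) ∨ (x0 = 4 ∧ x1 = 6 ∧ x2 = 6) ∨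
      (x0 = 6 ∧ x1 = 5 ∧ x2 = 5) ∨ (x0 = 5 ∧ x1 = 6 ∧ x2 = 5) ∨ (x0 = 5 ∧ x1 = 5 ∧ x2 = 6) := by
  obtain rfl : x2 = 16 - x0 - x1 := by omega
  interval_cases x0 <;> interval_cases x1 <;> first | (exfalso; omega) | simp

/-- The possible clean vertices. -/
theorem Cfg.bad (K : Cfg col M u c0 c1 c2) : ∃ d0 d1 d2, Cfg col M u d0 d1 d2 ∧
    (Bad1 col M u d0 d1 d2 ∨ Bad2 col M u d0 d1 d2) := by
  have hs := K.cards
  have hc := K.count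
  have hM := K.H.card
  have n0 := K.le_seven
  have n1 := K.s01.le_seven
  have n2 := K.s02.le_seven
  have l0 := K.le_five
  have l1 := K.s01.le_five
  have l2 := K.s02.le_five
  have s0 := K.seven (S := N col u c0) subset_rfl
  have s1 := K.s01.seven (S := N col u c1) subset_rfl
  have s2 := K.s02.seven (S := N col u c2) subset_rfl
  have f0 := K.six_ge (S := N col u c0) subset_rfl
  have f1 := K.s01.six_ge (S := N col u c1) subset_rfl
  have f2 := K.s02.six_ge (S := N col u c2) subset_rfl
  generalize a0 : (N col u c0).card = x0 at *
  generalize a1 : (N col u c1).card = x1 at *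
  generalize a2 : (N col u c2).card = x2 at *
  have key : (x0 = 7 ∧ x1 = 5 ∧ x2 = 4) ∨ (x0 = 7 ∧ x1 = 4 ∧ x2 = 5) ∨ (x0 = 5 ∧ x1 = 7 ∧ x2 = 4) ∨
      (x0 = 4 ∧ x1 = 7 ∧ x2 = 5) ∨ (x0 = 5 ∧ x1 = 4 ∧ x2 = 7) ∨ (x0 = 4 ∧ x1 = 5 ∧ x2 = 7) ∨
      (x0 = 6 ∧ x1 = 6 ∧ x2 = 4) ∨ (x0 = 6 ∧ x1 = 4 ∧ x2 = 6) ∨ (x0 = 4 ∧ x1 = 6 ∧ x2 = 6) ∨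
      (x0 = 6 ∧ x1 = 5 ∧ x2 = 5) ∨ (x0 = 5 ∧ x1 = 6 ∧ x2 = 5) ∨ (x0 = 5 ∧ x1 = 5 ∧ x2 = 6) :=
    sizes hs (by omega) n0 n1 n2 l0 l1 l2 s0 s1 s2
  rcases key with ⟨rfl, rfl, rfl⟩ | ⟨rfl, rfl, rfl⟩ | ⟨rfl, rfl, rfl⟩ | ⟨rfl, rfl, rfl⟩ |
    ⟨rfl, rfl, rfl⟩ | ⟨rfl, rfl, rfl⟩ | ⟨rfl, rfl, rfl⟩ | ⟨rfl, rfl, rfl⟩ | ⟨rfl, rfl, rfl⟩ |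
    ⟨rfl, rfl, rfl⟩ | ⟨rfl, rfl, rfl⟩ | ⟨rfl, rfl, rfl⟩
  · exact (K.case754 a0 a1 a2).elim
  · exact (K.s12.case754 a0 a2 a1).elim
  · exact (K.s01.case754 a1 a0 a2).elim
  · exact (K.s01.s12.case754 a1 a2 a0).elim
  · exact (K.s02.s12.case754 a2 a0 a1).elim
  · exact (K.s02.case754 a2 a1 a0).elim
  · exact ⟨_, _, _, K, Or.inl (K.case664 a0 a1 a2)⟩
  · exact ⟨_, _, _, K.s12, Or.inl (K.s12.case664 a0 a2 a1)⟩
  · exact ⟨_, _, _, K.s01.s12, Or.inl (K.s01.s12.case664 a1 a2 a0)⟩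
  · exact ⟨_, _, _, K, Or.inr (K.case655 a0 a1 a2)⟩
  · exact ⟨_, _, _, K.s01, Or.inr (K.s01.case655 a1 a0 a2)⟩
  · exact ⟨_, _, _, K.s02, Or.inr (K.s02.case655 a2 a1 a0)⟩
end

/-! ### The endgame -/

section
variable {col : V → V → ℕ} {M : Finset (Finset V)}

theorem tt_two {S T T' : Finset V} (h : T ∈ M) (h' : T' ∈ M) (hne : T ≠ T') (hs : T ⊆ S)
    (hs' : T' ⊆ S) : 2 ≤ tt M S := by
  rw [← Finset.card_pair hne]
  apply Finset.card_le_card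
  intro X hX
  simp only [Finset.mem_insert, Finset.mem_singleton] at hX
  rcases hX with rfl | rfl <;> simp [*]

theorem tt_three {S T T' T'' : Finset V} (h : T ∈ M) (h' : T' ∈ M) (h'' : T'' ∈ M) (h1 : T ≠ T')
    (h2 : T ≠ T'') (h3 : T' ≠ T'') (hs : T ⊆ S) (hs' : T' ⊆ S) (hs'' : T'' ⊆ S) : 3 ≤ tt M S := by
  rw [← Finset.card_eq_three.2 ⟨T, T', T'', h1, h2, h3, rfl⟩]
  apply Finset.card_le_card
  intro X hX
  simp only [Finset.mem_insert, Finset.mem_singleton] at hX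
  rcases hX with rfl | rfl | rfl <;> simp [*]

/-- The clean vertices. -/
def Qf (M : Finset (Finset V)) : Finset V := Finset.univ \ M.biUnion id

theorem mem_Qf {u : V} : u ∈ Qf M ↔ Cl M u := by
  simp [Qf, Cl]

theorem Hy.ne (H : Hy col M) {T : Finset V} (hT : T ∈ M) : ∃ p, p ∈ T := by
  have h3 := ((H.mem T).1 hT).1
  exact Finset.card_pos.1 (by omega)

/-- Two clean vertices seeing a triangle in the same colour. -/
theorem cl_two (H : Hy col M) {u v : V} {c : ℕ} {T : Finset V} (hT : T ∈ M) (hu : Cl M u)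
    (huv : u ≠ v) (h1 : T ⊆ N col u c) (h2 : T ⊆ N col v c) : col u v ≠ c := by
  intro h
  obtain ⟨p, hp⟩ := H.ne hT
  have a := mem_N.1 (h1 hp)
  have b := mem_N.1 (h2 hp)
  exact hu _ (mem3 H huv a.1.symm b.1.symm (by rw [h, a.2]) (by rw [h, b.2])) (by simp)

theorem in_N' {u : V} (hx : CX col M u = ∅) (hu : Cl M u) {T : Finset V} (hT : T ∈ M) {p : V}
    (hp : p ∈ T) : T ⊆ N col u (col u p) := by
  intro q hq
  rw [mem_N]
  refine ⟨fun h => hu T hT (h ▸ hq), ?_⟩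
  by_contra h
  have : T ∈ CX col M u := mem_CX.2 ⟨hT, q, hq, p, hp, h⟩
  rw [hx] at this
  simp at this

theorem Bad1.cx {u : V} {d0 d1 d2 : ℕ} (h : Bad1 col M u d0 d1 d2) : CX col M u = ∅ := h.1
theorem Bad2.cx {u : V} {d0 d1 d2 : ℕ} (h : Bad2 col M u d0 d1 d2) : CX col M u = ∅ := h.1

theorem clean (H : Hy col M) (C : Ctx col 0 1 2) {u : V} (hu : Cl M u) :
    CX col M u = ∅ ∧ M.card = 4 := by
  obtain ⟨d0, d1, d2, -, h | h⟩ := Cfg.bad ⟨H, hu, C⟩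
  · exact ⟨h.1, h.2.1⟩
  · exact ⟨h.1, h.2.1⟩

theorem col_ne (H : Hy col M) {u : V} {c : ℕ} {T : Finset V} (hT : T ∈ M) (hu : Cl M u)
    (h1 : T ⊆ N col u c) {t : ℕ} (ht : ∀ x ∈ T, ∀ y ∈ T, x ≠ y → col x y = t) : c ≠ t := by
  have h3 := ((H.mem T).1 hT).1
  obtain ⟨p, hp, q, hq, hpq⟩ := Finset.one_lt_card.1 (show 1 < T.card by omega)
  rw [← ht p hp q hq hpq]
  exact (cl_col H hu (h1 hp) (h1 hq) hpq).symm

/-- In case two triangles meet, every clean vertex has the second type. -/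
theorem meet_bad (H : Hy col M) {u p : V} {d0 d1 d2 : ℕ} {T1 T2 : Finset V}
    (h1 : T1 ∈ M) (h2 : T2 ∈ M) (hne : T1 ≠ T2) (p1 : p ∈ T1) (p2 : p ∈ T2) (hu : Cl M u)
    (K : Cfg col M u d0 d1 d2) : ¬ Bad1 col M u d0 d1 d2 := by
  rintro ⟨hx, -, -, -, -, e0, e1, e2, f0, f1⟩
  have s1 := in_N' hx hu h1 p1
  have s2 := in_N' hx hu h2 p2
  have key : ∀ S : Finset V, tt M S = 2 → T1 ⊆ S → T2 ⊆ S → tt M (S.erase p) ≠ 0 → False := by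
    intro S hS a1 a2 hn
    rw [tt, Finset.card_ne_zero] at hn
    obtain ⟨T, hT⟩ := hn
    rw [Finset.mem_filter] at hT
    have n1 : T ≠ T1 := by
      rintro rfl
      exact Finset.notMem_erase p S (hT.2 p1)
    have n2 : T ≠ T2 := by
      rintro rfl
      exact Finset.notMem_erase p S (hT.2 p2)
    have := tt_three hT.1 h1 h2 n1 n2 hne (hT.2.trans (Finset.erase_subset _ _)) a1 a2
    omega
  rcases K.h3 _ (K.H.lt u p) with h | h | h
  · rw [h] at s1 s2
    exact key _ e0 s1 s2 (f0 p (s1 p1))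
  · rw [h] at s1 s2
    exact key _ e1 s1 s2 (f1 p (s1 p1))
  · rw [h] at s1 s2
    have := tt_two h1 h2 hne s1 s2
    omega

theorem pairs_card {t : ℕ} (ht : t < 3) :
    ((Finset.range 3 ×ˢ Finset.range 3).filter fun p : ℕ × ℕ => p.1 ≠ t ∧ p.1 ≠ p.2).card = 4 := by
  interval_cases t <;> decide

theorem four_of (hM : M.card = 4) {T1 T2 : Finset V} (h1 : T1 ∈ M) (h2 : T2 ∈ M) (hne : T1 ≠ T2) :
    ∃ T3 T4, T3 ≠ T4 ∧ M = {T1, T2, T3, T4} ∧ T1 ≠ T3 ∧ T1 ≠ T4 ∧ T2 ≠ T3 ∧ T2 ≠ T4 := by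
  have hc : ((M.erase T1).erase T2).card = 2 := by
    rw [Finset.card_erase_of_mem (Finset.mem_erase.2 ⟨hne.symm, h2⟩), Finset.card_erase_of_mem h1, hM]
  obtain ⟨T3, T4, h34, e⟩ := Finset.card_eq_two.1 hc
  have m3 : T3 ∈ (M.erase T1).erase T2 := by simp [e]
  have m4 : T4 ∈ (M.erase T1).erase T2 := by simp [e]
  simp only [Finset.mem_erase] at m3 m4
  refine ⟨T3, T4, h34, ?_, m3.2.1.symm, m4.2.1.symm, m3.1.symm, m4.1.symm⟩
  rw [← e, Finset.insert_erase (Finset.mem_erase.2 ⟨hne.symm, h2⟩), Finset.insert_erase h1]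

theorem no_meet (H : Hy col M) (C : Ctx col 0 1 2) (hM : M.card = 4) {p : V} {T1 T2 : Finset V}
    (h1 : T1 ∈ M) (h2 : T2 ∈ M) (hne : T1 ≠ T2) (p1 : p ∈ T1) (p2 : p ∈ T2) : False := by
  obtain ⟨T3, T4, h34, e, n13, n14, n23, n24⟩ := four_of hM h1 h2 hne
  have h3 : T3 ∈ M := by simp [e]
  have h4 : T4 ∈ M := by simp [e]
  obtain ⟨p3, hp3⟩ := H.ne h3
  obtain ⟨p4, hp4⟩ := H.ne h4
  obtain ⟨k1, t, ht⟩ := (H.mem T1).1 h1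
  have k2 := ((H.mem T2).1 h2).1
  have k3 := ((H.mem T3).1 h3).1
  have k4 := ((H.mem T4).1 h4).1
  have t3 : t < 3 := by
    obtain ⟨p, hp, q, hq, hpq⟩ := Finset.one_lt_card.1 (show 1 < T1.card by omega)
    rw [← ht p hp q hq hpq]
    exact H.lt _ _
  have hQ : 6 ≤ (Qf M).card := by
    have a : (T1 ∪ T2).card ≤ 5 := by
      have := Finset.card_union_add_card_inter T1 T2
      have : 0 < (T1 ∩ T2).card := Finset.card_pos.2 ⟨p, Finset.mem_inter.2 ⟨p1, p2⟩⟩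
      omega
    have b : M.biUnion id ⊆ (T1 ∪ T2) ∪ (T3 ∪ T4) := by
      intro x hx
      rw [e] at hx
      simp at hx ⊢
      tauto
    have := Finset.card_le_card b
    have := Finset.card_union_le (T1 ∪ T2) (T3 ∪ T4)
    have := Finset.card_union_le T3 T4
    have := Finset.le_card_sdiff (M.biUnion id) (Finset.univ : Finset V)
    have e17 : (Finset.univ : Finset V).card = 17 := by simp
    rw [Qf]
    omega
  have key : ∀ u, Cl M u → T1 ⊆ N col u (col u p) ∧ T3 ⊆ N col u (col u p3) ∧
      T4 ⊆ N col u (col u p4) ∧ col u p ≠ col u p3 ∧ col u p ≠ col u p4 ∧ col u p3 ≠ col u p4 := by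
    intro u hu
    obtain ⟨d0, d1, d2, K, hB | hB⟩ := Cfg.bad ⟨H, hu, C⟩
    · exact (meet_bad H h1 h2 hne p1 p2 hu K hB).elim
    · have s1 := in_N' hB.cx hu h1 p1
      have s2 := in_N' hB.cx hu h2 p2
      have s3 := in_N' hB.cx hu h3 hp3
      have s4 := in_N' hB.cx hu h4 hp4
      obtain ⟨-, -, -, -, -, e0, e1, e2⟩ := hB
      have g : ∀ c < 3, tt M (N col u c) ≤ 2 ∧ (2 ≤ tt M (N col u c) → c = d0) := by
        intro c hc
        rcases K.h3 c hc with rfl | rfl | rfl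
        · exact ⟨by omega, fun _ => rfl⟩
        · exact ⟨by omega, by omega⟩
        · exact ⟨by omega, by omega⟩
      have ga := g _ (H.lt u p)
      have gb := g _ (H.lt u p3)
      have q := ga.2 (tt_two h1 h2 hne s1 s2)
      have a1 : col u p ≠ col u p3 := by
        intro h
        rw [← h] at s3
        have := tt_three h1 h2 h3 hne n13 n23 s1 s2 s3
        omega
      have a2 : col u p ≠ col u p4 := by
        intro h
        rw [← h] at s4
        have := tt_three h1 h2 h4 hne n14 n24 s1 s2 s4
        omega
      refine ⟨s1, s3, s4, a1, a2, ?_⟩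
      intro h
      rw [← h] at s4
      exact a1 (q.trans (gb.2 (tt_two h3 h4 h34 s3 s4)).symm)
  obtain ⟨u, hu, v, hv, huv, huv'⟩ := Finset.exists_ne_map_eq_of_card_lt_of_maps_to
    (s := Qf M) (t := (Finset.range 3 ×ˢ Finset.range 3).filter fun p : ℕ × ℕ => p.1 ≠ t ∧ p.1 ≠ p.2)
    (by rw [pairs_card t3]; omega) (f := fun u => (col u p, col u p3)) (by
      intro u hu
      have hu : Cl M u := mem_Qf.1 hu
      obtain ⟨s1, s3, s4, a1, a2, a3⟩ := key u hu
      simp only [Finset.coe_filter, Finset.mem_product, Finset.mem_range, Set.mem_ofPred_eq]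
      exact ⟨⟨H.lt _ _, H.lt _ _⟩, col_ne H h1 hu s1 ht, a1⟩)
  rw [mem_Qf] at hu hv
  obtain ⟨s1, s3, s4, a1, a2, a3⟩ := key u hu
  obtain ⟨s1', s3', s4', a1', a2', a3'⟩ := key v hv
  simp only [Prod.mk.injEq] at huv'
  have e4 : col u p4 = col v p4 := by
    have := H.lt u p
    have := H.lt u p3
    have := H.lt u p4
    have := H.lt v p4
    omega
  rw [← huv'.1] at s1'
  rw [← huv'.2] at s3'
  rw [← e4] at s4'
  have c1 := cl_two H h1 hu huv s1 s1'
  have c3 := cl_two H h3 hu huv s3 s3'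
  have c4 := cl_two H h4 hu huv s4 s4'
  have := H.lt u p
  have := H.lt u p3
  have := H.lt u p4
  have := H.lt u v
  omega

end

section
variable {col : V → V → ℕ} {M : Finset (Finset V)}

/-- The number of the four values equal to `k`. -/
def cn (k a b c d : ℕ) : ℕ :=
  (if a = k then 1 else 0) + (if b = k then 1 else 0) + (if c = k then 1 else 0) +
    (if d = k then 1 else 0)

/-- All colours occur an even number of times. -/
def Ev (a b c d : ℕ) : Prop := ∀ k < 3, cn k a b c d % 2 = 0

/-- The colour `r` does not occur, and the others occur twice. -/
def Tw (r a b c d : ℕ) : Prop := ∀ k < 3, cn k a b c d = if k = r then 0 else 2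

instance (a b c d : ℕ) : Decidable (Ev a b c d) := by unfold Ev; infer_instance
instance (r a b c d : ℕ) : Decidable (Tw r a b c d) := by unfold Tw; infer_instance

/-- The last step of the following enumeration. -/
def Last (a01 a02 a03 a04 a12 a13 a14 a23 a24 : ℕ) : Prop :=
    ∀ a34 < 3, ¬ (a03 = a04 ∧ a03 = a34) → ¬ (a12 = a13 ∧ a12 = a23) → ¬ (a12 = a14 ∧ a12 = a24) →
    ¬ (a13 = a14 ∧ a13 = a34) → ¬ (a23 = a24 ∧ a23 = a34) →
    Ev a03 a13 a23 a34 → Ev a04 a14 a24 a34 →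
    ∃ r < 3, Tw r a01 a02 a03 a04 ∧ Tw r a01 a12 a13 a14 ∧ Tw r a02 a12 a23 a24 ∧
      Tw r a03 a13 a23 a34 ∧ Tw r a04 a14 a24 a34

set_option synthInstance.maxSize 20000 in
set_option synthInstance.maxHeartbeats 400000 in
instance (a01 a02 a03 a04 a12 a13 a14 a23 a24 : ℕ) :
    Decidable (Last a01 a02 a03 a04 a12 a13 a14 a23 a24) := by unfold Last; infer_instance

/-- The middle step of the following enumeration. -/
def Mid (a01 a02 a03 a04 a12 a13 a14 : ℕ) : Prop :=
    ∀ a23 < 3, ¬ (a02 = a03 ∧ a02 = a23) → ∀ a24 < 3, ¬ (a02 = a04 ∧ a02 = a24) →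
    Ev a02 a12 a23 a24 → Last a01 a02 a03 a04 a12 a13 a14 a23 a24

set_option synthInstance.maxSize 20000 in
set_option synthInstance.maxHeartbeats 400000 in
instance (a01 a02 a03 a04 a12 a13 a14 : ℕ) :
    Decidable (Mid a01 a02 a03 a04 a12 a13 a14) := by unfold Mid; infer_instance

/-- The second step of the following enumeration. -/
def Snd (a01 a02 a03 a04 : ℕ) : Prop :=
    ∀ a12 < 3, ¬ (a01 = a02 ∧ a01 = a12) →
    ∀ a13 < 3, ¬ (a01 = a03 ∧ a01 = a13) → ∀ a14 < 3, ¬ (a01 = a04 ∧ a01 = a14) →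
    Ev a01 a12 a13 a14 → Mid a01 a02 a03 a04 a12 a13 a14

set_option synthInstance.maxSize 20000 in
set_option synthInstance.maxHeartbeats 400000 in
instance (a01 a02 a03 a04 : ℕ) : Decidable (Snd a01 a02 a03 a04) := by unfold Snd; infer_instance

set_option synthInstance.maxSize 20000 in
set_option synthInstance.maxHeartbeats 400000 in
/-- A colouring of `K_5` without monochromatic triangles and with all degrees even. -/
theorem k5_tab : ∀ a01 < 3, ∀ a02 < 3, ∀ a03 < 3, ∀ a04 < 3,
    Ev a01 a02 a03 a04 → Snd a01 a02 a03 a04 := by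
  decide +kernel

theorem five_of {Q : Finset V} (hQ : Q.card = 5) : ∃ v0 v1 v2 v3 v4 : V, Q = {v0, v1, v2, v3, v4} ∧
    [v0, v1, v2, v3, v4].Nodup := by
  have h : Q.toList.length = 5 := by simp [hQ]
  have hn := Q.nodup_toList
  have hm : ∀ x, x ∈ Q ↔ x ∈ Q.toList := by simp
  generalize Q.toList = l at h hn hm
  match l, h with
  | [v0, v1, v2, v3, v4], _ =>
    refine ⟨v0, v1, v2, v3, v4, ?_, hn⟩
    ext x
    simp [hm]

/-- The number of clean neighbours. -/
theorem clean_deg (H : Hy col M) (hd : ∀ T1 ∈ M, ∀ T2 ∈ M, T1 ≠ T2 → Disjoint T1 T2) {u : V}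
    (hu : Cl M u) (hx : CX col M u = ∅) (c : ℕ) :
    ((Qf M).filter (· ∈ N col u c)).card + 3 * tt M (N col u c) = (N col u c).card := by
  have hb : ((M.filter (· ⊆ N col u c)).biUnion id).card = 3 * tt M (N col u c) := by
    rw [Finset.card_biUnion]
    · rw [Finset.sum_congr rfl (g := fun _ => 3)]
      · rw [Finset.sum_const, smul_eq_mul, mul_comm, tt]
      · intro T hT
        exact ((H.mem T).1 (Finset.mem_filter.1 hT).1).1
    · intro T1 h1 T2 h2 hne
      exact hd _ (Finset.mem_filter.1 h1).1 _ (Finset.mem_filter.1 h2).1 hne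
  rw [← hb, ← Finset.card_union_of_disjoint]
  · congr 1
    ext p
    simp only [Finset.mem_union, Finset.mem_filter, Finset.mem_biUnion, id]
    constructor
    · rintro (h | ⟨T, ⟨-, h⟩, hp⟩)
      · exact h.2
      · exact h hp
    · intro hp
      by_cases hq : p ∈ Qf M
      · exact Or.inl ⟨hq, hp⟩
      · rw [mem_Qf, Cl] at hq
        push Not at hq
        obtain ⟨T, hT, hpT⟩ := hq
        have := in_N' hx hu hT hpT
        rw [(mem_N.1 hp).2] at this
        exact Or.inr ⟨T, ⟨hT, this⟩, hpT⟩
  · rw [Finset.disjoint_left]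
    intro p hp hp'
    simp only [Finset.mem_filter, Finset.mem_biUnion, id] at hp hp'
    obtain ⟨T, ⟨hT, -⟩, hpT⟩ := hp'
    exact mem_Qf.1 hp.1 T hT hpT

theorem no_mono (H : Hy col M) {u v w : V} (hu : Cl M u) (huv : u ≠ v) (huw : u ≠ w) (hvw : v ≠ w) :
    ¬ (col u v = col u w ∧ col u v = col v w) :=
  fun h => hu _ (mem3 H huv huw hvw h.1 h.2) (by simp)

theorem absent (H : Hy col M) (hQ : (Qf M).card = 5)
    (he : ∀ u, Cl M u → ∀ c < 3, ((Qf M).filter (· ∈ N col u c)).card % 2 = 0) :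
    ∃ r < 3, ∀ u, Cl M u → ∀ c < 3,
      ((Qf M).filter (· ∈ N col u c)).card = if c = r then 0 else 2 := by
  obtain ⟨v0, v1, v2, v3, v4, e, hn⟩ := five_of hQ
  have hq : ∀ u, Cl M u ↔ u = v0 ∨ u = v1 ∨ u = v2 ∨ u = v3 ∨ u = v4 := by
    intro u
    rw [← mem_Qf, e]
    simp
  simp only [List.nodup_cons, List.mem_cons, List.not_mem_nil, or_false, not_or, not_false_eq_true,
    List.nodup_nil, and_true] at hn
  obtain ⟨⟨n01, n02, n03, n04⟩, ⟨n12, n13, n14⟩, ⟨n23, n24⟩, n34⟩ := hn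
  have g : ∀ u c, ((Qf M).filter (· ∈ N col u c)).card =
      (if v0 ∈ N col u c then 1 else 0) + ((if v1 ∈ N col u c then 1 else 0) +
      ((if v2 ∈ N col u c then 1 else 0) + ((if v3 ∈ N col u c then 1 else 0) +
      (if v4 ∈ N col u c then 1 else 0)))) := by
    intro u c
    rw [Finset.card_filter, e, Finset.sum_insert (by simp [*]), Finset.sum_insert (by simp [*]),
      Finset.sum_insert (by simp [*]), Finset.sum_insert (by simp [*]), Finset.sum_singleton]
  have s := H.sym
  have g0 : ∀ c, ((Qf M).filter (· ∈ N col v0 c)).card =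
      cn c (col v0 v1) (col v0 v2) (col v0 v3) (col v0 v4) := by
    intro c
    rw [g]; simp only [mem_N, cn]
    simp [Ne.symm n01, Ne.symm n02, Ne.symm n03, Ne.symm n04, add_assoc]
  have g1 : ∀ c, ((Qf M).filter (· ∈ N col v1 c)).card =
      cn c (col v0 v1) (col v1 v2) (col v1 v3) (col v1 v4) := by
    intro c
    rw [g]; simp only [mem_N, cn, s v0 v1]
    simp [n01, Ne.symm n12, Ne.symm n13, Ne.symm n14, add_assoc]
  have g2 : ∀ c, ((Qf M).filter (· ∈ N col v2 c)).card =
      cn c (col v0 v2) (col v1 v2) (col v2 v3) (col v2 v4) := by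
    intro c
    rw [g]; simp only [mem_N, cn, s v0 v2, s v1 v2]
    simp [n02, n12, Ne.symm n23, Ne.symm n24, add_assoc]
  have g3 : ∀ c, ((Qf M).filter (· ∈ N col v3 c)).card =
      cn c (col v0 v3) (col v1 v3) (col v2 v3) (col v3 v4) := by
    intro c
    rw [g]; simp only [mem_N, cn, s v0 v3, s v1 v3, s v2 v3]
    simp [n03, n13, n23, Ne.symm n34, add_assoc]
  have g4 : ∀ c, ((Qf M).filter (· ∈ N col v4 c)).card =
      cn c (col v0 v4) (col v1 v4) (col v2 v4) (col v3 v4) := by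
    intro c
    rw [g]; simp only [mem_N, cn, s v0 v4, s v1 v4, s v2 v4, s v3 v4]
    simp [n04, n14, n24, n34, add_assoc]
  have c0 : Cl M v0 := by simp [hq]
  have c1 : Cl M v1 := by simp [hq]
  have c2 : Cl M v2 := by simp [hq]
  have c3 : Cl M v3 := by simp [hq]
  have c4 : Cl M v4 := by simp [hq]
  obtain ⟨r, hr, hh⟩ := k5_tab _ (H.lt v0 v1) _ (H.lt v0 v2) _ (H.lt v0 v3) _ (H.lt v0 v4)
    (fun k hk => by rw [← g0]; exact he _ c0 k hk)
    _ (H.lt v1 v2) (no_mono H c0 n01 n02 n12) _ (H.lt v1 v3) (no_mono H c0 n01 n03 n13)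
    _ (H.lt v1 v4) (no_mono H c0 n01 n04 n14) (fun k hk => by rw [← g1]; exact he _ c1 k hk)
    _ (H.lt v2 v3) (no_mono H c0 n02 n03 n23) _ (H.lt v2 v4) (no_mono H c0 n02 n04 n24)
    (fun k hk => by rw [← g2]; exact he _ c2 k hk)
    _ (H.lt v3 v4) (no_mono H c0 n03 n04 n34) (no_mono H c1 n12 n13 n23)
    (no_mono H c1 n12 n14 n24) (no_mono H c1 n13 n14 n34) (no_mono H c2 n23 n24 n34)
    (fun k hk => by rw [← g3]; exact he _ c3 k hk) (fun k hk => by rw [← g4]; exact he _ c4 k hk)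
  refine ⟨r, hr, fun u hu c hc => ?_⟩
  obtain ⟨h0, h1, h2, h3, h4⟩ := hh
  rcases (hq u).1 hu with rfl | rfl | rfl | rfl | rfl
  · rw [g0, h0 c hc]
  · rw [g1, h1 c hc]
  · rw [g2, h2 c hc]
  · rw [g3, h3 c hc]
  · rw [g4, h4 c hc]

theorem disj_end (H : Hy col M) (C : Ctx col 0 1 2) (hM : M.card = 4)
    (hd : ∀ T1 ∈ M, ∀ T2 ∈ M, T1 ≠ T2 → Disjoint T1 T2) : False := by
  have hQ : (Qf M).card = 5 := by
    have hb : (M.biUnion id).card = 12 := by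
      rw [Finset.card_biUnion (t := id) (fun T1 h1 T2 h2 h => hd T1 h1 T2 h2 h),
        Finset.sum_congr rfl (f := fun T => (id T).card) (g := fun _ => 3)
          (fun T hT => ((H.mem T).1 hT).1)]
      simp [hM]
    rw [Qf, Finset.card_sdiff_of_subset (Finset.subset_univ _), hb]
    simp
  have D : ∀ u, Cl M u → ∀ c, _ := fun u hu c => clean_deg H hd hu (clean H C hu).1 c
  obtain ⟨r, hr, ha⟩ := absent H hQ (by
    intro u hu c hc
    have := D u hu
    obtain ⟨d0, d1, d2, K, hB | hB⟩ := Cfg.bad ⟨H, hu, C⟩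
    · obtain ⟨-, -, k0, k1, k2, e0, e1, e2, -⟩ := hB
      rcases K.h3 c hc with rfl | rfl | rfl
      · have := D u hu c; omega
      · have := D u hu c; omega
      · have := D u hu c; omega
    · obtain ⟨-, -, k0, k1, k2, e0, e1, e2⟩ := hB
      rcases K.h3 c hc with rfl | rfl | rfl
      · have := D u hu c; omega
      · have := D u hu c; omega
      · have := D u hu c; omega)
  -- every other colour is used for exactly one triangle
  have one : ∀ u, Cl M u → ∀ c < 3, c ≠ r → tt M (N col u c) = 1 := by
    intro u hu c hc hcr
    have hac := ha u hu c hc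
    rw [if_neg hcr] at hac
    have hD := D u hu c
    have hl := tt_mono (M := M) (subset_rfl : N col u c ⊆ N col u c)
    obtain ⟨d0, d1, d2, K, hB | hB⟩ := Cfg.bad ⟨H, hu, C⟩
    · obtain ⟨-, -, k0, k1, k2, e0, e1, e2, -⟩ := hB
      rcases K.h3 c hc with rfl | rfl | rfl <;> omega
    · obtain ⟨-, -, k0, k1, k2, e0, e1, e2⟩ := hB
      rcases K.h3 c hc with rfl | rfl | rfl <;> omega
  have nr : ∀ u, Cl M u → ∀ v, Cl M v → u ≠ v → col u v ≠ r := by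
    intro u hu v hv huv h
    have := ha u hu r hr
    rw [if_pos rfl, Finset.card_eq_zero, Finset.filter_eq_empty_iff] at this
    exact this (mem_Qf.2 hv) (mem_N.2 ⟨huv.symm, h⟩)
  have two : ∀ T ∈ M, ∀ c < 3, c ≠ r → ((Qf M).filter (fun u => T ⊆ N col u c)).card ≤ 2 := by
    intro T hT c hc hcr
    by_contra! h
    obtain ⟨u, v, w, hu, hv, hw, huv, huw, hvw⟩ := Finset.two_lt_card_iff.1 h
    rw [Finset.mem_filter, mem_Qf] at hu hv hw
    have a1 := cl_two H hT hu.1 huv hu.2 hv.2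
    have a2 := cl_two H hT hu.1 huw hu.2 hw.2
    have a3 := cl_two H hT hv.1 hvw hv.2 hw.2
    have b1 := nr u hu.1 v hv.1 huv
    have b2 := nr u hu.1 w hw.1 huw
    have b3 := nr v hv.1 w hw.1 hvw
    have l1 := H.lt u v
    have l2 := H.lt u w
    have l3 := H.lt v w
    exact no_mono H hu.1 huv huw hvw ⟨by omega, by omega⟩
  have tot : ∀ c < 3, c ≠ r → ∑ T ∈ M, ((Qf M).filter (fun u => T ⊆ N col u c)).card = 5 := by
    intro c hc hcr
    simp only [Finset.card_filter]
    rw [Finset.sum_comm, Finset.sum_congr rfl (g := fun _ => 1)]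
    · simp [hQ]
    · intro u hu
      rw [← Finset.card_filter]
      exact one u (mem_Qf.1 hu) c hc hcr
  have big : ∀ c < 3, c ≠ r →
      3 ≤ (M.filter fun T => ((Qf M).filter (fun u => T ⊆ N col u c)).card ≠ 0).card := by
    intro c hc hcr
    have := Finset.sum_le_card_nsmul
      (M.filter fun T => ((Qf M).filter (fun u => T ⊆ N col u c)).card ≠ 0)
      (fun T => ((Qf M).filter (fun u => T ⊆ N col u c)).card) 2
      (fun T hT => two T (Finset.mem_filter.1 hT).1 c hc hcr)
    rw [Finset.sum_filter_ne_zero, tot c hc hcr, smul_eq_mul] at this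
    omega
  obtain ⟨b, g, hb, hg, hbr, hgr, hbg⟩ : ∃ b g, b < 3 ∧ g < 3 ∧ b ≠ r ∧ g ≠ r ∧ b ≠ g := by
    interval_cases r
    · exact ⟨1, 2, by norm_num⟩
    · exact ⟨0, 2, by norm_num⟩
    · exact ⟨0, 1, by norm_num⟩
  have hB := big b hb hbr
  have hG := big g hg hgr
  obtain ⟨T, hT⟩ : ((M.filter fun T => ((Qf M).filter (fun u => T ⊆ N col u b)).card ≠ 0) ∩
      (M.filter fun T => ((Qf M).filter (fun u => T ⊆ N col u g)).card ≠ 0)).Nonempty := by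
    rw [← Finset.card_pos]
    have h1 := Finset.card_union_add_card_inter
      (M.filter fun T => ((Qf M).filter (fun u => T ⊆ N col u b)).card ≠ 0)
      (M.filter fun T => ((Qf M).filter (fun u => T ⊆ N col u g)).card ≠ 0)
    have h2 := Finset.card_le_card (Finset.union_subset
      (Finset.filter_subset (fun T => ((Qf M).filter (fun u => T ⊆ N col u b)).card ≠ 0) M)
      (Finset.filter_subset (fun T => ((Qf M).filter (fun u => T ⊆ N col u g)).card ≠ 0) M))
    omega
  rw [Finset.mem_inter, Finset.mem_filter, Finset.mem_filter, Finset.card_ne_zero,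
    Finset.card_ne_zero] at hT
  obtain ⟨⟨hT, u, hu⟩, -, v, hv⟩ := hT
  rw [Finset.mem_filter, mem_Qf] at hu hv
  obtain ⟨w, hw, hwb, hwg⟩ : ∃ w, Cl M w ∧ ¬ T ⊆ N col w b ∧ ¬ T ⊆ N col w g := by
    by_contra! h
    have hs : Qf M ⊆ (Qf M).filter (fun u => T ⊆ N col u b) ∪
        (Qf M).filter (fun u => T ⊆ N col u g) := by
      intro w hw
      rw [Finset.mem_union, Finset.mem_filter, Finset.mem_filter]
      by_cases hwb : T ⊆ N col w b
      · exact Or.inl ⟨hw, hwb⟩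
      · exact Or.inr ⟨hw, h w (mem_Qf.1 hw) hwb⟩
    have h1 := Finset.card_le_card hs
    have h2 := Finset.card_union_le ((Qf M).filter (fun u => T ⊆ N col u b))
      ((Qf M).filter (fun u => T ⊆ N col u g))
    have h3 := two T hT b hb hbr
    have h4 := two T hT g hg hgr
    omega
  obtain ⟨k3, t, ht⟩ := (H.mem T).1 hT
  have t3 : t < 3 := by
    obtain ⟨p, hp, q, hq, hpq⟩ := Finset.one_lt_card.1 (show 1 < T.card by omega)
    rw [← ht p hp q hq hpq]
    exact H.lt _ _
  obtain ⟨p, hp⟩ := H.ne hT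
  have sw := in_N' (clean H C hw).1 hw hT hp
  have z1 := col_ne H hT hu.1 hu.2 ht
  have z2 := col_ne H hT hv.1 hv.2 ht
  have z3 := col_ne H hT hw sw ht
  have y1 : col w p ≠ b := fun h => hwb (h ▸ sw)
  have y2 : col w p ≠ g := fun h => hwg (h ▸ sw)
  have := H.lt w p
  omega

theorem final (H : Hy col M) (C : Ctx col 0 1 2) : False := by
  have hb : (M.biUnion id).card ≤ M.card * 3 :=
    Finset.card_biUnion_le_card_mul _ _ _ fun T hT => ((H.mem T).1 hT).1.le
  have hc := H.card
  have : (Qf M).Nonempty := by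
    rw [← Finset.card_pos]
    have := Finset.le_card_sdiff (M.biUnion id) (Finset.univ : Finset V)
    have e17 : (Finset.univ : Finset V).card = 17 := by simp
    rw [Qf]
    omega
  obtain ⟨u, hu⟩ := this
  have hM := (clean H C (mem_Qf.1 hu)).2
  refine disj_end H C hM fun T1 h1 T2 h2 hne => ?_
  rw [Finset.disjoint_left]
  exact fun p p1 p2 => no_meet H C hM h1 h2 hne p1 p2

end

theorem main (c : Fin 17 → Fin 17 → Fin 3) (hs : ∀ x y, c x y = c y x) :
    5 ≤ {s : Finset (Fin 17) | ∃ x y z, x ≠ y ∧ y ≠ z ∧ x ≠ z ∧ s = {x, y, z} ∧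
      c x y = c y z ∧ c y z = c x z}.ncard := by
  by_contra h
  classical
  set A := {s : Finset (Fin 17) | ∃ x y z, x ≠ y ∧ y ≠ z ∧ x ≠ z ∧ s = {x, y, z} ∧
      c x y = c y z ∧ c y z = c x z} with hA
  have H : Hy (fun x y => (c x y).val) (Set.toFinite A).toFinset := by
    refine ⟨fun a b => by rw [hs a b], fun a b => (c a b).isLt, fun T => ?_, ?_⟩
    · rw [Set.Finite.mem_toFinset]
      constructor
      · rintro ⟨x, y, z, hxy, hyz, hxz, rfl, e1, e2⟩
        refine ⟨Finset.card_eq_three.2 ⟨x, y, z, hxy, hxz, hyz, rfl⟩, (c x y).val, ?_⟩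
        intro a ha b hb hab
        simp only [Finset.mem_insert, Finset.mem_singleton] at ha hb
        rcases ha with rfl | rfl | rfl <;> rcases hb with rfl | rfl | rfl <;> grind
      · rintro ⟨h3, k, hk⟩
        obtain ⟨x, y, z, hxy, hxz, hyz, rfl⟩ := Finset.card_eq_three.1 h3
        have a1 := hk x (by simp) y (by simp) hxy
        have a2 := hk y (by simp) z (by simp) hyz
        have a3 := hk x (by simp) z (by simp) hxz
        exact ⟨x, y, z, hxy, hyz, hxz, rfl, Fin.ext (a1.trans a2.symm), Fin.ext (a2.trans a3.symm)⟩
    · rw [← Set.ncard_eq_toFinset_card A]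
      omega
  exact final H ⟨H.sym, H.lt, by norm_num, by norm_num, by norm_num, by norm_num, by norm_num,
    by norm_num⟩

end

end K17

theorem five_le_mono_triangles_K17 :
    ∀ c : Fin 17 → Fin 17 → Fin 3,
      (∀ x y, c x y = c y x) →
      5 ≤ {s : Finset (Fin 17) | ∃ x y z : Fin 17, x ≠ y ∧ y ≠ z ∧ x ≠ z ∧
        s = {x, y, z} ∧ c x y = c y z ∧ c y z = c x z}.ncard := by
  exact K17.main
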